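/- Let d ≥ 2. There exist constants c > 0 and C > 0 such that, almost surely, for all n large enough, A_{b_n} ⊆ B[n(1 + C n^{−c})], where A_{b_n} is the uIDLA aggregate with b_n particles started from {0}. -/

import Mathlib

open MeasureTheory Filter
open scoped ENNReal

noncomputable section

/-- The `k`-th binary digit of `x ∈ [0,1)` (after the binary point). -/
def bit (x : ℝ) (k : ℕ) : Bool := ⌊x * 2 ^ (k + 1)⌋ % 2 == 1

/-- From one uniform sample on `[0,1]`, extract countably many independent uniform
samples on `[0,1]`, using disjoint subsequences of binary digits. -/
def uSlice (x : ℝ) (i : ℕ) : ℝ :=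
  ∑' j : ℕ, if bit x (Nat.pair i j) then ((2 : ℝ) ^ (-(j : ℤ) - 1)) else 0

/-- The base probability space: Lebesgue measure restricted to `[0,1]`. -/
def μ0 : Measure ℝ := volume.restrict (Set.Icc 0 1)

/-- The vertex set of the lattice `ℤ^d`. -/
abbrev V (d : ℕ) := Fin d → ℤ

instance (d : ℕ) : MeasurableSpace (Finset (V d)) := ⊤

open Classical in
/-- `B[r]`: the Euclidean ball of radius `r` in `ℤ^d`, as a `Finset`. -/
def ball (d : ℕ) (r : ℝ) : Finset (V d) :=
  (Finset.Icc (fun _ => -⌈r⌉) (fun _ => ⌈r⌉)).filter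
    (fun y => Real.sqrt (∑ i, ((y i : ℝ)) ^ 2) ≤ r)

/-- `b_n`: the number of lattice points in the Euclidean ball of radius `n`. -/
def bn (d n : ℕ) : ℕ := (ball d n).card

/-- The `2d` unit vectors of `ℤ^d` (the possible steps of the simple random walk). -/
def unitVecs (d : ℕ) : Finset (V d) :=
  Finset.image
    (fun p : Fin d × Bool => fun j => if j = p.1 then (if p.2 then 1 else -1) else 0)
    Finset.univ

/-- Given `u` uniform on `[0,1]`, `pick S u` is a uniformly chosen element of `S`. -/
def pick {d : ℕ} (S : Finset (V d)) (u : ℝ) : V d :=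
  if h : S.Nonempty then
    (S.equivFin.symm ⟨(⌊u * S.card⌋).toNat % S.card,
      Nat.mod_lt _ (Finset.card_pos.mpr h)⟩).val
  else 0

/-- Position at time `t` of the simple random walk started at `x`, driven by the
random seed `ω`: the steps `pick (unitVecs d) (uSlice ω i)` are i.i.d. uniform on
the `2d` unit vectors when `ω` is uniform on `[0,1]`. -/
def walk {d : ℕ} (x : V d) (ω : ℝ) (t : ℕ) : V d :=
  x + ∑ i ∈ Finset.range t, pick (unitVecs d) (uSlice ω i)

/-- `t_S`: the first time the walk started at `x` is outside `S`. -/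
def exitT {d : ℕ} (S : Finset (V d)) (x : V d) (ω : ℝ) : ℕ :=
  sInf {t | walk x ω t ∉ S}

/-- The position `ξ(t_S)` at which the walk started at `x` first exits `S`. -/
def hitPt {d : ℕ} (S : Finset (V d)) (x : V d) (ω : ℝ) : V d :=
  walk x ω (exitT S x ω)

/-- `Add[ξ,S]`: add to `S` the exit point of a random walk started at `x`. -/
def addPt {d : ℕ} (S : Finset (V d)) (x : V d) (ω : ℝ) : Finset (V d) :=
  insert (hitPt S x ω) S

/-- `P_x(ξ(τ_A) = y)`: the probability that the walk started at `x` exits `A` at `y`. -/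
def hitProb {d : ℕ} (A : Finset (V d)) (x y : V d) : ℝ≥0∞ :=
  μ0 {ω | hitPt A x ω = y}

/-- The outer boundary `∂A`: vertices outside `A` with a neighbour in `A`. -/
def outb {d : ℕ} (A : Finset (V d)) : Finset (V d) :=
  (A.biUnion fun x => (unitVecs d).image (fun e => x + e)) \ A

/-- `DA_X(S)`: the IDLA aggregate obtained from `S` by launching one particle from each
point of the list `xs` in turn (driven by independent slices of the seed `ω`). -/
def daFrom {d : ℕ} : Finset (V d) → List (V d) → ℝ → Finset (V d)
  | S, [], _ => S
  | S, x :: xs, ω => daFrom (addPt S x (uSlice ω 0)) xs (uSlice ω 1)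

/-- The law of the IDLA aggregate `DA_X(S)`. -/
def daLaw {d : ℕ} (S : Finset (V d)) (xs : List (V d)) : Measure (Finset (V d)) :=
  μ0.map (fun ω => daFrom S xs ω)

/-- One uIDLA step: launch a particle from a uniformly chosen point of `S`. -/
def uStep {d : ℕ} (S : Finset (V d)) (ω : ℝ) : Finset (V d) :=
  addPt S (pick S (uSlice ω 0)) (uSlice ω 1)

/-- `A_k(S)`: the uIDLA aggregate obtained by adding `k` particles to `S`,
each started at a uniform point of the current aggregate. -/
def uAggFrom {d : ℕ} (S : Finset (V d)) (ω : ℝ) : ℕ → Finset (V d)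
  | 0 => S
  | k + 1 => uStep (uAggFrom S ω k) (uSlice ω k)

/-- The law of the uIDLA aggregate `A_k(S)`. -/
def uLaw {d : ℕ} (S : Finset (V d)) (k : ℕ) : Measure (Finset (V d)) :=
  μ0.map (fun ω => uAggFrom S ω k)

/-- One step of the subset uIDLA `A_·(E;m)`: at step `k`, perform a uIDLA step
with probability `|E|/(m+k)` and otherwise do nothing. -/
def subStep {d : ℕ} (m k : ℕ) (E : Finset (V d)) (ω : ℝ) : Finset (V d) :=
  if uSlice ω 0 * ((m : ℝ) + k) ≤ E.card then uStep E (uSlice ω 1) else E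

/-- The subset uIDLA `A_n(E;m)`. -/
def subAggFrom {d : ℕ} (E : Finset (V d)) (m : ℕ) (ω : ℝ) : ℕ → Finset (V d)
  | 0 => E
  | k + 1 => subStep m k (subAggFrom E m ω k) (uSlice ω k)

/-- The law of the subset uIDLA `A_n(E;m)`. -/
def subLaw {d : ℕ} (E : Finset (V d)) (m k : ℕ) : Measure (Finset (V d)) :=
  μ0.map (fun ω => subAggFrom E m ω k)

/-- Stochastic domination of random finite subsets of `ℤ^d`: `μ` dominates `ν` if
there is a coupling under which the sample of `ν` is a.s. contained in that of `μ`. -/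
def StochDom {d : ℕ} (μ ν : Measure (Finset (V d))) : Prop :=
  ∃ π : Measure (Finset (V d) × Finset (V d)), IsProbabilityMeasure π ∧
    π.map Prod.fst = μ ∧ π.map Prod.snd = ν ∧ π {p | p.2 ⊆ p.1} = 1

/-- A `Geometric(1/2)` sample (taking value `j ≥ 0` with probability `2^{-(j+1)}`)
produced from a uniform sample `u` on `[0,1]` by inverting the CDF. -/
def geom (u : ℝ) : ℕ := sInf {j : ℕ | u ≤ 1 - (2 : ℝ) ^ (-(j : ℤ) - 1)}

/-- The parent of vertex `j ≥ 1` in the uniform random recursive tree (vertex `0` is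
the root): uniform on `{0, …, j-1}` when the seed is uniform on `[0,1]`. -/
def parent (ω : ℝ) (j : ℕ) : ℕ := (⌊uSlice ω (Nat.pair 0 j) * j⌋).toNat % j

/-- The reaching time of vertex `j` in a uniform random recursive tree whose edges
carry i.i.d. `Geometric(1/2)` weights: the sum of the weights on the path from the
root to `j`. (The `min` is a.s. inoperative, since a.s. `parent ω (j+1) ≤ j`.) -/
def reach (ω : ℝ) : ℕ → ℕ
  | 0 => 0
  | j + 1 => reach ω (min (parent ω (j + 1)) j) + geom (uSlice ω (Nat.pair 1 (j + 1)))
termination_by j => j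
decreasing_by exact Nat.lt_succ_of_le (min_le_right _ _)

end

section

namespace UI
open MeasureTheory Filter Set

lemma mu0_Ico : μ0 = volume.restrict (Set.Ico (0:ℝ) 1) := by
  unfold μ0
  exact (Measure.restrict_congr_set Ico_ae_eq_Icc).symm

instance : IsProbabilityMeasure μ0 := ⟨by simp [μ0]⟩

noncomputable def coin : Measure Bool := (2⁻¹ : ENNReal) • (Measure.dirac true + Measure.dirac false)

instance : IsProbabilityMeasure coin := ⟨by
  simp [coin, ← two_mul]
  rw [mul_comm]; exact ENNReal.inv_mul_cancel (by norm_num) (by norm_num)⟩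

lemma bit_meas (k : ℕ) : Measurable (fun x => bit x k) := by
  unfold bit
  have h : Measurable (fun x : ℝ => ⌊x * 2 ^ (k + 1)⌋) := by fun_prop
  have h2 : Measurable (fun m : ℤ => (m % 2 == 1)) := measurable_of_countable _
  exact h2.comp h

lemma mu0_split (E : Set ℝ) (hE : MeasurableSet E) :
    μ0 E = 2⁻¹ * μ0 {y | y / 2 ∈ E} + 2⁻¹ * μ0 {y | (1 + y) / 2 ∈ E} := by
  have m1 : MeasurableSet {y : ℝ | y / 2 ∈ E} := hE.preimage (by fun_prop)
  have m2 : MeasurableSet {y : ℝ | (1 + y) / 2 ∈ E} := hE.preimage (by fun_prop)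
  rw [mu0_Ico, Measure.restrict_apply hE, Measure.restrict_apply m1, Measure.restrict_apply m2]
  have e1 : {y : ℝ | y / 2 ∈ E} ∩ Ico 0 1 = (fun x => (1/2:ℝ) * x) ⁻¹' (E ∩ Ico 0 (1/2)) := by
    ext y; simp only [mem_inter_iff, mem_ofPred_eq, mem_Ico, mem_preimage]
    rw [show y / 2 = 1/2*y by ring]
    constructor
    · rintro ⟨h, h1, h2⟩; exact ⟨h, by linarith, by linarith⟩
    · rintro ⟨h, h1, h2⟩; exact ⟨h, by linarith, by linarith⟩
  have e2 : {y : ℝ | (1 + y) / 2 ∈ E} ∩ Ico 0 1 =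
      (fun x => 1 + x) ⁻¹' ((fun x => (1/2:ℝ) * x) ⁻¹' (E ∩ Ico (1/2) 1)) := by
    ext y; simp only [mem_inter_iff, mem_ofPred_eq, mem_Ico, mem_preimage]
    rw [show (1 + y) / 2 = 1/2*(1+y) by ring]
    constructor
    · rintro ⟨h, h1, h2⟩; exact ⟨h, by linarith, by linarith⟩
    · rintro ⟨h, h1, h2⟩; exact ⟨h, by linarith, by linarith⟩
  rw [e1, e2, measure_preimage_add, Real.volume_preimage_mul_left (by norm_num),
    Real.volume_preimage_mul_left (by norm_num)]
  have : E ∩ Ico (0:ℝ) 1 = (E ∩ Ico 0 (1/2)) ∪ (E ∩ Ico (1/2) 1) := by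
    rw [← inter_union_distrib_left, Ico_union_Ico_eq_Ico (by norm_num) (by norm_num)]
  rw [this, measure_union _ (hE.inter measurableSet_Ico)]
  · have : ENNReal.ofReal |(1/2:ℝ)⁻¹| = 2 := by norm_num
    rw [this, ← mul_assoc, ← mul_assoc, ENNReal.inv_mul_cancel (by norm_num) (by norm_num),
      one_mul, one_mul]
  · refine Disjoint.mono inter_subset_right inter_subset_right ?_
    rw [Ico_disjoint_Ico]; norm_num

lemma bit_half (y : ℝ) (hy : y ∈ Ico (0:ℝ) 1) : bit (y/2) 0 = false := by
  unfold bit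
  have : ⌊y / 2 * 2 ^ (0 + 1)⌋ = 0 := by
    rw [Int.floor_eq_iff]; constructor <;> norm_num <;> linarith [hy.1, hy.2]
  rw [this]; rfl

lemma bit_half' (y : ℝ) (hy : y ∈ Ico (0:ℝ) 1) : bit ((1+y)/2) 0 = true := by
  unfold bit
  have : ⌊(1 + y) / 2 * 2 ^ (0 + 1)⌋ = 1 := by
    rw [Int.floor_eq_iff]; constructor <;> norm_num <;> linarith [hy.1, hy.2]
  rw [this]; rfl

lemma bit_half_succ (y : ℝ) (k : ℕ) : bit (y/2) (k+1) = bit y k := by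
  unfold bit
  rw [show y / 2 * 2 ^ (k + 1 + 1) = y * 2 ^ (k+1) by ring]

lemma bit_half_succ' (y : ℝ) (k : ℕ) : bit ((1+y)/2) (k+1) = bit y k := by
  unfold bit
  rw [show (1 + y) / 2 * 2 ^ (k + 1 + 1) = y * 2 ^ (k+1) + ((2 * 2 ^ k : ℤ) : ℝ) by
    push_cast; ring, Int.floor_add_intCast, Int.add_mul_emod_self_left]

lemma box_range (n : ℕ) (t : ℕ → Set Bool) :
    μ0 {x | ∀ i < n, bit x i ∈ t i} = ∏ i ∈ Finset.range n, coin (t i) := by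
  induction n generalizing t with
  | zero => simp
  | succ n ih =>
    have hm : ∀ (n : ℕ) (t : ℕ → Set Bool), MeasurableSet {x | ∀ i < n, bit x i ∈ t i} := by
      intro n t
      have : {x | ∀ i < n, bit x i ∈ t i} = ⋂ i, ⋂ (_ : i < n), (fun x => bit x i) ⁻¹' (t i) := by
        ext; simp
      rw [this]
      exact MeasurableSet.iInter fun i => MeasurableSet.iInter fun _ =>
        bit_meas i (MeasurableSet.of_discrete)
    rw [mu0_split _ (hm _ _), Finset.prod_range_succ']
    have key : ∀ (b : Bool) (φ : ℝ → ℝ), (∀ y ∈ Ico (0:ℝ) 1, bit (φ y) 0 = b) →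
        (∀ y k, bit (φ y) (k+1) = bit y k) →
        μ0 {y | φ y ∈ {x | ∀ i < n + 1, bit x i ∈ t i}} =
          (t 0).indicator 1 b * ∏ i ∈ Finset.range n, coin (t (i+1)) := by
      intro b φ h0 h1
      rw [← ih]
      have hae : ∀ᵐ y ∂μ0, y ∈ Ico (0:ℝ) 1 := by
        rw [mu0_Ico]; exact ae_restrict_mem measurableSet_Ico
      by_cases hb : b ∈ t 0
      · rw [indicator_of_mem hb, Pi.one_apply, one_mul]
        apply measure_congr
        filter_upwards [hae] with y hy
        apply propext
        show (∀ i < n+1, bit (φ y) i ∈ t i) ↔ (∀ i < n, bit y i ∈ t (i+1))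
        constructor
        · intro h i hi; rw [← h1]; exact h _ (by omega)
        · intro h i hi
          rcases i with _ | i
          · rw [h0 y hy]; exact hb
          · rw [h1]; exact h _ (by omega)
      · rw [indicator_of_notMem hb, zero_mul]
        rw [measure_eq_zero_iff_ae_notMem]
        filter_upwards [hae] with y hy h
        have := h 0 (by omega)
        rw [h0 y hy] at this; exact hb this
    have k1 := key false (fun y => y/2) (fun y hy => bit_half y hy) bit_half_succ
    have k2 := key true (fun y => (1+y)/2) (fun y hy => bit_half' y hy) bit_half_succ'
    rw [k1, k2]
    simp only [coin, Measure.smul_apply, Measure.add_apply, smul_eq_mul]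
    rw [Measure.dirac_apply, Measure.dirac_apply]
    ring

lemma bits_law : μ0.map (fun x k => bit x k) = Measure.infinitePi (fun _ : ℕ => coin) := by
  classical
  refine Measure.eq_infinitePi _ fun s t ht => ?_
  have hmeas : Measurable (fun (x : ℝ) (k : ℕ) => bit x k) := measurable_pi_iff.2 bit_meas
  rw [Measure.map_apply hmeas (.pi s.countable_toSet fun _ _ ↦ ht _)]
  obtain ⟨n, hn⟩ := s.exists_nat_subset_range
  have := box_range n (fun i => if i ∈ s then t i else univ)
  rw [← Finset.prod_subset hn] at this
  · convert this using 1
    · congr 1; ext x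
      simp only [mem_preimage, Set.mem_pi, Finset.mem_coe, mem_ofPred_eq]
      constructor
      · intro h i hi
        by_cases his : i ∈ s
        · simpa [his] using h i his
        · simp [his]
      · intro h i his
        simpa [his] using h i (by simpa using hn his)
    · exact Finset.prod_congr rfl fun i hi => by simp [hi]
  · intro i _ hi; rw [if_neg hi]; exact measure_univ

noncomputable def PhiB (b : ℕ → Bool) : ℝ := ∑' j : ℕ, if b j then ((2 : ℝ) ^ (-(j : ℤ) - 1)) else 0

lemma PhiB_eq (b : ℕ → Bool) : PhiB b = Real.ofDigits (b := 2) (fun j => if b j then 1 else 0) := by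
  unfold PhiB Real.ofDigits Real.ofDigitsTerm
  congr 1; ext j
  split_ifs with hj
  · rw [show (-(j:ℤ) - 1) = -((j+1 : ℕ) : ℤ) by push_cast; ring, zpow_neg, zpow_natCast]
    simp [hj]
  · simp [hj]

lemma PhiB_meas : Measurable PhiB := by
  have h : PhiB = (Real.ofDigits (b := 2)) ∘ (fun (b : ℕ → Bool) j => if b j then 1 else 0) := by
    funext b; exact PhiB_eq b
  rw [h]
  refine Real.continuous_ofDigits.measurable.comp ?_
  refine measurable_pi_iff.2 fun j => ?_
  have : Measurable (fun c : Bool => (if c then (1 : Fin 2) else 0)) := measurable_of_countable _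
  exact this.comp (measurable_pi_apply j)

lemma PhiB_bits (x : ℝ) (hx : x ∈ Ico (0:ℝ) 1) : PhiB (fun k => bit x k) = x := by
  rw [PhiB_eq]
  conv_rhs => rw [← Real.ofDigits_digits (b := 2) (by norm_num) hx]
  congr 1; ext j
  unfold bit Real.digits
  have hpos : (0:ℝ) ≤ x * 2 ^ (j+1) := by have := hx.1; positivity
  have : ⌊x * 2 ^ (j+1)⌋ = (⌊x * 2 ^ (j+1)⌋₊ : ℤ) := (Int.natCast_floor_eq_floor hpos).symm
  rw [this]
  push_cast
  set m := ⌊x * 2 ^ (j+1)⌋₊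
  rcases Nat.mod_two_eq_zero_or_one m with h | h
  · have h' : (m : ℤ) % 2 = 0 := by omega
    simp [h', Fin.ofNat, h]
  · have h' : (m : ℤ) % 2 = 1 := by omega
    simp [h', Fin.ofNat, h]

lemma PhiB_law : (Measure.infinitePi (fun _ : ℕ => coin)).map PhiB = μ0 := by
  rw [← bits_law, Measure.map_map PhiB_meas (measurable_pi_iff.2 bit_meas)]
  have : (PhiB ∘ fun x k => bit x k) =ᵐ[μ0] id := by
    have hae : ∀ᵐ y ∂μ0, y ∈ Ico (0:ℝ) 1 := by
      rw [mu0_Ico]; exact ae_restrict_mem measurableSet_Ico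
    filter_upwards [hae] with y hy
    exact PhiB_bits y hy
  rw [Measure.map_congr this, Measure.map_id]

lemma uSlice_eq (x : ℝ) (i : ℕ) : uSlice x i = PhiB (fun j => bit x (Nat.pair i j)) := rfl

lemma uSlice_meas (i : ℕ) : Measurable (fun x => uSlice x i) := by
  simp only [uSlice_eq]
  exact PhiB_meas.comp (measurable_pi_iff.2 fun j => bit_meas _)

/-- the slices are i.i.d. uniform -/
lemma slices_law : μ0.map (fun x i => uSlice x i) = Measure.infinitePi (fun _ : ℕ => μ0) := by
  have h1 : (Measure.infinitePi (fun _ : ℕ => coin)).map (fun b (p : ℕ × ℕ) => b (Nat.pair p.1 p.2))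
      = Measure.infinitePi (fun _ : ℕ × ℕ => coin) := by
    have : Function.Injective (fun p : ℕ × ℕ => Nat.pair p.1 p.2) := Nat.pairEquiv.injective
    exact Measure.map_infinitePi_infinitePi_of_inj (P := fun _ : ℕ => coin) this
  have h2 := Measure.infinitePi_map_curry (X := Bool) (fun (_ _ : ℕ) => coin)
  have h3 := Measure.infinitePi_map_pi (fun _ : ℕ => Measure.infinitePi (fun _ : ℕ => coin))
    (f := fun _ => PhiB) (fun _ => PhiB_meas)
  simp only [PhiB_law] at h3
  rw [← h3, ← h2, ← h1, ← bits_law, Measure.map_map, Measure.map_map, Measure.map_map]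
  · rfl
  all_goals first
    | exact measurable_pi_iff.2 bit_meas
    | exact MeasurableEquiv.measurable _
    | exact (measurable_pi_iff.2 fun i => PhiB_meas.comp (measurable_pi_apply i))
    | exact (measurable_pi_iff.2 fun i => PhiB_meas.comp (measurable_pi_apply i)).comp
        (MeasurableEquiv.measurable _)
    | exact measurable_pi_iff.2 fun p => measurable_pi_apply _
    | exact ((measurable_pi_iff.2 fun i => PhiB_meas.comp (measurable_pi_apply i)).comp
        (MeasurableEquiv.measurable _)).comp (measurable_pi_iff.2 fun p => measurable_pi_apply _)

end UI

end

section
open MeasureTheory Filter Set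
namespace UI

/-- sum of `F` over the `2d` neighbours -/
noncomputable def nb {d : ℕ} (F : V d → ℝ) (x : V d) : ℝ :=
  ∑ i, (F (x + Pi.single i 1) + F (x - Pi.single i 1))

lemma max_principle {d : ℕ} (hd : 0 < d) (S : Finset (V d)) (D : V d → ℝ)
    (h1 : ∀ x ∈ S, 2 * (d:ℝ) * D x ≤ nb D x) (h2 : ∀ x, x ∉ S → D x ≤ 0) : ∀ x, D x ≤ 0 := by
  by_contra hcon
  push Not at hcon
  obtain ⟨x0, hx0⟩ := hcon
  have hx0S : x0 ∈ S := by
    by_contra h; exact absurd (h2 x0 h) (not_le.mpr hx0)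
  obtain ⟨x1, hx1S, hx1⟩ := S.exists_max_image D ⟨x0, hx0S⟩
  have hm : 0 < D x1 := lt_of_lt_of_le hx0 (hx1 _ hx0S)
  have hall : ∀ y, D y ≤ D x1 := by
    intro y
    by_cases hy : y ∈ S
    · exact hx1 y hy
    · exact (h2 y hy).trans hm.le
  let i0 : Fin d := ⟨0, hd⟩
  let T := S.filter (fun x => D x = D x1)
  obtain ⟨x2, hx2T, hx2⟩ := T.exists_max_image (fun x => x i0) ⟨x1, by simp [T, hx1S]⟩
  simp only [T, Finset.mem_filter] at hx2T hx2
  have h3 := h1 x2 hx2T.1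
  have h4 : D (x2 + Pi.single i0 1) = D x1 := by
    by_contra hne
    have hlt : D (x2 + Pi.single i0 1) < D x1 := lt_of_le_of_ne (hall _) hne
    have : nb D x2 < ∑ i : Fin d, (D x1 + D x1) := by
      apply Finset.sum_lt_sum
      · intro i _; exact add_le_add (hall _) (hall _)
      · exact ⟨i0, Finset.mem_univ _, add_lt_add_of_lt_of_le hlt (hall _)⟩
    simp at this
    rw [hx2T.2] at h3
    nlinarith
  have h5 : x2 + Pi.single i0 1 ∈ S := by
    by_contra h
    have := h2 _ h
    rw [h4] at this; linarith
  have := hx2 _ ⟨h5, h4⟩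
  simp at this

lemma integral_finite_range {Ω α : Type*} [MeasurableSpace Ω] (μ : Measure Ω) [IsProbabilityMeasure μ]
    (Y : Ω → α) (S : Finset α) (hY : ∀ x ∈ S, MeasurableSet {w | Y w = x})
    (hS : ∀ᵐ w ∂μ, Y w ∈ S) (H : α → ℝ) :
    ∫ w, H (Y w) ∂μ = ∑ x ∈ S, μ.real {w | Y w = x} * H x := by
  classical
  have : ∫ w, H (Y w) ∂μ = ∫ w, ∑ x ∈ S, ({w | Y w = x}.indicator (fun _ => H x) w) ∂μ := by
    apply integral_congr_ae
    filter_upwards [hS] with w hw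
    simp [indicator, hw]
  rw [this, integral_finsetSum]
  · apply Finset.sum_congr rfl
    intro x hx
    rw [integral_indicator (hY x hx)]
    simp
  · intro x hx
    exact (integrable_const _).indicator (hY x hx)

lemma pick_mem {d : ℕ} (S : Finset (V d)) (hS : S.Nonempty) (u : ℝ) : pick S u ∈ S := by
  unfold pick; rw [dif_pos hS]; exact Subtype.coe_prop _

lemma pick_meas {d : ℕ} (S : Finset (V d)) : Measurable (fun u => pick S u) := by
  unfold pick
  by_cases h : S.Nonempty
  · simp only [dif_pos h]
    have h1 : Measurable (fun u : ℝ => (⌊u * S.card⌋)) := by fun_prop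
    exact (measurable_from_top (f := fun k : ℤ => ((S.equivFin.symm ⟨k.toNat % S.card,
      Nat.mod_lt _ (Finset.card_pos.mpr h)⟩).val : V d))).comp h1
  · simp only [dif_neg h]; exact measurable_const

lemma pick_prob {d : ℕ} (S : Finset (V d)) (x : V d) (hx : x ∈ S) :
    μ0.real {u | pick S u = x} = 1 / S.card := by
  have hS : S.Nonempty := ⟨x, hx⟩
  have hc : 0 < S.card := Finset.card_pos.mpr hS
  have hc' : (0:ℝ) < S.card := by exact_mod_cast hc
  set j := S.equivFin ⟨x, hx⟩ with hj
  have hjl : ((j:ℕ):ℝ) + 1 ≤ S.card := by exact_mod_cast j.2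
  have hset : {u | pick S u = x} ∩ Ico 0 1 = Ico ((j:ℝ) / S.card) (((j:ℝ)+1)/S.card) := by
    ext u
    simp only [mem_inter_iff, mem_ofPred_eq, mem_Ico, div_le_iff₀ hc', lt_div_iff₀ hc']
    unfold pick; rw [dif_pos hS]
    have key : 0 ≤ u → u < 1 → (((S.equivFin.symm ⟨(⌊u * S.card⌋).toNat % S.card,
      Nat.mod_lt _ (Finset.card_pos.mpr hS)⟩).val : V d) = x ↔ ⌊u * S.card⌋ = (j:ℤ)) := by
      intro h0 h1
      have hf0 : 0 ≤ ⌊u * S.card⌋ := Int.floor_nonneg.mpr (by positivity)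
      have hf1 : ⌊u * S.card⌋ < S.card := by
        rw [Int.floor_lt]; push_cast; nlinarith
      have hmod : (⌊u * S.card⌋).toNat % S.card = (⌊u * S.card⌋).toNat := Nat.mod_eq_of_lt (by omega)
      have : (((S.equivFin.symm ⟨(⌊u * S.card⌋).toNat % S.card,
        Nat.mod_lt _ (Finset.card_pos.mpr hS)⟩).val : V d) = x ↔ 
        (⟨(⌊u * S.card⌋).toNat % S.card, Nat.mod_lt _ (Finset.card_pos.mpr hS)⟩ : Fin S.card) = j) := by
        rw [hj, ← Equiv.symm_apply_eq, Subtype.ext_iff]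
      rw [this, Fin.ext_iff]; simp only [hmod]; omega
    constructor
    · rintro ⟨h1, h2, h3⟩
      rw [key h2 h3, Int.floor_eq_iff] at h1
      exact_mod_cast h1
    · rintro ⟨h1, h2⟩
      have h0 : 0 ≤ u := by
        by_contra h; push Not at h
        have : (0:ℝ) ≤ (j:ℕ) := by positivity
        nlinarith
      have h3 : u < 1 := by
        by_contra h; push Not at h
        nlinarith
      refine ⟨?_, h0, h3⟩
      rw [key h0 h3, Int.floor_eq_iff]
      constructor <;> push_cast <;> assumption
  rw [mu0_Ico, measureReal_restrict_apply' measurableSet_Ico, hset, Real.volume_real_Ico]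
  rw [max_eq_left]
  · ring
  · rw [← sub_div]; apply div_nonneg _ hc'.le; linarith

lemma pick_integral {d : ℕ} (S : Finset (V d)) (hS : S.Nonempty) (H : V d → ℝ) :
    ∫ u, H (pick S u) ∂μ0 = (1 / (S.card : ℝ)) * ∑ x ∈ S, H x := by
  rw [integral_finite_range μ0 (pick S) S (fun x _ => pick_meas S (measurableSet_singleton x))
    (Eventually.of_forall (pick_mem S hS)), Finset.mul_sum]
  exact Finset.sum_congr rfl (fun x hx => by rw [pick_prob S x hx])

lemma unit_fun_true {d : ℕ} (i : Fin d) : (fun j => if j = i then (if true then (1:ℤ) else -1) else 0) = Pi.single i 1 := by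
  ext j; simp [Pi.single_apply]

lemma unit_fun_false {d : ℕ} (i : Fin d) : (fun j => if j = i then (if false then (1:ℤ) else -1) else 0) = - Pi.single i 1 := by
  ext j; simp [Pi.single_apply]; split <;> simp

lemma unit_inj {d : ℕ} : Function.Injective 
    (fun p : Fin d × Bool => (fun j => if j = p.1 then (if p.2 then 1 else -1) else 0 : V d)) := by
  rintro ⟨i, a⟩ ⟨j, b⟩ h
  have h1 := congrFun h i
  simp only [if_true] at h1
  by_cases hij : i = j
  · subst hij
    cases a <;> cases b <;> simp_all
  · rw [if_neg hij] at h1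
    cases a <;> simp at h1

lemma unit_sum {d : ℕ} (H : V d → ℝ) : ∑ e ∈ unitVecs d, H e = ∑ i, (H (Pi.single i 1) + H (- Pi.single i 1)) := by
  unfold unitVecs
  rw [Finset.sum_image (fun a _ b _ h => unit_inj h), ← Finset.univ_product_univ, Finset.sum_product]
  apply Finset.sum_congr rfl
  intro i _
  rw [Fintype.sum_bool, unit_fun_true, unit_fun_false]

lemma unit_card {d : ℕ} : (unitVecs d).card = 2 * d := by
  unfold unitVecs
  rw [Finset.card_image_of_injective _ unit_inj]; simp [mul_comm]

lemma unit_mem {d : ℕ} (e : V d) : e ∈ unitVecs d ↔ ∃ i, e = Pi.single i 1 ∨ e = - Pi.single i 1 := by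
  unfold unitVecs
  constructor
  · intro h
    obtain ⟨⟨i, b⟩, _, rfl⟩ := Finset.mem_image.mp h
    refine ⟨i, ?_⟩
    cases b
    · right; exact unit_fun_false i
    · left; exact unit_fun_true i
  · rintro ⟨i, h | h⟩
    · exact Finset.mem_image.mpr ⟨(i, true), Finset.mem_univ _, by rw [h]; exact unit_fun_true i⟩
    · exact Finset.mem_image.mpr ⟨(i, false), Finset.mem_univ _, by rw [h]; exact unit_fun_false i⟩

lemma unit_nonempty {d : ℕ} (hd : 0 < d) : (unitVecs d).Nonempty := by
  rw [← Finset.card_pos, unit_card]; omega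

lemma step_integral {d : ℕ} (hd : 0 < d) (H : V d → ℝ) (x : V d) :
    ∫ u, H (x + pick (unitVecs d) u) ∂μ0 = (1 / (2 * (d:ℝ))) * nb H x := by
  have := pick_integral (unitVecs d) (unit_nonempty hd) (fun e => H (x + e))
  rw [this, unit_card, unit_sum]
  simp [nb, sub_eq_add_neg]

end UI

end

section
open MeasureTheory Filter Set
namespace UI

/-- the law of an i.i.d. sequence of uniforms -/
noncomputable abbrev PP : Measure (ℕ → ℝ) := Measure.infinitePi (fun _ : ℕ => μ0)

def consS (p : ℝ × (ℕ → ℝ)) : ℕ → ℝ := fun n => Nat.casesOn n p.1 p.2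

lemma consS_meas : Measurable consS := by
  rw [measurable_pi_iff]
  intro n
  cases n with
  | zero => exact measurable_fst
  | succ n => exact (measurable_pi_apply n).comp measurable_snd

lemma cons_law : (μ0.prod PP).map consS = PP := by
  classical
  refine Measure.eq_infinitePi _ fun s t ht => ?_
  rw [Measure.map_apply consS_meas (.pi s.countable_toSet fun _ _ ↦ ht _)]
  obtain ⟨n, hn⟩ := s.exists_nat_subset_range
  set T : ℕ → Set ℝ := fun i => if i ∈ s then t i else univ with hT
  have hTm : ∀ i, MeasurableSet (T i) := by
    intro i; simp only [hT]; split_ifs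
    · exact ht i
    · exact MeasurableSet.univ
  have h1 : consS ⁻¹' (Set.pi s t) = (T 0) ×ˢ (Set.pi (Finset.range n) (fun i => T (i+1))) := by
    ext ⟨u, us⟩
    simp only [mem_preimage, Set.mem_pi, Finset.mem_coe, mem_prod, Finset.mem_range]
    constructor
    · intro h
      refine ⟨?_, ?_⟩
      · by_cases h0 : 0 ∈ s
        · simpa [hT, h0, consS] using h 0 h0
        · simp [hT, h0]
      · intro i _
        by_cases h0 : i+1 ∈ s
        · simpa [hT, h0, consS] using h (i+1) h0
        · simp [hT, h0]
    · rintro ⟨h0, h1⟩ i hi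
      cases i with
      | zero => simpa [hT, hi, consS] using h0
      | succ i => simpa [hT, hi, consS] using h1 i (by have := Finset.mem_range.mp (hn hi); omega)
  rw [h1, Measure.prod_prod, Measure.infinitePi_pi _ (fun i _ => hTm (i+1)), mul_comm,
    ← Finset.prod_range_succ' (fun i => μ0 (T i)) n]
  have h2 : s ⊆ Finset.range (n+1) := hn.trans (Finset.range_subset_range.mpr (by omega))
  rw [← Finset.prod_subset h2]
  · exact Finset.prod_congr rfl fun i hi => by simp [hT, hi]
  · intro i _ hi; simp [hT, hi]

lemma cons_integral (G : (ℕ → ℝ) → ℝ) (hG : Measurable G) (C : ℝ) (hC : ∀ us, |G us| ≤ C) :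
    ∫ us, G us ∂PP = ∫ u, ∫ us, G (consS (u, us)) ∂PP ∂μ0 := by
  conv_lhs => rw [← cons_law]
  rw [integral_map consS_meas.aemeasurable hG.aestronglyMeasurable, integral_prod]
  exact Integrable.of_bound (hG.comp consS_meas).aestronglyMeasurable C
    (Eventually.of_forall (fun p => hC _))

noncomputable def walkS {d : ℕ} (x : V d) (us : ℕ → ℝ) (t : ℕ) : V d :=
  x + ∑ i ∈ Finset.range t, pick (unitVecs d) (us i)
noncomputable def exitS {d : ℕ} (S : Finset (V d)) (x : V d) (us : ℕ → ℝ) : ℕ :=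
  sInf {t | walkS x us t ∉ S}
noncomputable def hitS {d : ℕ} (S : Finset (V d)) (x : V d) (us : ℕ → ℝ) : V d :=
  walkS x us (exitS S x us)

lemma hitPt_eq {d : ℕ} (S : Finset (V d)) (x : V d) (ω : ℝ) :
    hitPt S x ω = hitS S x (fun i => uSlice ω i) := rfl

lemma walkS_cons {d : ℕ} (x : V d) (u : ℝ) (us : ℕ → ℝ) (t : ℕ) :
    walkS x (consS (u, us)) (t+1) = walkS (x + pick (unitVecs d) u) us t := by
  unfold walkS
  rw [Finset.sum_range_succ', add_comm _ (pick (unitVecs d) _), ← add_assoc]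
  rfl

lemma walkS_meas {d : ℕ} (x : V d) (t : ℕ) : Measurable (fun us => walkS x us t) := by
  unfold walkS
  apply Measurable.const_add
  apply Finset.measurable_sum
  intro i _
  exact (pick_meas _).comp (measurable_pi_apply i)

lemma exitS_meas {d : ℕ} (S : Finset (V d)) (x : V d) : Measurable (fun us => exitS S x us) := by
  classical
  have hm : ∀ t, MeasurableSet {us | walkS x us t ∉ S} := fun t =>
    (walkS_meas x t) (S.finite_toSet.measurableSet.compl)
  apply measurable_to_countable'
  intro n
  rcases Nat.eq_zero_or_pos n with rfl | hn
  · have : (fun us => exitS S x us) ⁻¹' {0} = {us | walkS x us 0 ∉ S} ∪ ⋂ t, {us | walkS x us t ∉ S}ᶜ := by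
      ext us
      simp only [mem_preimage, mem_singleton_iff, exitS, Nat.sInf_eq_zero, mem_ofPred_eq, mem_union,
        mem_iInter, mem_compl_iff]
      refine or_congr Iff.rfl ?_
      rw [eq_empty_iff_forall_notMem]; rfl
    rw [this]
    exact (hm 0).union (MeasurableSet.iInter fun t => (hm t).compl)
  · have : (fun us => exitS S x us) ⁻¹' {n} = {us | walkS x us n ∉ S} ∩ ⋂ t ∈ Finset.range n, {us | walkS x us t ∉ S}ᶜ := by
      ext us
      simp only [mem_preimage, mem_singleton_iff, exitS, mem_inter_iff, 
        mem_iInter, mem_compl_iff, Finset.mem_range]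
      constructor
      · intro h
        have hne : {t | walkS x us t ∉ S}.Nonempty := Nat.nonempty_of_pos_sInf (by omega)
        refine ⟨h ▸ Nat.sInf_mem hne, fun t ht hc => ?_⟩
        exact Nat.notMem_of_lt_sInf (h ▸ ht) hc
      · rintro ⟨h1, h2⟩
        apply le_antisymm (Nat.sInf_le h1)
        by_contra hlt; push Not at hlt
        exact h2 _ hlt (Nat.sInf_mem (s := {t | walkS x us t ∉ S}) ⟨n, h1⟩)
    rw [this]
    exact (hm n).inter (Finset.measurableSet_biInter _ fun t _ => (hm t).compl)

lemma hitS_meas {d : ℕ} (S : Finset (V d)) (x : V d) : Measurable (fun us => hitS S x us) := by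
  apply measurable_to_countable'
  intro y
  have : (fun us => hitS S x us) ⁻¹' {y} = ⋃ n, ({us | exitS S x us = n} ∩ {us | walkS x us n = y}) := by
    ext us; simp [hitS]
  rw [this]
  exact MeasurableSet.iUnion fun n => ((exitS_meas S x) (measurableSet_singleton n)).inter
    ((walkS_meas x n) (measurableSet_singleton y))

lemma hitS_off {d : ℕ} (S : Finset (V d)) (x : V d) (hx : x ∉ S) (us : ℕ → ℝ) : hitS S x us = x := by
  have : exitS S x us = 0 := by
    unfold exitS
    rw [Nat.sInf_eq_zero]; left; simp [walkS, hx]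
  rw [hitS, this]; simp [walkS]

def stays {d : ℕ} (S : Finset (V d)) (x : V d) : Set (ℕ → ℝ) := {us | ∀ t, walkS x us t ∈ S}

lemma stays_meas {d : ℕ} (S : Finset (V d)) (x : V d) : MeasurableSet (stays S x) := by
  have : stays S x = ⋂ t, {us | walkS x us t ∈ S} := by ext us; simp [stays]
  rw [this]
  exact MeasurableSet.iInter fun t => (walkS_meas x t) (S.finite_toSet.measurableSet)

lemma stays_cons {d : ℕ} (S : Finset (V d)) (x : V d) (hx : x ∈ S) (u us) :
    consS (u, us) ∈ stays S x ↔ us ∈ stays S (x + pick (unitVecs d) u) := by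
  constructor
  · intro h t
    have := h (t+1)
    rwa [walkS_cons] at this
  · intro h t
    cases t with
    | zero => simpa [walkS] using hx
    | succ t => rw [walkS_cons]; exact h t

lemma stays_zero {d : ℕ} (hd : 0 < d) (S : Finset (V d)) (x : V d) : PP (stays S x) = 0 := by
  have key : ∀ x, PP.real (stays S x) ≤ 0 := by
    apply max_principle hd S
    · intro x hx
      have h1 : PP.real (stays S x) = ∫ us, (stays S x).indicator (fun _ => (1:ℝ)) us ∂PP := by
        rw [integral_indicator (stays_meas S x)]; simp
      rw [cons_integral _ (measurable_const.indicator (stays_meas S x)) 1] at h1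
      · have h2 : ∀ u, ∫ us, (stays S x).indicator (fun _ => (1:ℝ)) (consS (u,us)) ∂PP =
            PP.real (stays S (x + pick (unitVecs d) u)) := by
          intro u
          have : PP.real (stays S (x + pick (unitVecs d) u)) = 
            ∫ us, (stays S (x + pick (unitVecs d) u)).indicator (fun _ => (1:ℝ)) us ∂PP := by
            rw [integral_indicator (stays_meas S _)]; simp
          rw [this]
          congr 1; ext us
          have := stays_cons S x hx u us
          by_cases hh : us ∈ stays S (x + pick (unitVecs d) u)
          · simp [hh, this.mpr hh]
          · simp [hh, mt this.mp hh]
        simp_rw [h2] at h1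
        rw [step_integral hd (fun y => PP.real (stays S y))] at h1
        rw [h1]
        have : (0:ℝ) < d := by exact_mod_cast hd
        field_simp; rfl
      · intro us; simp only [indicator]; split_ifs <;> simp
    · intro x hx
      have : stays S x = ∅ := by
        ext us; simp only [stays, mem_ofPred_eq, mem_empty_iff_false, iff_false, not_forall]
        exact ⟨0, by simpa [walkS] using hx⟩
      simp [this]
  have := le_antisymm (key x) measureReal_nonneg
  rwa [measureReal_eq_zero_iff] at this

lemma hitS_cons {d : ℕ} (S : Finset (V d)) (x : V d) (hx : x ∈ S) (u us)
    (hs : us ∉ stays S (x + pick (unitVecs d) u)) :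
    hitS S x (consS (u, us)) = hitS S (x + pick (unitVecs d) u) us := by
  simp only [stays, mem_ofPred_eq, not_forall] at hs
  have hne : {t | walkS (x + pick (unitVecs d) u) us t ∉ S}.Nonempty := hs
  have h1 : exitS S x (consS (u,us)) = exitS S (x + pick (unitVecs d) u) us + 1 := by
    unfold exitS
    apply le_antisymm
    · apply Nat.sInf_le
      simp only [mem_ofPred_eq]
      rw [walkS_cons]
      exact Nat.sInf_mem hne
    · have hne2 : {t | walkS x (consS (u,us)) t ∉ S}.Nonempty := by
        obtain ⟨t, ht⟩ := hne
        exact ⟨t+1, by simp only [mem_ofPred_eq]; rw [walkS_cons]; exact ht⟩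
      have hm := Nat.sInf_mem hne2
      set s := sInf {t | walkS x (consS (u,us)) t ∉ S} with hs
      cases hc : s with
      | zero => rw [hc] at hm; exact absurd hx (by simpa [walkS] using hm)
      | succ s' =>
        rw [hc] at hm
        simp only [mem_ofPred_eq] at hm
        rw [walkS_cons] at hm
        exact Nat.succ_le_succ (Nat.sInf_le hm)
  rw [hitS, h1, walkS_cons]; rfl

lemma hitS_outb {d : ℕ} (hd : 0 < d) (S : Finset (V d)) (x : V d) (hx : x ∈ S) (us) (hs : us ∉ stays S x) :
    hitS S x us ∈ outb S := by
  simp only [stays, mem_ofPred_eq, not_forall] at hs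
  have hne : {t | walkS x us t ∉ S}.Nonempty := hs
  have hm := Nat.sInf_mem hne
  unfold outb
  rw [Finset.mem_sdiff]
  refine ⟨?_, hm⟩
  unfold hitS exitS
  cases hc : sInf {t | walkS x us t ∉ S} with
  | zero => rw [hc] at hm; exact absurd hx (by simpa [walkS] using hm)
  | succ t =>
    have ht : walkS x us t ∈ S := by
      by_contra h
      exact Nat.notMem_of_lt_sInf (s := {t | walkS x us t ∉ S}) (by omega) h
    rw [Finset.mem_biUnion]
    refine ⟨_, ht, Finset.mem_image.mpr ⟨pick (unitVecs d) (us t), pick_mem _ (unit_nonempty hd) _, ?_⟩⟩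
    simp [walkS, Finset.sum_range_succ, add_assoc]

lemma hitS_ae {d : ℕ} (hd : 0 < d) (S : Finset (V d)) (x : V d) (hx : x ∈ S) :
    ∀ᵐ us ∂PP, hitS S x us ∈ outb S := by
  have : ∀ᵐ us ∂PP, us ∉ stays S x := by
    rw [ae_iff]; simp [stays_zero hd]
  filter_upwards [this] with us h using hitS_outb hd S x hx us h

lemma outb_unit {d : ℕ} (S : Finset (V d)) (x e : V d) (hx : x ∈ S) (he : e ∈ unitVecs d) :
    x + e ∈ S ∨ x + e ∈ outb S := by
  by_cases h : x + e ∈ S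
  · left; exact h
  · right; unfold outb; rw [Finset.mem_sdiff]
    exact ⟨Finset.mem_biUnion.mpr ⟨x, hx, Finset.mem_image.mpr ⟨e, he, rfl⟩⟩, h⟩

lemma exit_super {d : ℕ} (hd : 0 < d) (S : Finset (V d)) (F : V d → ℝ)
    (hF : ∀ x ∈ S, nb F x ≤ 2 * (d:ℝ) * F x) (x : V d) (hx : x ∈ S) :
    ∑ y ∈ outb S, PP.real {us | hitS S x us = y} * F y ≤ F x := by
  classical
  let G : V d → ℝ := fun y => if y ∈ S ∪ outb S then F y else 0
  have hGb : ∃ C, ∀ y, |G y| ≤ C := by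
    refine ⟨∑ y ∈ S ∪ outb S, |F y|, fun y => ?_⟩
    by_cases h : y ∈ S ∪ outb S
    · simp only [G, if_pos h]
      exact Finset.single_le_sum (f := fun y => |F y|) (fun _ _ => abs_nonneg _) h
    · simp only [G, if_neg h, abs_zero]
      exact Finset.sum_nonneg (fun _ _ => abs_nonneg _)
  obtain ⟨C, hC⟩ := hGb
  have hGS : ∀ x ∈ S, G x = F x := fun x hx => by simp [G, hx]
  have hGo : ∀ x ∈ outb S, G x = F x := fun x hx => by simp [G, hx]
  have hGn : ∀ x ∈ S, nb G x = nb F x := by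
    intro x hx
    unfold nb
    apply Finset.sum_congr rfl
    intro i _
    have a1 := outb_unit S x (Pi.single i 1) hx ((unit_mem _).mpr ⟨i, Or.inl rfl⟩)
    have a2 := outb_unit S x (-Pi.single i 1) hx ((unit_mem _).mpr ⟨i, Or.inr rfl⟩)
    rw [← sub_eq_add_neg] at a2
    have b1 : G (x + Pi.single i 1) = F (x + Pi.single i 1) := by
      rcases a1 with h | h
      · exact hGS _ h
      · exact hGo _ h
    have b2 : G (x - Pi.single i 1) = F (x - Pi.single i 1) := by
      rcases a2 with h | h
      · exact hGS _ h
      · exact hGo _ h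
    rw [b1, b2]
  have hGm : Measurable G := measurable_of_countable G
  let h : V d → ℝ := fun x => ∫ us, G (hitS S x us) ∂PP
  have hharm : ∀ x ∈ S, nb h x = 2 * (d:ℝ) * h x := by
    intro x hx
    have h1 : h x = ∫ u, ∫ us, G (hitS S x (consS (u,us))) ∂PP ∂μ0 :=
      cons_integral (fun us => G (hitS S x us)) (hGm.comp (hitS_meas S x)) C (fun us => hC _)
    have h2 : ∀ u, ∫ us, G (hitS S x (consS (u,us))) ∂PP = h (x + pick (unitVecs d) u) := by
      intro u
      apply integral_congr_ae
      have : ∀ᵐ us ∂PP, us ∉ stays S (x + pick (unitVecs d) u) := by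
        rw [ae_iff]; simp [stays_zero hd]
      filter_upwards [this] with us hus
      rw [hitS_cons S x hx u us hus]
    simp_rw [h2] at h1
    rw [step_integral hd h] at h1
    rw [h1]
    have : (0:ℝ) < d := by exact_mod_cast hd
    field_simp
  have hoff : ∀ x, x ∉ S → h x = G x := by
    intro x hx
    simp only [h, hitS_off S x hx]; simp
  have key := max_principle hd S (fun x => h x - G x) (by
    intro x hx
    have e1 : nb (fun x => h x - G x) x = nb h x - nb G x := by
      unfold nb; rw [← Finset.sum_sub_distrib]; apply Finset.sum_congr rfl; intro i _; ring
    rw [e1, hharm x hx, hGn x hx]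
    have := hF x hx
    rw [← hGS x hx] at this
    linarith) (by intro x hx; simp [hoff x hx]) x
  have e2 : h x = ∑ y ∈ outb S, PP.real {us | hitS S x us = y} * G y :=
    integral_finite_range PP (hitS S x) (outb S)
      (fun y _ => (hitS_meas S x) (measurableSet_singleton y)) (hitS_ae hd S x hx) G
  rw [Finset.sum_congr rfl (fun y hy => by rw [hGo y hy])] at e2
  rw [← e2, ← hGS x hx]; simpa using key

end UI

end

section
open MeasureTheory Filter Set ProbabilityTheory
namespace UI

lemma slice_law (i : ℕ) : μ0.map (fun x => uSlice x i) = μ0 := by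
  have h := congrArg (fun m => m.map (fun f : ℕ → ℝ => f i)) slices_law
  rw [Measure.infinitePi_map_eval, Measure.map_map (measurable_pi_apply i)
    (measurable_pi_iff.2 uSlice_meas)] at h
  exact h

lemma slice_indep : iIndepFun (fun i x => uSlice x i) μ0 := by
  rw [iIndepFun_iff_map_fun_eq_infinitePi_map (fun i => uSlice_meas i)]
  simp_rw [slice_law]
  exact slices_law

lemma slice_pre (i : ℕ) (E : Set ℝ) (hE : MeasurableSet E) : μ0.real {x | uSlice x i ∈ E} = μ0.real E := by
  conv_rhs => rw [← slice_law i]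
  rw [map_measureReal_apply (uSlice_meas i) hE]; rfl

lemma hitPt_meas {d : ℕ} (S : Finset (V d)) (x : V d) : Measurable (fun w => hitPt S x w) :=
  (hitS_meas S x).comp (measurable_pi_iff.2 uSlice_meas)

lemma hitPt_prob {d : ℕ} (S : Finset (V d)) (x y : V d) :
    μ0.real {w | hitPt S x w = y} = PP.real {us | hitS S x us = y} := by
  unfold PP
  have h : MeasurableSet {us | hitS S x us = y} := (hitS_meas S x) (measurableSet_singleton y)
  have h2 : Measurable (fun (x : ℝ) (i : ℕ) => uSlice x i) := measurable_pi_iff.2 uSlice_meas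
  rw [← slices_law, map_measureReal_apply h2 h]; rfl

lemma hitPt_ae {d : ℕ} (hd : 0 < d) (S : Finset (V d)) (x : V d) (hx : x ∈ S) :
    ∀ᵐ w ∂μ0, hitPt S x w ∈ outb S := by
  have h := hitS_ae hd S x hx
  rw [PP, ← slices_law] at h
  exact ae_of_ae_map (measurable_pi_iff.2 uSlice_meas).aemeasurable h

lemma hitPt_mem {d : ℕ} (hd : 0 < d) (S : Finset (V d)) (x : V d) (hx : x ∈ S) (w : ℝ) :
    hitPt S x w ∈ S ∪ outb S := by
  classical
  rw [hitPt_eq]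
  by_cases h : (fun i => uSlice w i) ∈ stays S x
  · exact Finset.mem_union_left _ (h _)
  · exact Finset.mem_union_right _ (hitS_outb hd S x hx _ h)

/-- the law of the next particle -/
noncomputable def ker {d : ℕ} (S : Finset (V d)) (y : V d) : ℝ :=
  (1 / (S.card:ℝ)) * ∑ x ∈ S, PP.real {us | hitS S x us = y}

lemma ker_nonneg {d : ℕ} (S : Finset (V d)) (y : V d) : 0 ≤ ker S y := by
  unfold ker
  have : 0 ≤ ∑ x ∈ S, PP.real {us | hitS S x us = y} := Finset.sum_nonneg fun _ _ => measureReal_nonneg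
  positivity

lemma ker_super {d : ℕ} (hd : 0 < d) (S : Finset (V d)) (F : V d → ℝ)
    (hF : ∀ x ∈ S, nb F x ≤ 2 * (d:ℝ) * F x) :
    ∑ y ∈ outb S, ker S y * F y ≤ (1 / (S.card:ℝ)) * ∑ x ∈ S, F x := by
  unfold ker
  calc ∑ y ∈ outb S, (1 / (S.card:ℝ)) * (∑ x ∈ S, PP.real {us | hitS S x us = y}) * F y
      = (1 / (S.card:ℝ)) * ∑ x ∈ S, ∑ y ∈ outb S, PP.real {us | hitS S x us = y} * F y := by
        rw [Finset.sum_comm, Finset.mul_sum]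
        apply Finset.sum_congr rfl; intro y _; rw [mul_assoc, Finset.sum_mul]
    _ ≤ _ := by
        apply mul_le_mul_of_nonneg_left _ (by positivity)
        exact Finset.sum_le_sum fun x hx => exit_super hd S F hF x hx

lemma ker_sub {d : ℕ} (hd : 0 < d) (S : Finset (V d)) (F : V d → ℝ)
    (hF : ∀ x ∈ S, 2 * (d:ℝ) * F x ≤ nb F x) :
    (1 / (S.card:ℝ)) * ∑ x ∈ S, F x ≤ ∑ y ∈ outb S, ker S y * F y := by
  have := ker_super hd S (fun x => - F x) (by
    intro x hx
    have e : nb (fun x => - F x) x = - nb F x := by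
      unfold nb; rw [← Finset.sum_neg_distrib]; apply Finset.sum_congr rfl; intro i _; ring
    rw [e]; linarith [hF x hx])
  simp only [Finset.sum_neg_distrib, mul_neg] at this
  linarith

lemma ker_one {d : ℕ} (hd : 0 < d) (S : Finset (V d)) (hS : S.Nonempty) : ∑ y ∈ outb S, ker S y = 1 := by
  have hc : (S.card:ℝ) ≠ 0 := by exact_mod_cast (Finset.card_pos.mpr hS).ne'
  have hn : ∀ x : V d, nb (fun _ => (1:ℝ)) x = 2 * (d:ℝ) * 1 := by intro x; simp [nb]; ring
  have h1 := ker_super hd S (fun _ => 1) (fun x _ => (hn x).le)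
  have h2 := ker_sub hd S (fun _ => 1) (fun x _ => (hn x).ge)
  simp [hc] at h1 h2
  exact le_antisymm h1 h2

/-- the transition operator -/
noncomputable def Kop {d : ℕ} (f : Finset (V d) → ℝ) (S : Finset (V d)) : ℝ :=
  ∑ y ∈ outb S, ker S y * f (insert y S)

lemma step_prob {d : ℕ} (S : Finset (V d)) (hS : S.Nonempty) (y : V d) :
    μ0.real {w | hitPt S (pick S (uSlice w 0)) (uSlice w 1) = y} = ker S y := by
  have hset : {w | hitPt S (pick S (uSlice w 0)) (uSlice w 1) = y} =
      ⋃ x ∈ S, ((fun w => uSlice w 0) ⁻¹' {u | pick S u = x} ∩ (fun w => uSlice w 1) ⁻¹' {v | hitPt S x v = y}) := by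
    ext w; simp [pick_mem S hS]
  have m1 : ∀ x, MeasurableSet {u | pick S u = x} := fun x => pick_meas S (measurableSet_singleton x)
  have m2 : ∀ x, MeasurableSet {v | hitPt S x v = y} := fun x => hitPt_meas S x (measurableSet_singleton y)
  rw [hset, measureReal_biUnion_finset]
  · unfold ker
    rw [Finset.mul_sum]
    apply Finset.sum_congr rfl
    intro x hx
    have hi : IndepFun (fun w => uSlice w 0) (fun w => uSlice w 1) μ0 := slice_indep.indepFun (by norm_num)
    rw [measureReal_def, hi.measure_inter_preimage_eq_mul _ _ (m1 x) (m2 x), ENNReal.toReal_mul]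
    have a := slice_pre 0 _ (m1 x)
    have b := slice_pre 1 _ (m2 x)
    rw [pick_prob S x hx] at a
    rw [hitPt_prob] at b
    rw [← a, ← b]; rfl
  · intro x _ x' _ hne
    simp only [Function.onFun]
    rw [Set.disjoint_left]
    rintro w ⟨h1, _⟩ ⟨h2, _⟩
    exact hne (h1.symm.trans h2)
  · intro x _
    exact ((uSlice_meas 0) (m1 x)).inter ((uSlice_meas 1) (m2 x))

lemma step_pt_meas {d : ℕ} (S : Finset (V d)) :
    Measurable (fun w => hitPt S (pick S (uSlice w 0)) (uSlice w 1)) := by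
  have h1 : Measurable (fun p : V d × ℝ => hitPt S p.1 p.2) := measurable_from_prod_countable_right (fun x => hitPt_meas S x)
  exact h1.comp (((pick_meas S).comp (uSlice_meas 0)).prodMk (uSlice_meas 1))

lemma ustep_integral {d : ℕ} (hd : 0 < d) (S : Finset (V d)) (hS : S.Nonempty) (f : Finset (V d) → ℝ) :
    ∫ w, f (uStep S w) ∂μ0 = Kop f S := by
  have h := integral_finite_range μ0 (fun w => hitPt S (pick S (uSlice w 0)) (uSlice w 1)) (outb S)
    (fun y _ => step_pt_meas S (measurableSet_singleton y)) (by
      have : ∀ x ∈ S, ∀ᵐ w ∂μ0, hitPt S x (uSlice w 1) ∈ outb S := by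
        intro x hx
        have h := hitPt_ae hd S x hx
        rw [← slice_law 1] at h
        exact ae_of_ae_map (uSlice_meas 1).aemeasurable h
      have := (ae_ball_iff S.countable_toSet).mpr this
      filter_upwards [this] with w hw
      exact hw _ (pick_mem S hS _)) (fun y => f (insert y S))
  unfold uStep addPt Kop
  rw [h]
  exact Finset.sum_congr rfl fun y _ => by rw [step_prob S hS]

end UI

end

section
open MeasureTheory Filter Set ProbabilityTheory
namespace UI

instance (d : ℕ) : DiscreteMeasurableSpace (Finset (V d)) := ⟨fun _ => trivial⟩

noncomputable def AS (d : ℕ) (us : ℕ → ℝ) : ℕ → Finset (V d)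
  | 0 => {0}
  | k + 1 => uStep (AS d us k) (us k)

lemma AS_eq (d : ℕ) (w : ℝ) (k : ℕ) : uAggFrom ({0} : Finset (V d)) w k = AS d (fun i => uSlice w i) k := by
  induction k with
  | zero => rfl
  | succ k ih => simp only [uAggFrom, AS, ih]

lemma AS_dep (d : ℕ) (us vs : ℕ → ℝ) (k : ℕ) (h : ∀ i < k, us i = vs i) : AS d us k = AS d vs k := by
  induction k with
  | zero => rfl
  | succ k ih => simp only [AS]; rw [ih (fun i hi => h i (by omega)), h k (by omega)]

lemma uStep_meas {d : ℕ} (S : Finset (V d)) : Measurable (fun w => uStep S w) := by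
  unfold uStep addPt
  exact (measurable_of_countable (fun y : V d => insert y S)).comp (step_pt_meas S)

lemma uStep_meas2 {d : ℕ} : Measurable (fun p : Finset (V d) × ℝ => uStep p.1 p.2) :=
  measurable_from_prod_countable_right (fun S => uStep_meas S)

lemma AS_meas (d : ℕ) (k : ℕ) : Measurable (fun us => AS d us k) := by
  induction k with
  | zero => exact measurable_const
  | succ k ih =>
    have h2 : Measurable (fun us : ℕ → ℝ => (AS d us k, us k)) := ih.prodMk (measurable_pi_apply k)
    have h3 : (fun us : ℕ → ℝ => AS d us (k+1)) = (fun p : Finset (V d) × ℝ => uStep p.1 p.2) ∘ (fun us : ℕ → ℝ => (AS d us k, us k)) := by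
      funext us; simp only [AS, Function.comp]
    rw [h3]
    exact uStep_meas2.comp h2

lemma A_meas (d : ℕ) (k : ℕ) : Measurable (fun w => uAggFrom ({0} : Finset (V d)) w k) := by
  simp_rw [AS_eq]
  exact (AS_meas d k).comp (measurable_pi_iff.2 uSlice_meas)

lemma A_indep (d : ℕ) (k : ℕ) :
    IndepFun (fun w => uAggFrom ({0} : Finset (V d)) w k) (fun w => uSlice w k) μ0 := by
  have h := slice_indep.indepFun_finset (Finset.range k) {k} (by simp) uSlice_meas
  let ext : ((i : Finset.range k) → ℝ) → (ℕ → ℝ) := fun g i => if hi : i ∈ Finset.range k then g ⟨i, hi⟩ else 0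
  have hext : Measurable ext := by
    rw [measurable_pi_iff]; intro i
    by_cases hi : i ∈ Finset.range k
    · simp only [ext, dif_pos hi]; exact measurable_pi_apply _
    · simp only [ext, dif_neg hi]; exact measurable_const
  have h2 := h.comp ((AS_meas d k).comp hext) (measurable_pi_apply (⟨k, by simp⟩ : ({k} : Finset ℕ)))
  convert h2 using 1
  swap
  · rfl
  funext w
  simp only [Function.comp]
  rw [AS_eq]
  apply AS_dep
  intro i hi
  simp [ext, hi]

/-- possible values of the aggregate -/
noncomputable def states (d : ℕ) : ℕ → Finset (Finset (V d))
  | 0 => {{0}}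
  | k + 1 => (states d k).biUnion (fun S => (S ∪ outb S).image (fun y => insert y S))

lemma A_zero_mem (d : ℕ) (w : ℝ) (k : ℕ) : (0 : V d) ∈ uAggFrom ({0} : Finset (V d)) w k := by
  induction k with
  | zero => simp [uAggFrom]
  | succ k ih => simp only [uAggFrom, uStep, addPt]; exact Finset.mem_insert_of_mem ih

lemma A_mono (d : ℕ) (w : ℝ) {k l : ℕ} (h : k ≤ l) :
    uAggFrom ({0} : Finset (V d)) w k ⊆ uAggFrom ({0} : Finset (V d)) w l := by
  induction h with
  | refl => exact subset_rfl
  | step _ ih => exact ih.trans (by simp only [uAggFrom, uStep, addPt]; exact Finset.subset_insert _ _)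

lemma A_states {d : ℕ} (hd : 0 < d) (w : ℝ) (k : ℕ) : uAggFrom ({0} : Finset (V d)) w k ∈ states d k := by
  induction k with
  | zero => simp [uAggFrom, states]
  | succ k ih =>
    simp only [uAggFrom, states, Finset.mem_biUnion]
    refine ⟨_, ih, ?_⟩
    apply Finset.mem_image.mpr
    exact ⟨_, hitPt_mem hd _ _ (pick_mem _ ⟨0, A_zero_mem d w k⟩ _) _, rfl⟩

/-- expectation of a function of the aggregate after `k` steps -/
noncomputable def EE {d : ℕ} (k : ℕ) (f : Finset (V d) → ℝ) : ℝ := ∫ w, f (uAggFrom ({0} : Finset (V d)) w k) ∂μ0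

lemma f_int {d : ℕ} (hd : 0 < d) (k : ℕ) (f : Finset (V d) → ℝ) :
    Integrable (fun w => f (uAggFrom ({0} : Finset (V d)) w k)) μ0 := by
  apply Integrable.of_bound (C := ∑ S ∈ states d k, |f S|)
  · exact ((measurable_of_countable f).comp (A_meas d k)).aestronglyMeasurable
  · apply Eventually.of_forall
    intro w
    exact Finset.single_le_sum (f := fun S => |f S|) (fun _ _ => abs_nonneg _) (A_states hd w k)

lemma EE_step {d : ℕ} (hd : 0 < d) (k : ℕ) (f : Finset (V d) → ℝ) : EE (k+1) f = EE k (Kop f) := by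
  classical
  unfold EE
  have h1 : ∀ w, f (uAggFrom ({0} : Finset (V d)) w (k+1)) = ∑ S ∈ states d k,
      ((if uAggFrom ({0} : Finset (V d)) w k = S then (1:ℝ) else 0) * f (uStep S (uSlice w k))) := by
    intro w
    simp only [ite_mul, one_mul, zero_mul]
    rw [Finset.sum_ite_eq (states d k) (uAggFrom ({0} : Finset (V d)) w k), if_pos (A_states hd w k)]; rfl
  have h2 : ∀ w, Kop f (uAggFrom ({0} : Finset (V d)) w k) = ∑ S ∈ states d k,
      ((if uAggFrom ({0} : Finset (V d)) w k = S then (1:ℝ) else 0) * Kop f S) := by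
    intro w
    simp only [ite_mul, one_mul, zero_mul]
    rw [Finset.sum_ite_eq (states d k) (uAggFrom ({0} : Finset (V d)) w k), if_pos (A_states hd w k)]
  have hm1 : ∀ S, Measurable (fun w => if uAggFrom ({0} : Finset (V d)) w k = S then (1:ℝ) else 0) := fun S =>
    (measurable_of_countable (fun T : Finset (V d) => if T = S then (1:ℝ) else 0)).comp (A_meas d k)
  have hm2 : ∀ S : Finset (V d), Measurable (fun u => f (uStep S u)) := fun S =>
    (measurable_of_countable f).comp (uStep_meas S)
  have hb : ∀ S : Finset (V d), S.Nonempty → Integrable (fun u => f (uStep S u)) μ0 := by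
    intro S hS
    apply Integrable.of_bound (C := ∑ T ∈ (S ∪ outb S).image (fun y => insert y S), |f T|) (hm2 S).aestronglyMeasurable
    apply Eventually.of_forall
    intro w
    exact Finset.single_le_sum (f := fun S => |f S|) (fun _ _ => abs_nonneg _) 
      (Finset.mem_image.mpr ⟨_, hitPt_mem hd _ _ (pick_mem _ hS _) _, rfl⟩)
  have hne : ∀ S ∈ states d k, S.Nonempty := by
    clear h1 h2
    intro S hS
    cases k with
    | zero => simp [states] at hS; subst hS; simp
    | succ k =>
      simp only [states, Finset.mem_biUnion, Finset.mem_image] at hS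
      obtain ⟨T, _, y, _, rfl⟩ := hS
      exact Finset.insert_nonempty _ _
  have hi1 : ∀ S, Integrable (fun w => if uAggFrom ({0} : Finset (V d)) w k = S then (1:ℝ) else 0) μ0 := fun S =>
    f_int hd k (fun T : Finset (V d) => if T = S then (1:ℝ) else 0)
  simp_rw [h1, h2]
  have hind : ∀ S, IndepFun (fun w => if uAggFrom ({0} : Finset (V d)) w k = S then (1:ℝ) else 0)
      (fun w => f (uStep S (uSlice w k))) μ0 := fun S =>
    (A_indep d k).comp (measurable_of_countable (fun T : Finset (V d) => if T = S then (1:ℝ) else 0)) (hm2 S)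
  have hsl : ∀ S : Finset (V d), S.Nonempty → Integrable (fun w => f (uStep S (uSlice w k))) μ0 := by
    intro S hS
    have := hb S hS
    rw [← slice_law k] at this
    exact this.comp_measurable (uSlice_meas k)
  rw [integral_finsetSum, integral_finsetSum]
  · apply Finset.sum_congr rfl
    intro S hS
    rw [(hind S).integral_fun_mul_eq_mul_integral (hm1 S).aestronglyMeasurable
      ((hm2 S).comp (uSlice_meas k)).aestronglyMeasurable, integral_mul_const]
    congr 1
    rw [← ustep_integral hd S (hne S hS) f]
    conv_rhs => rw [← slice_law k]
    rw [integral_map (uSlice_meas k).aemeasurable (hm2 S).aestronglyMeasurable]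
  · intro S _; exact (hi1 S).mul_const _
  · intro S hS; exact (hind S).integrable_mul (hi1 S) (hsl S (hne S hS))

noncomputable def nsq {d : ℕ} (x : V d) : ℝ := ∑ i, (x i : ℝ)^2

def Good {d : ℕ} (k : ℕ) (S : Finset (V d)) : Prop :=
  S.card = k + 1 ∧ (0 : V d) ∈ S ∧ ∀ x ∈ S, nsq x ≤ (k:ℝ)^2

lemma nsq_add {d : ℕ} (x : V d) (i : Fin d) : nsq (x + Pi.single i 1) = nsq x + 2 * (x i : ℝ) + 1 := by
  unfold nsq
  have : ∀ j, (((x + Pi.single i 1 : V d) j : ℤ):ℝ)^2 = (x j:ℝ)^2 + (if j = i then 2 * (x i:ℝ) + 1 else 0) := by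
    intro j
    by_cases h : j = i
    · subst h; simp; ring
    · simp [h]
  simp_rw [this, Finset.sum_add_distrib]
  simp; ring

lemma nsq_sub {d : ℕ} (x : V d) (i : Fin d) : nsq (x - Pi.single i 1) = nsq x - 2 * (x i : ℝ) + 1 := by
  unfold nsq
  have : ∀ j, (((x - Pi.single i 1 : V d) j : ℤ):ℝ)^2 = (x j:ℝ)^2 + (if j = i then - 2 * (x i:ℝ) + 1 else 0) := by
    intro j
    by_cases h : j = i
    · subst h; simp; ring
    · simp [h]
  simp_rw [this, Finset.sum_add_distrib]
  simp; ring

lemma nsq_nonneg {d : ℕ} (x : V d) : 0 ≤ nsq x := Finset.sum_nonneg fun _ _ => sq_nonneg _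

lemma coord_le {d : ℕ} (x : V d) (i : Fin d) : (x i : ℝ)^2 ≤ nsq x :=
  Finset.single_le_sum (f := fun i => (x i : ℝ)^2) (fun _ _ => sq_nonneg _) (Finset.mem_univ i)

lemma outb_mem {d : ℕ} (S : Finset (V d)) (y : V d) (hy : y ∈ outb S) :
    y ∉ S ∧ ∃ x ∈ S, ∃ i, y = x + Pi.single i 1 ∨ y = x - Pi.single i 1 := by
  unfold outb at hy
  simp only [Finset.mem_sdiff, Finset.mem_biUnion, Finset.mem_image] at hy
  obtain ⟨⟨x, hx, e, he, rfl⟩, h2⟩ := hy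
  refine ⟨h2, x, hx, ?_⟩
  obtain ⟨i, rfl | rfl⟩ := (unit_mem e).mp he
  · exact ⟨i, Or.inl rfl⟩
  · exact ⟨i, Or.inr (sub_eq_add_neg _ _).symm⟩

lemma outb_nsq {d : ℕ} (S : Finset (V d)) (k : ℕ) (hS : ∀ x ∈ S, nsq x ≤ (k:ℝ)^2) (y : V d) (hy : y ∈ outb S) :
    nsq y ≤ ((k+1 : ℕ):ℝ)^2 := by
  obtain ⟨_, x, hx, i, h⟩ := outb_mem S y hy
  have h1 := hS x hx
  have h2 := abs_le.mp (abs_le_of_sq_le_sq ((coord_le x i).trans h1) (by positivity))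
  push_cast
  rcases h with rfl | rfl
  · rw [nsq_add]; nlinarith
  · rw [nsq_sub]; nlinarith

lemma Kop_mono {d : ℕ} (f g : Finset (V d) → ℝ) (S : Finset (V d)) (h : ∀ y ∈ outb S, f (insert y S) ≤ g (insert y S)) :
    Kop f S ≤ Kop g S :=
  Finset.sum_le_sum fun y hy => mul_le_mul_of_nonneg_left (h y hy) (ker_nonneg S y)

lemma Good_insert {d : ℕ} (k : ℕ) (S : Finset (V d)) (hS : Good k S) (y : V d) (hy : y ∈ outb S) : Good (k+1) (insert y S) := by
  obtain ⟨h1, h2, h3⟩ := hS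
  refine ⟨?_, Finset.mem_insert_of_mem h2, ?_⟩
  · rw [Finset.card_insert_of_notMem (outb_mem S y hy).1, h1]
  · intro x hx
    rcases Finset.mem_insert.mp hx with rfl | hx
    · exact outb_nsq S k h3 x hy
    · refine (h3 x hx).trans ?_
      push_cast; have : (0:ℝ) ≤ k := by positivity
      nlinarith

lemma EE_mono {d : ℕ} (hd : 0 < d) (k : ℕ) (f g : Finset (V d) → ℝ) (h : ∀ S, Good k S → f S ≤ g S) :
    EE k f ≤ EE k g := by
  induction k generalizing f g with
  | zero =>
    apply integral_mono (f_int hd 0 f) (f_int hd 0 g)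
    intro w
    apply h
    simp [uAggFrom, Good, nsq]
  | succ k ih =>
    rw [EE_step hd, EE_step hd]
    apply ih
    intro S hS
    exact Kop_mono f g S fun y hy => h _ (Good_insert k S hS y hy)

lemma EE_add {d : ℕ} (hd : 0 < d) (k : ℕ) (f g : Finset (V d) → ℝ) : EE k (fun S => f S + g S) = EE k f + EE k g :=
  integral_add (f_int hd k f) (f_int hd k g)

lemma EE_mul {d : ℕ} (k : ℕ) (c : ℝ) (f : Finset (V d) → ℝ) : EE k (fun S => c * f S) = c * EE k f :=
  integral_const_mul _ _

lemma EE_const {d : ℕ} (k : ℕ) (c : ℝ) : EE k (fun _ : Finset (V d) => c) = c := by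
  simp [EE]

lemma EE_zero {d : ℕ} (f : Finset (V d) → ℝ) : EE 0 f = f {0} := by
  simp [EE, uAggFrom]

open Classical in
lemma EE_prob {d : ℕ} (k : ℕ) (P : Finset (V d) → Prop) :
    μ0.real {w | P (uAggFrom ({0} : Finset (V d)) w k)} = EE k (fun S => if P S then 1 else 0) := by
  have hm : MeasurableSet {w | P (uAggFrom ({0} : Finset (V d)) w k)} := (A_meas d k) (MeasurableSet.of_discrete (s := {S | P S}))
  have : μ0.real {w | P (uAggFrom ({0} : Finset (V d)) w k)} = ∫ w, {w | P (uAggFrom ({0} : Finset (V d)) w k)}.indicator (fun _ => (1:ℝ)) w ∂μ0 := by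
    rw [integral_indicator hm]; simp
  rw [this]; unfold EE; congr 1

end UI

end

section
open MeasureTheory Filter Set
namespace UI

lemma mvt_pow (g g' : ℝ → ℝ) (n : ℕ) (C : ℝ) (hC : 0 ≤ C) (h0 : g 0 = 0)
    (hd : ∀ w, |w| ≤ 1/2 → HasDerivAt g (g' w) w) (hb : ∀ w, |w| ≤ 1/2 → |g' w| ≤ C * |w|^n) :
    ∀ w, |w| ≤ 1/2 → |g w| ≤ C * |w|^(n+1) := by
  intro w hw
  have hs : Convex ℝ (Icc (-|w|) |w|) := convex_Icc _ _
  have key := hs.norm_image_sub_le_of_norm_hasDerivWithin_le (f := g) (f' := g') (C := C * |w|^n) (x := 0) (y := w)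
    (fun x hx => (hd x ((abs_le.mpr hx).trans hw)).hasDerivWithinAt)
    (fun x hx => by
      have hx' := abs_le.mpr hx
      refine (hb x (hx'.trans hw)).trans ?_
      gcongr) (Set.mem_Icc.mpr ⟨by linarith [abs_nonneg w], abs_nonneg w⟩) (Set.mem_Icc.mpr (abs_le.mp le_rfl))
  rw [h0, sub_zero, sub_zero, Real.norm_eq_abs, Real.norm_eq_abs] at key
  rw [pow_succ, ← mul_assoc]; exact key

noncomputable def fg (γ w : ℝ) : ℝ := (1 + w) ^ (-γ)

lemma fg_zero (γ : ℝ) : fg γ 0 = 1 := by simp [fg]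

lemma fg_deriv (γ w : ℝ) (hw : |w| ≤ 1/2) : HasDerivAt (fg γ) (-γ * fg (γ+1) w) w := by
  unfold fg
  have h1 : 0 < 1 + w := by linarith [(abs_le.mp hw).1]
  have := (((hasDerivAt_id w).const_add 1).rpow_const (p := -γ) (Or.inl h1.ne'))
  refine this.congr_deriv ?_
  rw [show -γ - 1 = -(γ+1) by ring]; simp

lemma fg_T0 (γ : ℝ) (hγ : 0 ≤ γ) : ∃ C, 0 ≤ C ∧ ∀ w, |w| ≤ 1/2 → |fg γ w - 1| ≤ C * |w|^1 := by
  have hb : ∀ w, |w| ≤ 1/2 → |fg (γ+1) w| ≤ 2^(γ+1) := by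
    intro w hw
    have h1 : 1/2 ≤ 1 + w := by linarith [(abs_le.mp hw).1]
    unfold fg
    rw [abs_of_nonneg (Real.rpow_nonneg (by linarith) _)]
    calc (1+w)^(-(γ+1)) ≤ (1/2 : ℝ)^(-(γ+1)) := Real.rpow_le_rpow_of_nonpos (by norm_num) h1 (by linarith)
      _ = 2^(γ+1) := by rw [Real.rpow_neg (by norm_num), ← Real.inv_rpow (by norm_num)]; norm_num
  refine ⟨γ * 2^(γ+1), by positivity, ?_⟩
  apply mvt_pow (fun w => fg γ w - 1) (fun w => -γ * fg (γ+1) w) 0 _ (by positivity) (by simp [fg_zero])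
  · intro w hw; exact (fg_deriv γ w hw).sub_const 1
  · intro w hw; rw [abs_mul, abs_neg, abs_of_nonneg hγ, pow_zero, mul_one]
    exact mul_le_mul_of_nonneg_left (hb w hw) hγ

lemma fg_T1 (γ : ℝ) (hγ : 0 ≤ γ) : ∃ C, 0 ≤ C ∧ ∀ w, |w| ≤ 1/2 → |fg γ w - (1 - γ * w)| ≤ C * |w|^2 := by
  obtain ⟨C, hC, h⟩ := fg_T0 (γ+1) (by linarith)
  refine ⟨γ * C, by positivity, ?_⟩
  apply mvt_pow (fun w => fg γ w - (1 - γ * w)) (fun w => -γ * (fg (γ+1) w - 1)) 1 _ (by positivity) (by simp [fg_zero])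
  · intro w hw
    have := (fg_deriv γ w hw).sub (((hasDerivAt_id w).const_mul γ).const_sub 1)
    refine this.congr_deriv ?_
    ring
  · intro w hw; rw [abs_mul, abs_neg, abs_of_nonneg hγ, mul_assoc]
    exact mul_le_mul_of_nonneg_left (h w hw) hγ

lemma fg_T2 (γ : ℝ) (hγ : 0 ≤ γ) : ∃ C, 0 ≤ C ∧ ∀ w, |w| ≤ 1/2 →
    |fg γ w - (1 - γ * w + γ * (γ+1) / 2 * w^2)| ≤ C * |w|^3 := by
  obtain ⟨C, hC, h⟩ := fg_T1 (γ+1) (by linarith)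
  refine ⟨γ * C, by positivity, ?_⟩
  apply mvt_pow (fun w => fg γ w - (1 - γ * w + γ * (γ+1) / 2 * w^2)) (fun w => -γ * (fg (γ+1) w - (1 - (γ+1)*w))) 2 _ (by positivity) (by simp [fg_zero])
  · intro w hw
    have := (fg_deriv γ w hw).sub ((((hasDerivAt_id w).const_mul γ).const_sub 1).add (((hasDerivAt_id w).pow 2).const_mul (γ * (γ+1) / 2)))
    refine this.congr_deriv ?_
    simp; ring
  · intro w hw; rw [abs_mul, abs_neg, abs_of_nonneg hγ, mul_assoc]
    exact mul_le_mul_of_nonneg_left (h w hw) hγ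

lemma fg_T3 (γ : ℝ) (hγ : 0 ≤ γ) : ∃ C, 0 ≤ C ∧ ∀ w, |w| ≤ 1/2 →
    |fg γ w - (1 - γ * w + γ * (γ+1) / 2 * w^2 - γ * (γ+1) * (γ+2) / 6 * w^3)| ≤ C * |w|^4 := by
  obtain ⟨C, hC, h⟩ := fg_T2 (γ+1) (by linarith)
  refine ⟨γ * C, by positivity, ?_⟩
  apply mvt_pow (fun w => fg γ w - (1 - γ * w + γ * (γ+1) / 2 * w^2 - γ * (γ+1) * (γ+2) / 6 * w^3)) (fun w => -γ * (fg (γ+1) w - (1 - (γ+1)*w + (γ+1) * (γ+1+1) / 2 * w^2))) 3 _ (by positivity) (by simp [fg_zero])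
  · intro w hw
    have := (fg_deriv γ w hw).sub (((((hasDerivAt_id w).const_mul γ).const_sub 1).add (((hasDerivAt_id w).pow 2).const_mul (γ * (γ+1) / 2))).sub (((hasDerivAt_id w).pow 3).const_mul (γ * (γ+1) * (γ+2) / 6)))
    refine this.congr_deriv ?_
    simp; ring
  · intro w hw; rw [abs_mul, abs_neg, abs_of_nonneg hγ, mul_assoc]
    exact mul_le_mul_of_nonneg_left (h w hw) hγ

lemma fg_even (γ : ℝ) (hγ : 0 ≤ γ) : ∃ C, 0 ≤ C ∧ ∀ w, |w| ≤ 1/2 →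
    |fg γ w + fg γ (-w) - (2 + γ * (γ+1) * w^2)| ≤ C * w^4 := by
  obtain ⟨C, hC, h⟩ := fg_T3 γ hγ
  refine ⟨2 * C, by positivity, fun w hw => ?_⟩
  have h1 := abs_le.mp (h w hw)
  have h2 := abs_le.mp (h (-w) (by rwa [abs_neg]))
  have e : |w|^4 = w^4 := by rw [← abs_pow, abs_of_nonneg (by positivity)]
  rw [abs_neg] at h2
  rw [e] at h1 h2
  rw [abs_le]; constructor <;> nlinarith

lemma fg_odd (γ : ℝ) (hγ : 0 ≤ γ) : ∃ C, 0 ≤ C ∧ ∀ w, |w| ≤ 1/2 →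
    |fg γ w - fg γ (-w) + 2 * γ * w| ≤ C * |w|^3 := by
  obtain ⟨C, hC, h⟩ := fg_T2 γ hγ
  refine ⟨2 * C, by positivity, fun w hw => ?_⟩
  have h1 := abs_le.mp (h w hw)
  have h2 := abs_le.mp (h (-w) (by rwa [abs_neg]))
  rw [abs_neg] at h2
  rw [abs_le]; constructor <;> nlinarith

end UI

end

section
open MeasureTheory Filter Set
namespace UI

lemma sum1d (β : ℝ) (hβ : 1 < β) : ∃ C, 0 ≤ C ∧ ∀ X : Finset ℤ, ∑ t ∈ X, (1 + (t:ℝ)^2)^(-(β/2)) ≤ C := by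
  have hs : Summable (fun t : ℤ => |(t:ℝ)|^(-β)) := Real.summable_abs_int_rpow hβ
  refine ⟨1 + ∑' t : ℤ, |(t:ℝ)|^(-β), ?_, fun X => ?_⟩
  · have : 0 ≤ ∑' t : ℤ, |(t:ℝ)|^(-β) := tsum_nonneg fun t => Real.rpow_nonneg (abs_nonneg _) _
    linarith
  · calc ∑ t ∈ X, (1 + (t:ℝ)^2)^(-(β/2)) ≤ ∑ t ∈ X, ((if t = 0 then 1 else 0) + |(t:ℝ)|^(-β)) := by
          apply Finset.sum_le_sum
          intro t _
          by_cases ht : t = 0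
          · subst ht; simp; exact Real.rpow_nonneg le_rfl _
          · rw [if_neg ht, zero_add]
            have h0 : 0 < |(t:ℝ)| := abs_pos.mpr (by exact_mod_cast ht)
            have : |(t:ℝ)|^(-β) = (|(t:ℝ)|^2)^(-(β/2)) := by
              rw [← Real.rpow_natCast, ← Real.rpow_mul h0.le]; congr 1; push_cast; ring
            rw [this, sq_abs]
            apply Real.rpow_le_rpow_of_nonpos _ _ (by linarith)
            · rw [← sq_abs]; positivity
            · linarith
      _ ≤ _ := by
          rw [Finset.sum_add_distrib]
          apply add_le_add
          · rw [Finset.sum_ite_eq']; split_ifs <;> norm_num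
          · exact hs.sum_le_tsum X (fun t _ => Real.rpow_nonneg (abs_nonneg _) _)

lemma sum_latt (d : ℕ) (hd : 0 < d) (α : ℝ) (hα : (d:ℝ) < α) :
    ∃ C, 0 < C ∧ ∀ X : Finset (V d), ∑ y ∈ X, (1 + nsq y)^(-(α/2)) ≤ C := by
  have hd' : (0:ℝ) < d := by exact_mod_cast hd
  obtain ⟨C, hC, h⟩ := sum1d (α / d) (by rw [lt_div_iff₀ hd']; linarith)
  refine ⟨C^d + 1, by positivity, fun X => ?_⟩
  classical
  let Y : Finset ℤ := X.biUnion (fun y => Finset.univ.image (fun i => y i))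
  have hX : X ⊆ Fintype.piFinset (fun _ : Fin d => Y) := by
    intro y hy
    rw [Fintype.mem_piFinset]
    intro i
    exact Finset.mem_biUnion.mpr ⟨y, hy, Finset.mem_image.mpr ⟨i, Finset.mem_univ _, rfl⟩⟩
  have hpt : ∀ y : V d, (1 + nsq y)^(-(α/2)) ≤ ∏ i, (1 + (y i:ℝ)^2)^(-(α/d/2)) := by
    intro y
    rw [Real.finsetProd_rpow _ _ (fun i _ => by positivity)]
    have h1 : ∏ i, (1 + (y i:ℝ)^2) ≤ (1 + nsq y)^d := by
      calc ∏ i, (1 + (y i:ℝ)^2) ≤ ∏ i : Fin d, (1 + nsq y) := by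
            apply Finset.prod_le_prod
            · intro i _; positivity
            · intro i _; linarith [coord_le y i]
        _ = _ := by simp
    have hn := nsq_nonneg y
    have h2 : (1 + nsq y)^(-(α/2)) = ((1 + nsq y)^d)^(-(α/d/2)) := by
      rw [← Real.rpow_natCast, ← Real.rpow_mul (by linarith)]; congr 1; field_simp
    rw [h2]
    apply Real.rpow_le_rpow_of_nonpos _ h1
    · have : 0 < α / d / 2 := by have : 0 < α := hd'.trans hα
                                 positivity
      linarith
    · exact Finset.prod_pos fun i _ => by positivity
  calc ∑ y ∈ X, (1 + nsq y)^(-(α/2)) ≤ ∑ y ∈ Fintype.piFinset (fun _ : Fin d => Y), ∏ i, (1 + (y i:ℝ)^2)^(-(α/d/2)) := by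
        refine (Finset.sum_le_sum fun y _ => hpt y).trans ?_
        apply Finset.sum_le_sum_of_subset_of_nonneg hX
        intro y _ _
        exact Finset.prod_nonneg fun i _ => Real.rpow_nonneg (by positivity) _
    _ = ∏ i : Fin d, ∑ t ∈ Y, (1 + (t:ℝ)^2)^(-(α/d/2)) := by rw [Finset.prod_univ_sum]
    _ ≤ ∏ i : Fin d, C := by
        apply Finset.prod_le_prod
        · intro i _; exact Finset.sum_nonneg fun t _ => Real.rpow_nonneg (by positivity) _
        · intro i _; exact h Y
    _ ≤ C^d + 1 := by simp

noncomputable def pw {d : ℕ} (a γ : ℝ) (y : V d) : ℝ := (nsq y + a)^(-γ)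

lemma pw_pm {d : ℕ} (a γ : ℝ) (ha : 0 ≤ a) (y : V d) (i : Fin d)
    (hw : |2 * (y i:ℝ) / (nsq y + a + 1)| ≤ 1/2) :
    pw a γ (y + Pi.single i 1) = (nsq y + a + 1)^(-γ) * fg γ (2 * (y i:ℝ) / (nsq y + a + 1)) ∧
    pw a γ (y - Pi.single i 1) = (nsq y + a + 1)^(-γ) * fg γ (-(2 * (y i:ℝ) / (nsq y + a + 1))) := by
  have hA : 0 < nsq y + a + 1 := by linarith [nsq_nonneg y]
  have hw' := abs_le.mp hw
  unfold pw fg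
  constructor
  · rw [← Real.mul_rpow hA.le (by linarith), nsq_add]
    congr 1; field_simp; ring
  · rw [← Real.mul_rpow hA.le (by linarith), nsq_sub]
    congr 1; field_simp; ring

lemma w_small {d : ℕ} (a : ℝ) (ha : 0 ≤ a) (y : V d) (hy : 3 ≤ a ∨ 16 ≤ nsq y) (i : Fin d) :
    |2 * (y i:ℝ) / (nsq y + a + 1)| ≤ 1/2 ∧ (2 * (y i:ℝ) / (nsq y + a + 1))^2 ≤ 4 / (nsq y + a + 1) ∧
     2 ≤ nsq y + a + 1 := by
  have hs := nsq_nonneg y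
  have hA : 0 < nsq y + a + 1 := by linarith
  have hc := coord_le y i
  refine ⟨?_, ?_, ?_⟩
  · apply abs_le_of_sq_le_sq _ (by norm_num)
    rw [div_pow, div_le_iff₀ (by positivity)]
    rcases hy with h | h
    · nlinarith [sq_nonneg (nsq y - (a+1))]
    · nlinarith
  · rw [div_pow, div_le_div_iff₀ (by positivity) hA]
    nlinarith [mul_nonneg hA.le hA.le, mul_nonneg hA.le (sub_nonneg.mpr hc)]
  · rcases hy with h | h <;> linarith

lemma lap_pw (d : ℕ) (γ : ℝ) (hγ : 0 ≤ γ) : ∃ C, 0 ≤ C ∧ ∀ (a : ℝ) (y : V d), 0 ≤ a → (3 ≤ a ∨ 16 ≤ nsq y) →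
    |nb (pw a γ) y - 2 * d * pw a γ y - (nsq y + a + 1)^(-γ) *
      (4 * γ * (γ+1) * nsq y / (nsq y + a + 1)^2 - 2 * d * γ / (nsq y + a + 1))|
      ≤ C * ((nsq y + a + 1)^(-γ) / (nsq y + a + 1)^2) := by
  obtain ⟨C1, hC1, h1⟩ := fg_even γ hγ
  obtain ⟨C2, hC2, h2⟩ := fg_T1 γ hγ
  refine ⟨16 * d * C1 + 2 * d * C2, by positivity, fun a y ha hy => ?_⟩
  rcases Nat.eq_zero_or_pos d with rfl | hd
  · have : nsq y = 0 := by simp [nsq]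
    rw [this]; simp [nb]
  have hs := nsq_nonneg y
  set A := nsq y + a + 1 with hA
  have hA0 : 0 < A := by linarith
  have hA2 : 2 ≤ A := (w_small a ha y hy ⟨0, hd⟩).2.2
  have hAg : 0 < A^(-γ) := Real.rpow_pos_of_pos hA0 _
  have hpw : pw a γ y = A^(-γ) * fg γ (-(1/A)) := by
    have : (0:ℝ) ≤ 1 + -(1/A) := by
      have : 1/A ≤ 1 := by rw [div_le_one hA0]; linarith
      linarith
    unfold pw fg
    rw [← Real.mul_rpow hA0.le this]; congr 1; field_simp; rw [hA]; ring
  have hinv : |(-(1/A))| ≤ 1/2 := by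
    rw [abs_neg, abs_of_pos (by positivity)]
    exact one_div_le_one_div_of_le (by norm_num) hA2
  have hb := h2 _ hinv
  have hnb : nb (pw a γ) y = A^(-γ) * ∑ i, (fg γ (2 * (y i:ℝ) / A) + fg γ (-(2 * (y i:ℝ) / A))) := by
    unfold nb
    rw [Finset.mul_sum]
    apply Finset.sum_congr rfl
    intro i _
    obtain ⟨e1, e2⟩ := pw_pm a γ ha y i (w_small a ha y hy i).1
    rw [e1, e2]; ring
  have hsum : ∑ i : Fin d, (2 + γ * (γ+1) * (2 * (y i:ℝ) / A)^2) = 2 * d + 4 * γ * (γ+1) * nsq y / A^2 := by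
    rw [Finset.sum_add_distrib, ← Finset.mul_sum]
    simp_rw [div_pow, mul_pow]
    rw [← Finset.sum_div, ← Finset.mul_sum]
    simp [nsq]; ring
  have hS : |∑ i, (fg γ (2 * (y i:ℝ) / A) + fg γ (-(2 * (y i:ℝ) / A))) - (2 * d + 4 * γ * (γ+1) * nsq y / A^2)| ≤ 16 * d * C1 / A^2 := by
    rw [← hsum, ← Finset.sum_sub_distrib]
    refine (Finset.abs_sum_le_sum_abs _ _).trans ?_
    calc _ ≤ ∑ i : Fin d, 16 * C1 / A^2 := by
          apply Finset.sum_le_sum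
          intro i _
          obtain ⟨b1, b2, _⟩ := w_small a ha y hy i
          refine (h1 _ b1).trans ?_
          have : (2 * (y i:ℝ) / A)^4 ≤ (4/A)^2 := by
            calc (2 * (y i:ℝ) / A)^4 = ((2 * (y i:ℝ) / A)^2)^2 := by ring
              _ ≤ _ := by gcongr
          calc C1 * (2 * (y i:ℝ) / A)^4 ≤ C1 * (4/A)^2 := by gcongr
            _ = _ := by ring
      _ = _ := by simp; ring
  have e : nb (pw a γ) y - 2 * d * pw a γ y - A^(-γ) * (4 * γ * (γ+1) * nsq y / A^2 - 2 * d * γ / A) =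
      A^(-γ) * ((∑ i, (fg γ (2 * (y i:ℝ) / A) + fg γ (-(2 * (y i:ℝ) / A))) - (2 * d + 4 * γ * (γ+1) * nsq y / A^2))
        - 2 * d * (fg γ (-(1/A)) - (1 - γ * (-(1/A))))) := by
    rw [hnb, hpw]; ring
  rw [e, abs_mul, abs_of_pos hAg]
  have hb' : |2 * d * (fg γ (-(1/A)) - (1 - γ * (-(1/A))))| ≤ 2 * d * C2 / A^2 := by
    rw [abs_mul, abs_of_nonneg (by positivity)]
    rw [abs_neg, abs_of_pos (a := 1/A) (by positivity)] at hb
    calc _ ≤ 2 * d * (C2 * (1/A)^2) := by gcongr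
      _ = _ := by ring
  calc A^(-γ) * _ ≤ A^(-γ) * (16 * d * C1 / A^2 + 2 * d * C2 / A^2) := by
        gcongr
        exact (abs_sub _ _).trans (add_le_add hS hb')
    _ = _ := by ring

end UI

end

section
open MeasureTheory Filter Set
namespace UI

lemma sparse_log (M : ℝ) (hM : 1 ≤ M) : ∃ φ : V 2 → ℝ, (∀ x, nb φ x ≤ 4 * φ x) ∧ nb φ 0 ≤ 4 * φ 0 - 4 ∧
    ∀ x, nsq x ≤ 4 * M^2 → 0 ≤ φ x ∧ φ x ≤ 8 * (1 + Real.log M) := by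
  refine ⟨fun x => 2 * (Real.log (4*M^2+1) - Real.log (nsq x + 1)), ?_, ?_, ?_⟩
  · intro x
    have hs := nsq_nonneg x
    set S := nsq x + 1 with hS
    have hx : nsq x = (x 0:ℝ)^2 + (x 1:ℝ)^2 := by simp [nsq, Fin.sum_univ_two]
    have key : ∀ i, 0 < S + 2 * (x i:ℝ) + 1 ∧ 0 < S - 2 * (x i:ℝ) + 1 := by
      intro i
      have := coord_le x i
      constructor <;> nlinarith [sq_nonneg ((x i:ℝ)-1), sq_nonneg ((x i:ℝ)+1)]
    have h0 := key 0
    have h1 := key 1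
    have hlog : 4 * Real.log S ≤ Real.log (S + 2 * (x 0:ℝ) + 1) + Real.log (S - 2 * (x 0:ℝ) + 1) +
        (Real.log (S + 2 * (x 1:ℝ) + 1) + Real.log (S - 2 * (x 1:ℝ) + 1)) := by
      rw [← Real.log_mul h0.1.ne' h0.2.ne', ← Real.log_mul h1.1.ne' h1.2.ne', ← Real.log_mul
        (mul_pos h0.1 h0.2).ne' (mul_pos h1.1 h1.2).ne']
      have : 4 * Real.log S = Real.log (S^4) := by rw [Real.log_pow]; norm_num
      rw [this]
      apply Real.log_le_log (by positivity)
      have e : (x 0:ℝ)^2 = S - 1 - (x 1:ℝ)^2 := by rw [hS, hx]; ring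
      have hp := mul_nonneg (sq_nonneg (x 0:ℝ)) (sq_nonneg (x 1:ℝ))
      have e3 : (S + 2 * (x 0:ℝ) + 1) * (S - 2 * (x 0:ℝ) + 1) * ((S + 2 * (x 1:ℝ) + 1) * (S - 2 * (x 1:ℝ) + 1)) =
          S^4 + (2 * S^2 + 8 * S + 5) + 16 * ((x 0:ℝ)^2 * (x 1:ℝ)^2) := by
        rw [hS, hx]; ring
      have hS0 : 0 ≤ S := by linarith
      rw [e3]
      have : 0 ≤ 2 * S^2 + 8 * S + 5 := by positivity
      linarith
    simp only [nb, Fin.sum_univ_two, nsq_add, nsq_sub]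
    have e1 : ∀ i, nsq x + 2 * (x i:ℝ) + 1 + 1 = S + 2 * (x i:ℝ) + 1 := fun i => by rw [hS]; ring
    have e2 : ∀ i, nsq x - 2 * (x i:ℝ) + 1 + 1 = S - 2 * (x i:ℝ) + 1 := fun i => by rw [hS]; ring
    rw [e1, e1, e2, e2]
    linarith
  · have hn : nsq (0 : V 2) = 0 := by simp [nsq]
    simp only [nb, Fin.sum_univ_two, nsq_add, nsq_sub, hn]
    have := Real.log_two_gt_d9
    norm_num
    linarith
  · intro x hx
    have hs := nsq_nonneg x
    constructor
    · have := Real.log_le_log (show 0 < nsq x + 1 by linarith) (show nsq x + 1 ≤ 4*M^2+1 by linarith)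
      linarith
    · have h1 : 0 ≤ Real.log (nsq x + 1) := Real.log_nonneg (by linarith)
      have h2 : Real.log (4*M^2+1) ≤ Real.log (8 * M^2) := Real.log_le_log (by positivity) (by nlinarith)
      rw [Real.log_mul (by norm_num) (by positivity), Real.log_pow, show (8:ℝ) = 2^3 by norm_num, Real.log_pow] at h2
      have := Real.log_two_lt_d9
      push_cast at h2
      nlinarith [Real.log_nonneg hM]

lemma sparse1 (d : ℕ) (hd : 2 ≤ d) : ∃ C, 0 < C ∧ ∀ M : ℝ, 1 ≤ M → ∃ φ : V d → ℝ,
    (∀ x, nb φ x ≤ 2 * d * φ x) ∧ nb φ 0 ≤ 2 * d * φ 0 - 2 * d ∧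
    ∀ x, nsq x ≤ 4 * M^2 → 0 ≤ φ x ∧ φ x ≤ C * (1 + Real.log M) * (1 + nsq x)^(-(((d:ℝ)-2)/2)) := by
  rcases Nat.lt_or_ge 2 d with h3 | h3
  · have hd3 : (3:ℝ) ≤ d := by exact_mod_cast h3
    set γ := ((d:ℝ)-2)/2 with hγ
    have hγ0 : 0 < γ := by rw [hγ]; linarith
    obtain ⟨C, hC, h⟩ := lap_pw d γ hγ0.le
    set a := 3 + C / (2 * d * γ) with ha
    have ha3 : 3 ≤ a := by rw [ha]; have : 0 ≤ C / (2*d*γ) := by positivity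
                           linarith
    have key : ∀ y : V d, nb (pw a γ) y ≤ 2 * d * pw a γ y - 4 * (d * γ) * ((nsq y + a + 1)^(-γ) / (nsq y + a + 1)^2) := by
      intro y
      have h1 := (abs_le.mp (h a y (by linarith) (Or.inl ha3))).2
      have hs := nsq_nonneg y
      have hA : 0 < nsq y + a + 1 := by linarith
      have hb : (4 * γ * (γ+1) * nsq y / (nsq y + a + 1)^2 - 2 * d * γ / (nsq y + a + 1)) = - (2 * d * γ * (a+1)) / (nsq y + a + 1)^2 := by
        field_simp
        rw [hγ]; ring
      rw [hb] at h1
      have hp : 0 ≤ (nsq y + a + 1)^(-γ) / (nsq y + a + 1)^2 := by positivity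
      have e : (nsq y + a + 1)^(-γ) * (- (2 * d * γ * (a+1)) / (nsq y + a + 1)^2) = - (2 * d * γ * (a+1)) * ((nsq y + a + 1)^(-γ) / (nsq y + a + 1)^2) := by ring
      rw [e] at h1
      have e2 : 2 * d * γ * (a+1) = 8 * d * γ + C := by rw [ha]; field_simp; ring
      rw [e2] at h1
      have : 0 ≤ d * γ * ((nsq y + a + 1)^(-γ) / (nsq y + a + 1)^2) := by positivity
      linarith
    have hn : nsq (0 : V d) = 0 := by simp [nsq]
    set δ := 4 * (d * γ) * ((0 + a + 1)^(-γ) / (0 + a + 1)^2) with hδ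
    have hδ0 : 0 < δ := by have : 0 < 0 + a + 1 := by linarith
                           positivity
    refine ⟨2 * d / δ, by positivity, fun M hM => ⟨fun y => 2 * d / δ * pw a γ y, ?_, ?_, ?_⟩⟩
    · intro x
      have := key x
      have hA : 0 < nsq x + a + 1 := by linarith [nsq_nonneg x]
      have hp : 0 ≤ 4 * (d * γ) * ((nsq x + a + 1)^(-γ) / (nsq x + a + 1)^2) := by positivity
      have e : nb (fun y => 2 * d / δ * pw a γ y) x = 2 * d / δ * nb (pw a γ) x := by
        simp only [nb, Finset.mul_sum, mul_add]
      rw [e]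
      calc 2 * d / δ * nb (pw a γ) x ≤ 2 * d / δ * (2 * d * pw a γ x) := by gcongr; linarith
        _ = _ := by ring
    · have := key 0
      rw [hn, ← hδ] at this
      have e : nb (fun y => 2 * d / δ * pw a γ y) (0 : V d) = 2 * d / δ * nb (pw a γ) (0 : V d) := by
        simp only [nb, Finset.mul_sum, mul_add]
      rw [e]
      calc 2 * d / δ * nb (pw a γ) (0 : V d) ≤ 2 * d / δ * (2 * d * pw a γ (0 : V d) - δ) := by gcongr
        _ = _ := by field_simp
    · intro x _
      have hs := nsq_nonneg x
      constructor
      · have : 0 < nsq x + a := by linarith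
        unfold pw; positivity
      · have h1 : pw a γ x ≤ (1 + nsq x)^(-γ) := by
          unfold pw
          exact Real.rpow_le_rpow_of_nonpos (by linarith) (by linarith) (by linarith)
        have h2 : 1 ≤ 1 + Real.log M := by linarith [Real.log_nonneg hM]
        have h3 : 0 ≤ (1 + nsq x)^(-γ) := by positivity
        calc 2 * d / δ * pw a γ x ≤ 2 * d / δ * (1 + nsq x)^(-γ) := by gcongr
          _ = 2 * d / δ * 1 * (1 + nsq x)^(-γ) := by ring
          _ ≤ _ := by gcongr
  · obtain rfl : d = 2 := le_antisymm h3 hd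
    refine ⟨8, by norm_num, fun M hM => ?_⟩
    obtain ⟨φ, h1, h2, h3⟩ := sparse_log M hM
    refine ⟨φ, fun x => by have := h1 x; norm_num; linarith, by norm_num; linarith, fun x hx => ?_⟩
    obtain ⟨h4, h5⟩ := h3 x hx
    refine ⟨h4, ?_⟩
    norm_num
    linarith

/-- Sum of a Riesz-type kernel over a set of at most m points. -/
lemma riesz_sum (d : ℕ) (hd : 2 ≤ d) (η : ℝ) (hη : 0 < η) : ∃ C, 0 < C ∧ ∀ (m : ℝ) (T : Finset (V d)) (x : V d), 1 ≤ m → (T.card:ℝ) ≤ m →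
    ∑ y ∈ T, (1 + nsq (x - y))^(-(((d:ℝ)-2)/2)) ≤ C * m^((2+η)/d) := by
  have hd0 : (0:ℝ) < d := by exact_mod_cast (by omega : 0 < d)
  have hd2 : (2:ℝ) ≤ d := by exact_mod_cast hd
  obtain ⟨C, hC, h⟩ := sum_latt d (by omega) (d + η) (by linarith)
  refine ⟨C + 1, by positivity, fun m T x hm hT => ?_⟩
  set ρ := m^(1/(d:ℝ)) with hρ
  have hρ1 : 1 ≤ ρ := Real.one_le_rpow hm (by positivity)
  have hρ0 : 0 < ρ := by linarith
  have hpt : ∀ q : ℝ, 1 ≤ q → q^(-(((d:ℝ)-2)/2)) ≤ ρ^(2+η) * q^(-((d+η)/2)) + ρ^(-((d:ℝ)-2)) := by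
    intro q hq
    have hq0 : 0 < q := by linarith
    rcases le_total q (ρ^2) with hqρ | hqρ
    · have : q^(-(((d:ℝ)-2)/2)) = q^((2+η)/2) * q^(-((d+η)/2)) := by
        rw [← Real.rpow_add hq0]; congr 1; ring
      rw [this]
      have h1 : q^((2+η)/2) ≤ ρ^(2+η) := by
        calc q^((2+η)/2) ≤ (ρ^2)^((2+η)/2) := Real.rpow_le_rpow hq0.le hqρ (by linarith)
          _ = _ := by rw [← Real.rpow_natCast, ← Real.rpow_mul hρ0.le]; congr 1; push_cast; ring
      have : 0 ≤ ρ^(-((d:ℝ)-2)) := by positivity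
      have : q^((2+η)/2) * q^(-((d+η)/2)) ≤ ρ^(2+η) * q^(-((d+η)/2)) := by gcongr
      linarith
    · have h1 : q^(-(((d:ℝ)-2)/2)) ≤ ρ^(-((d:ℝ)-2)) := by
        calc q^(-(((d:ℝ)-2)/2)) ≤ (ρ^2)^(-(((d:ℝ)-2)/2)) := Real.rpow_le_rpow_of_nonpos (by positivity) hqρ (by linarith)
          _ = _ := by rw [← Real.rpow_natCast, ← Real.rpow_mul hρ0.le]; congr 1; push_cast; ring
      have : 0 ≤ ρ^(2+η) * q^(-((d+η)/2)) := by positivity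
      linarith
  have hsum : ∑ y ∈ T, (1 + nsq (x - y))^(-((d+η)/2)) ≤ C := by
    classical
    have := h (T.image (fun y => x - y))
    rwa [Finset.sum_image (fun a _ b _ hab => sub_right_injective hab)] at this
  have e1 : m^((2+η)/d) = ρ^(2+η) := by rw [hρ, ← Real.rpow_mul (by linarith)]; congr 1; ring
  have e2 : m * ρ^(-((d:ℝ)-2)) = ρ^(2:ℝ) := by
    have : m = ρ^(d:ℝ) := by rw [hρ, ← Real.rpow_mul (by linarith)]; field_simp; simp
    nth_rw 1 [this]
    rw [← Real.rpow_add hρ0]; congr 1; ring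
  calc ∑ y ∈ T, (1 + nsq (x - y))^(-(((d:ℝ)-2)/2)) ≤ ∑ y ∈ T, (ρ^(2+η) * (1 + nsq (x-y))^(-((d+η)/2)) + ρ^(-((d:ℝ)-2))) :=
        Finset.sum_le_sum fun y _ => hpt _ (by linarith [nsq_nonneg (x-y)])
    _ = ρ^(2+η) * ∑ y ∈ T, (1 + nsq (x-y))^(-((d+η)/2)) + T.card * ρ^(-((d:ℝ)-2)) := by
        rw [Finset.sum_add_distrib, ← Finset.mul_sum]; simp
    _ ≤ ρ^(2+η) * C + m * ρ^(-((d:ℝ)-2)) := by gcongr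
    _ ≤ ρ^(2+η) * C + ρ^(2+η) := by
        rw [e2]; gcongr
        · linarith
    _ = _ := by rw [e1]; ring

lemma nsq_sub_le {d : ℕ} (x y : V d) (M : ℝ) (hx : nsq x ≤ M^2) (hy : nsq y ≤ M^2) : nsq (x - y) ≤ 4 * M^2 := by
  have : nsq (x - y) ≤ 2 * nsq x + 2 * nsq y := by
    unfold nsq
    rw [Finset.mul_sum, Finset.mul_sum, ← Finset.sum_add_distrib]
    apply Finset.sum_le_sum
    intro i _
    simp only [Pi.sub_apply, Int.cast_sub]
    nlinarith [sq_nonneg ((x i:ℝ) + y i)]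
  linarith

/-- The sparse potential. -/
lemma sparse (d : ℕ) (hd : 2 ≤ d) (η : ℝ) (hη : 0 < η) : ∃ C, 0 < C ∧ ∀ (M m : ℝ) (T : Finset (V d)), 1 ≤ M → 1 ≤ m → (T.card:ℝ) ≤ m →
    (∀ y ∈ T, nsq y ≤ M^2) → ∃ w : V d → ℝ, (∀ x, nb w x ≤ 2 * d * w x) ∧ (∀ x ∈ T, nb w x ≤ 2 * d * w x - 2 * d) ∧
    ∀ x, nsq x ≤ M^2 → 0 ≤ w x ∧ w x ≤ C * (1 + Real.log M) * m^((2+η)/d) := by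
  obtain ⟨C1, hC1, h1⟩ := sparse1 d hd
  obtain ⟨C2, hC2, h2⟩ := riesz_sum d hd η hη
  refine ⟨C1 * C2, by positivity, fun M m T hM hm hT hTM => ?_⟩
  obtain ⟨φ, ha, hb, hc⟩ := h1 M hM
  have enb : ∀ x, nb (fun x => ∑ y ∈ T, φ (x - y)) x = ∑ y ∈ T, nb φ (x - y) := by
    intro x
    simp only [nb]
    rw [Finset.sum_comm]
    apply Finset.sum_congr rfl
    intro i _
    rw [← Finset.sum_add_distrib]
    apply Finset.sum_congr rfl
    intro y _
    congr 2 <;> abel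
  refine ⟨fun x => ∑ y ∈ T, φ (x - y), ?_, ?_, ?_⟩
  · intro x
    rw [enb, Finset.mul_sum]
    exact Finset.sum_le_sum fun y _ => ha _
  · intro x hx
    rw [enb]
    beta_reduce
    rw [← Finset.sum_erase_add T (fun y => nb φ (x - y)) hx, ← Finset.sum_erase_add T (fun y => φ (x - y)) hx, mul_add, Finset.mul_sum, sub_self]
    have := Finset.sum_le_sum (s := T.erase x) fun y _ => ha (x - y)
    linarith
  · intro x hx
    have hr : ∀ y ∈ T, nsq (x - y) ≤ 4 * M^2 := fun y hy => nsq_sub_le x y M hx (hTM y hy)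
    refine ⟨Finset.sum_nonneg fun y hy => (hc _ (hr y hy)).1, ?_⟩
    have hl : 0 ≤ Real.log M := Real.log_nonneg hM
    calc ∑ y ∈ T, φ (x - y) ≤ ∑ y ∈ T, C1 * (1 + Real.log M) * (1 + nsq (x-y))^(-(((d:ℝ)-2)/2)) :=
          Finset.sum_le_sum fun y hy => (hc _ (hr y hy)).2
      _ = C1 * (1 + Real.log M) * ∑ y ∈ T, (1 + nsq (x-y))^(-(((d:ℝ)-2)/2)) := by rw [Finset.mul_sum]
      _ ≤ C1 * (1 + Real.log M) * (C2 * m^((2+η)/d)) := by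
          gcongr
          exact h2 m T x hm hT
      _ = _ := by ring
end UI

end

section
open MeasureTheory Filter Set
namespace UI

noncomputable def nrm {d : ℕ} (x : V d) : ℝ := √(nsq x)

lemma nrm_nonneg {d : ℕ} (x : V d) : 0 ≤ nrm x := Real.sqrt_nonneg _
lemma nrm_sq {d : ℕ} (x : V d) : (nrm x)^2 = nsq x := Real.sq_sqrt (nsq_nonneg x)

noncomputable def gc (h t : ℝ) : ℝ := Real.cosh (max t 0 / h)

lemma gc_one_le (h t : ℝ) : 1 ≤ gc h t := Real.one_le_cosh _

lemma cosh_mono {a b : ℝ} (ha : 0 ≤ a) (hab : a ≤ b) : Real.cosh a ≤ Real.cosh b := by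
  rw [Real.cosh_le_cosh, abs_of_nonneg ha, abs_of_nonneg (ha.trans hab)]; exact hab

lemma gc_mono (h : ℝ) (hh : 0 < h) {s t : ℝ} (hst : s ≤ t) : gc h s ≤ gc h t := by
  unfold gc
  apply cosh_mono (by positivity)
  gcongr

lemma gc_two (h : ℝ) (hh : 0 < h) (a b : ℝ) : gc h (a+b) + gc h (a-b) ≤ 2 * gc h a * Real.cosh (b/h) := by
  rcases le_total 0 a with ha | ha
  · have key : ∀ t, gc h t ≤ Real.cosh (t/h) := by
      intro t
      unfold gc
      rw [Real.cosh_le_cosh, abs_div, abs_div]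
      rw [abs_of_nonneg (show (0:ℝ) ≤ max t 0 from le_max_right _ _)]
      apply div_le_div_of_nonneg_right _ (abs_nonneg h)
      exact max_le (le_abs_self t) (abs_nonneg t)
    have e : 2 * gc h a * Real.cosh (b/h) = Real.cosh ((a+b)/h) + Real.cosh ((a-b)/h) := by
      unfold gc
      rw [max_eq_left ha, add_div, sub_div, Real.cosh_add, Real.cosh_sub]; ring
    rw [e]; exact add_le_add (key _) (key _)
  · have e : gc h a = 1 := by unfold gc; rw [max_eq_right ha]; simp
    rw [e]
    have key : ∀ t, t ≤ |b| → gc h t ≤ Real.cosh (b/h) := by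
      intro t ht
      unfold gc
      rw [Real.cosh_le_cosh, abs_div, abs_div]
      rw [abs_of_nonneg (show (0:ℝ) ≤ max t 0 from le_max_right _ _)]
      apply div_le_div_of_nonneg_right _ (abs_nonneg h)
      exact max_le ht (abs_nonneg b)
    have h1 := key (a+b) (by linarith [le_abs_self b])
    have h2 := key (a-b) (by linarith [neg_abs_le b])
    linarith

lemma sinh_le_mul_cosh (u : ℝ) (hu : 0 ≤ u) : Real.sinh u ≤ u * Real.cosh u := by
  have h := (Real.sinh_sub_id_strictMono).monotone
  have hm : MonotoneOn (fun u => u * Real.cosh u - Real.sinh u) (Ici 0) := by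
    apply monotoneOn_of_deriv_nonneg (convex_Ici 0)
    · fun_prop
    · fun_prop
    · intro x hx
      rw [interior_Ici] at hx
      have hd : HasDerivAt (fun u => u * Real.cosh u - Real.sinh u) (x * Real.sinh x) x := by
        have := ((hasDerivAt_id x).mul (Real.hasDerivAt_cosh x)).sub (Real.hasDerivAt_sinh x)
        refine this.congr_deriv ?_
        simp
      rw [hd.deriv]
      exact mul_nonneg (le_of_lt hx) (Real.sinh_nonneg_iff.mpr (le_of_lt hx))
  have := hm (by simp) (show u ∈ Ici 0 from hu) hu
  simp at this
  linarith

lemma gc_drift (h : ℝ) (hh : 0 < h) (t ρ : ℝ) (hρ : 1 ≤ ρ) (ht : t ≤ ρ) :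
    gc h (t + 1/(2*ρ)) ≤ gc h t * Real.exp (1/h^2) := by
  set s := max t 0 with hs
  set ε := 1/(2*ρ) with hε
  have hε0 : 0 < ε := by positivity
  have hs0 : 0 ≤ s := le_max_right _ _
  have hsρ : s ≤ ρ := max_le ht (by linarith)
  have hsε : s * ε ≤ 1/2 := by
    rw [hε, mul_one_div, div_le_div_iff₀ (by positivity) (by norm_num)]; linarith
  have hε2 : ε ≤ 1/2 := by
    rw [hε]; apply div_le_div_of_nonneg_left <;> linarith
  have h1 : gc h (t+ε) ≤ Real.cosh (s/h + ε/h) := by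
    unfold gc
    apply cosh_mono (by positivity)
    rw [← add_div]
    gcongr
    apply max_le
    · have : t ≤ s := le_max_left _ _
      linarith
    · positivity
  have h2 : Real.cosh (s/h + ε/h) ≤ Real.cosh (s/h) * (Real.cosh (ε/h) * (1 + 1/(2*h^2))) := by
    rw [Real.cosh_add]
    have a1 := sinh_le_mul_cosh (s/h) (by positivity)
    have a2 := sinh_le_mul_cosh (ε/h) (by positivity)
    have b1 : 0 ≤ Real.sinh (s/h) := Real.sinh_nonneg_iff.mpr (by positivity)
    have b2 : 0 ≤ Real.sinh (ε/h) := Real.sinh_nonneg_iff.mpr (by positivity)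
    have c1 := Real.cosh_pos (s/h)
    have c2 := Real.cosh_pos (ε/h)
    have a3 : Real.sinh (s/h) * Real.sinh (ε/h) ≤ (s/h * Real.cosh (s/h)) * (ε/h * Real.cosh (ε/h)) := by gcongr
    have a4 : (s/h * Real.cosh (s/h)) * (ε/h * Real.cosh (ε/h)) = (Real.cosh (s/h) * Real.cosh (ε/h)) * (s*ε/h^2) := by field_simp
    have a5 : s*ε/h^2 ≤ 1/(2*h^2) := by
      rw [div_le_div_iff₀ (by positivity) (by positivity)]; nlinarith [sq_nonneg h]
    have a6 : (Real.cosh (s/h) * Real.cosh (ε/h)) * (s*ε/h^2) ≤ (Real.cosh (s/h) * Real.cosh (ε/h)) * (1/(2*h^2)) := by gcongr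
    linarith
  have h3 : Real.cosh (ε/h) * (1 + 1/(2*h^2)) ≤ Real.exp (1/h^2) := by
    have a1 : Real.cosh (ε/h) ≤ Real.exp (1/(2*h^2)) := by
      refine (Real.cosh_le_exp_half_sq _).trans (Real.exp_le_exp.mpr ?_)
      rw [div_pow, div_div, div_le_div_iff₀ (by positivity) (by positivity)]
      nlinarith [sq_nonneg h, mul_nonneg (sq_nonneg h) (show 0 ≤ 1 - ε^2 by nlinarith)]
    have a2 : 1 + 1/(2*h^2) ≤ Real.exp (1/(2*h^2)) := by
      have := Real.add_one_le_exp (1/(2*h^2)); linarith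
    calc Real.cosh (ε/h) * (1 + 1/(2*h^2)) ≤ Real.exp (1/(2*h^2)) * Real.exp (1/(2*h^2)) := by gcongr
      _ = _ := by rw [← Real.exp_add]; congr 1; field_simp; norm_num
  have hpos : 0 < gc h t := by linarith [gc_one_le h t]
  calc gc h (t+ε) ≤ gc h t * (Real.cosh (ε/h) * (1 + 1/(2*h^2))) := h1.trans h2
    _ ≤ _ := by gcongr

lemma nrm_step {d : ℕ} (x : V d) (hx : 0 < nrm x) (i : Fin d) :
    nrm (x + Pi.single i 1) ≤ nrm x + 1/(2*nrm x) + (x i:ℝ)/nrm x ∧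
    nrm (x - Pi.single i 1) ≤ nrm x + 1/(2*nrm x) - (x i:ℝ)/nrm x := by
  have hs := nrm_sq x
  have hn := coord_le x i
  have hc : |(x i:ℝ)| ≤ nrm x := by
    apply abs_le_of_sq_le_sq _ hx.le
    rw [hs]; exact hn
  have hc' := abs_le.mp hc
  have hdiv : |(x i:ℝ)/nrm x| ≤ 1 := by rw [abs_div, abs_of_pos hx, div_le_one hx]; exact hc
  have hdiv' := abs_le.mp hdiv
  set ρ := nrm x
  have hp : 0 < 1/(2*ρ) := by positivity
  have e1 : (x i:ℝ)/ρ * ρ = x i := by field_simp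
  have e2 : 1/(2*ρ) * ρ = 1/2 := by field_simp
  set b := (x i:ℝ)/ρ
  set ε := 1/(2*ρ)
  have hb : b^2 ≤ 1 := by nlinarith
  constructor
  · have h0 : 0 ≤ ρ + ε + b := by
      by_contra hneg
      push Not at hneg
      nlinarith [sq_nonneg (ρ-1), mul_pos hx hx]
    unfold nrm
    rw [nsq_add, Real.sqrt_le_left h0, ← hs]
    nlinarith [sq_nonneg (ε + b)]
  · have h0 : 0 ≤ ρ + ε - b := by
      by_contra hneg
      push Not at hneg
      nlinarith [sq_nonneg (ρ-1), mul_pos hx hx]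
    unfold nrm
    rw [nsq_sub, Real.sqrt_le_left h0, ← hs]
    nlinarith [sq_nonneg (ε - b)]

lemma nrm_one_le {d : ℕ} (x : V d) (hx : 0 < nrm x) : 1 ≤ nrm x := by
  have h : nsq x = ((∑ i, (x i)^2 : ℤ) : ℝ) := by simp [nsq]
  have h1 : 0 < nsq x := by rw [← nrm_sq]; positivity
  unfold nrm
  rw [Real.one_le_sqrt, h]
  rw [h] at h1
  have : 0 < (∑ i, (x i)^2 : ℤ) := by exact_mod_cast h1
  exact_mod_cast this

lemma gc_nb {d : ℕ} (h R : ℝ) (hh : 1 ≤ h) (hR : 0 ≤ R) (x : V d) (hx : R < nrm x) :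
    nb (fun x => gc h (nrm x - R - 1)) x ≤ 2 * d * (gc h (nrm x - R - 1) * Real.exp (2/h^2)) := by
  have hh0 : 0 < h := by linarith
  have hρ0 : 0 < nrm x := by linarith
  have hρ := nrm_one_le x hρ0
  set t := nrm x - R - 1
  have hdr := gc_drift h hh0 t (nrm x) hρ (by simp only [t]; linarith)
  have key : ∀ i, gc h (nrm (x + Pi.single i 1) - R - 1) + gc h (nrm (x - Pi.single i 1) - R - 1) ≤
      2 * (gc h t * Real.exp (2/h^2)) := by
    intro i
    obtain ⟨h1, h2⟩ := nrm_step x hρ0 i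
    set b := (x i:ℝ)/nrm x with hb
    have hb1 : |b| ≤ 1 := by
      rw [hb, abs_div, abs_of_pos hρ0, div_le_one hρ0]
      apply abs_le_of_sq_le_sq _ hρ0.le
      rw [nrm_sq]; exact coord_le x i
    have hcb : Real.cosh (b/h) ≤ Real.exp (1/h^2) := by
      refine (Real.cosh_le_exp_half_sq _).trans (Real.exp_le_exp.mpr ?_)
      rw [div_pow, div_div, div_le_div_iff₀ (by positivity) (by positivity)]
      have : b^2 ≤ 1 := by rw [← sq_abs]; nlinarith [abs_nonneg b]
      nlinarith [mul_nonneg (sq_nonneg h) (sub_nonneg.mpr this), sq_nonneg h]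
    have hpos : 0 ≤ gc h t := by linarith [gc_one_le h t]
    have hcp := Real.cosh_pos (b/h)
    have hpos2 : 0 ≤ gc h (t + 1/(2*nrm x)) := by linarith [gc_one_le h (t + 1/(2*nrm x))]
    calc _ ≤ gc h (t + 1/(2*nrm x) + b) + gc h (t + 1/(2*nrm x) - b) := by
          apply add_le_add <;> apply gc_mono h hh0 <;> simp only [t] <;> linarith
      _ ≤ 2 * gc h (t + 1/(2*nrm x)) * Real.cosh (b/h) := gc_two h hh0 _ _
      _ ≤ 2 * (gc h t * Real.exp (1/h^2)) * Real.exp (1/h^2) := by gcongr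
      _ = _ := by
          have : Real.exp (2/h^2) = Real.exp (1/h^2) * Real.exp (1/h^2) := by rw [← Real.exp_add]; congr 1; ring
          rw [this]; ring
  unfold nb
  calc _ ≤ ∑ i : Fin d, 2 * (gc h t * Real.exp (2/h^2)) := Finset.sum_le_sum fun i _ => key i
    _ = _ := by simp; ring

lemma nb_sqrt {d : ℕ} (F G : V d → ℝ) (x : V d) (a b : ℝ) 
    (hF : ∀ i, 0 ≤ F (x + Pi.single i 1) ∧ 0 ≤ F (x - Pi.single i 1))
    (hG : ∀ i, 0 ≤ G (x + Pi.single i 1) ∧ 0 ≤ G (x - Pi.single i 1))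
    (h1 : nb F x ≤ 2 * d * a) (h2 : nb G x ≤ 2 * d * b) (ha : 0 ≤ a) (hb : 0 ≤ b) (hab : a * b ≤ F x * G x) :
    nb (fun x => √(F x * G x)) x ≤ 2 * d * √(F x * G x) := by
  classical
  have hcs : nb (fun x => √(F x * G x)) x ≤ √(nb F x) * √(nb G x) := by
    let f : Fin d × Bool → ℝ := fun p => if p.2 then F (x + Pi.single p.1 1) else F (x - Pi.single p.1 1)
    let g : Fin d × Bool → ℝ := fun p => if p.2 then G (x + Pi.single p.1 1) else G (x - Pi.single p.1 1)
    have h := Real.sum_sqrt_mul_sqrt_le (Finset.univ) (f := f) (g := g) 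
      (fun p => by simp only [f]; split_ifs; exacts [(hF _).1, (hF _).2])
      (fun p => by simp only [g]; split_ifs; exacts [(hG _).1, (hG _).2])
    rw [Fintype.sum_prod_type, Fintype.sum_prod_type, Fintype.sum_prod_type] at h
    simp only [Fintype.sum_bool, f, g, if_true, Bool.false_eq_true, if_false] at h
    unfold nb
    refine le_trans (le_of_eq ?_) h
    apply Finset.sum_congr rfl
    intro i _
    beta_reduce
    rw [Real.sqrt_mul (hF i).1, Real.sqrt_mul (hF i).2]
  refine hcs.trans ?_
  have hdd : (0:ℝ) ≤ 2 * d := by positivity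
  calc √(nb F x) * √(nb G x) ≤ √(2*d*a) * √(2*d*b) := by gcongr
    _ = 2 * d * √(a*b) := by
        rw [← Real.sqrt_mul (by positivity), show 2*d*a*(2*d*b) = (2*(d:ℝ))^2*(a*b) by ring, Real.sqrt_mul (by positivity),
          Real.sqrt_sq hdd]
    _ ≤ _ := by gcongr
end UI

end

section
open MeasureTheory Filter Set
namespace UI

lemma nrm_nb_le {d : ℕ} (x : V d) (i : Fin d) : nrm (x + Pi.single i 1) ≤ nrm x + 1 ∧ nrm (x - Pi.single i 1) ≤ nrm x + 1 := by
  have h0 := nrm_nonneg x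
  have hs := nrm_sq x
  have hc : |(x i:ℝ)| ≤ nrm x := by
    apply abs_le_of_sq_le_sq _ h0
    rw [hs]; exact coord_le x i
  have hc' := abs_le.mp hc
  constructor
  · show √(nsq _) ≤ _
    rw [nsq_add, Real.sqrt_le_left (by linarith)]; nlinarith
  · show √(nsq _) ≤ _
    rw [nsq_sub, Real.sqrt_le_left (by linarith)]; nlinarith

/-- Existence of the superharmonic function comparable with the square root of gc. -/
lemma outer_super (d : ℕ) (hd : 2 ≤ d) (η : ℝ) (hη : 0 < η) : ∃ C, 0 < C ∧ ∀ (k : ℕ) (S : Finset (V d)) (m R h : ℝ),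
    1 ≤ m → 0 ≤ R → 1 ≤ h → C * (1 + Real.log (k+2)) * m^((2+η)/d) ≤ h^2 → (∀ x ∈ S, nsq x ≤ (k:ℝ)^2) →
    ((S.filter (fun x => R < nrm x)).card:ℝ) ≤ m → 
    ∃ v : V d → ℝ, (∀ x ∈ S, nb v x ≤ 2 * (d:ℝ) * v x) ∧ (∀ y ∈ outb S, √(gc h (nrm y - R - 1)) ≤ v y) ∧
      ∀ x ∈ S, v x ≤ 2 * √(gc h (nrm x - R - 1)) := by
  classical
  obtain ⟨C, hC, H⟩ := sparse d hd η hη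
  refine ⟨32 * C, by positivity, fun k S m R h hm hR hh hCh hS hT => ?_⟩
  set T := S.filter (fun x => R < nrm x) with hTdef
  have hk : (0:ℝ) ≤ k := Nat.cast_nonneg k
  have hh0 : 0 < h := by linarith
  obtain ⟨w, hw1, hw2, hw3⟩ := H (k+2) m T (by linarith) hm hT (fun y hy => by
    have := hS y (Finset.mem_filter.mp hy).1
    nlinarith)
  set β := 32 / h^2 with hβ
  have hβ0 : 0 < β := by positivity
  set F : V d → ℝ := fun x => gc h (nrm x - R - 1) with hF
  set G : V d → ℝ := fun x => 1 + β * w x with hG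
  have hF1 : ∀ x, 1 ≤ F x := fun x => gc_one_le _ _
  have hGb : ∀ x, nsq x ≤ ((k:ℝ)+2)^2 → 1 ≤ G x ∧ G x ≤ 2 := by
    intro x hx
    obtain ⟨a1, a2⟩ := hw3 x hx
    refine ⟨by simp only [hG]; nlinarith [mul_nonneg hβ0.le a1], ?_⟩
    have : β * w x ≤ 1 := by
      rw [hβ, div_mul_eq_mul_div, div_le_one (by positivity)]
      linarith
    simp only [hG]; linarith
  have hnbr : ∀ x ∈ S, ∀ i, nsq (x + Pi.single i 1 : V d) ≤ ((k:ℝ)+2)^2 ∧ nsq (x - Pi.single i 1 : V d) ≤ ((k:ℝ)+2)^2 := by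
    intro x hx i
    have h1 := nrm_nb_le x i
    have h2 : nrm x ≤ k := by
      unfold nrm; rw [Real.sqrt_le_left hk]; exact hS x hx
    rw [← nrm_sq, ← nrm_sq]
    constructor
    · exact pow_le_pow_left₀ (nrm_nonneg _) (by linarith) 2
    · exact pow_le_pow_left₀ (nrm_nonneg _) (by linarith) 2
  have enbG : ∀ x, nb G x = 2 * d + β * nb w x := by
    intro x
    simp only [nb, hG, Finset.mul_sum]
    rw [Finset.sum_congr rfl (fun i _ => show (1 + β * w (x + Pi.single i 1) + (1 + β * w (x - Pi.single i 1))) =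
      2 + β * (w (x + Pi.single i 1) + w (x - Pi.single i 1)) by ring), Finset.sum_add_distrib]
    simp; ring
  refine ⟨fun x => √(F x * G x), ?_, ?_, ?_⟩
  · intro x hx
    have hxk : nsq x ≤ ((k:ℝ)+2)^2 := by have := hS x hx; nlinarith
    obtain ⟨g1, g2⟩ := hGb x hxk
    have hn := hnbr x hx
    have hFn : ∀ i, 0 ≤ F (x + Pi.single i 1) ∧ 0 ≤ F (x - Pi.single i 1) := fun i => 
      ⟨by linarith [hF1 (x + Pi.single i 1)], by linarith [hF1 (x - Pi.single i 1)]⟩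
    have hGn : ∀ i, 0 ≤ G (x + Pi.single i 1) ∧ 0 ≤ G (x - Pi.single i 1) := fun i => 
      ⟨by linarith [(hGb _ (hn i).1).1], by linarith [(hGb _ (hn i).2).1]⟩
    have hFx := hF1 x
    by_cases hxT : R < nrm x
    · have hxT' : x ∈ T := Finset.mem_filter.mpr ⟨hx, hxT⟩
      have h2 : nb G x ≤ 2 * d * (G x - β) := by
        rw [enbG]
        have := mul_le_mul_of_nonneg_left (hw2 x hxT') hβ0.le
        simp only [hG]; linarith
      have hdd : (0:ℝ) < 2 * d := by have : (2:ℝ) ≤ d := by exact_mod_cast hd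
                                     linarith
      have hb : 0 ≤ G x - β := by
        have : 0 ≤ nb G x := Finset.sum_nonneg fun i _ => add_nonneg (hGn i).1 (hGn i).2
        exact nonneg_of_mul_nonneg_right (this.trans h2) hdd
      refine nb_sqrt F G x _ (G x - β) hFn hGn (gc_nb h R hh hR x hxT) h2 ?_ hb ?_
      · have : 0 ≤ gc h (nrm x - R - 1) := by linarith [gc_one_le h (nrm x - R - 1)]
        positivity
      · show F x * Real.exp (2/h^2) * (G x - β) ≤ F x * G x
        rw [mul_assoc]
        apply mul_le_mul_of_nonneg_left _ (by linarith)
        have he : Real.exp (2/h^2) ≤ 1 + 16/h^2 := by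
          have hu0 : 0 ≤ 2/h^2 := by positivity
          have hu1 : 2/h^2 ≤ 2 := by rw [div_le_iff₀ (by positivity)]; nlinarith
          set u := 2/h^2
          have e1 : 16/h^2 = 8 * u := by simp only [u]; ring
          rw [e1]
          have e2 : Real.exp (-u) ≥ 1 - u := by have := Real.add_one_le_exp (-u); linarith
          have e3 : Real.exp u ≤ 8 := by
            have : Real.exp u ≤ Real.exp 2 := Real.exp_le_exp.mpr hu1
            have h3 : Real.exp 2 = Real.exp 1 * Real.exp 1 := by rw [← Real.exp_add]; norm_num
            have := Real.exp_one_lt_d9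
            have := Real.exp_pos 1
            nlinarith
          have e4 : Real.exp u * Real.exp (-u) = 1 := by rw [← Real.exp_add]; simp
          have e5 := Real.exp_pos u
          nlinarith
        have e16 : 16/h^2 = β/2 := by rw [hβ]; ring
        rw [e16] at he
        calc Real.exp (2/h^2) * (G x - β) ≤ (1 + β/2) * (G x - β) := by gcongr
          _ ≤ G x := by nlinarith
    · push Not at hxT
      have hFone : ∀ y : V d, nrm y ≤ R + 1 → F y = 1 := by
        intro y hy
        simp only [hF, gc]
        rw [max_eq_right (by linarith)]; simp
      have h1 : nb F x ≤ 2 * d * 1 := by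
        unfold nb
        rw [Finset.sum_congr rfl (fun i _ => show F (x + Pi.single i 1) + F (x - Pi.single i 1) = 2 by
          rw [hFone _ (by linarith [(nrm_nb_le x i).1]), hFone _ (by linarith [(nrm_nb_le x i).2])]; norm_num)]
        simp; linarith
      have h2 : nb G x ≤ 2 * d * G x := by
        rw [enbG]
        have := mul_le_mul_of_nonneg_left (hw1 x) hβ0.le
        simp only [hG]; linarith
      refine nb_sqrt F G x 1 (G x) hFn hGn h1 h2 (by norm_num) (by linarith) ?_
      exact mul_le_mul_of_nonneg_right hFx (by linarith)
  · intro y hy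
    have hyk := outb_nsq S k hS y hy
    have := (hGb y (hyk.trans (by push_cast; nlinarith))).1
    apply Real.sqrt_le_sqrt
    have := hF1 y
    show F y ≤ F y * G y
    nlinarith
  · intro x hx
    have hxk : nsq x ≤ ((k:ℝ)+2)^2 := by have := hS x hx; nlinarith
    have := (hGb x hxk).2
    have hF0 := hF1 x
    calc √(F x * G x) ≤ √(2^2 * F x) := by
          apply Real.sqrt_le_sqrt; nlinarith
      _ = 2 * √(F x) := by rw [Real.sqrt_mul (by norm_num), Real.sqrt_sq (by norm_num)]

open Classical in
noncomputable def Zf {d : ℕ} (m R h : ℝ) (S : Finset (V d)) : ℝ :=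
  if ((S.filter (fun x => R < nrm x)).card:ℝ) ≤ m then ∑ x ∈ S, √(gc h (nrm x - R - 1)) else 0

lemma Zf_nonneg {d : ℕ} (m R h : ℝ) (S : Finset (V d)) : 0 ≤ Zf m R h S := by
  unfold Zf
  split_ifs
  · exact Finset.sum_nonneg fun _ _ => Real.sqrt_nonneg _
  · exact le_rfl

lemma outer (d : ℕ) (hd : 2 ≤ d) (η : ℝ) (hη : 0 < η) : ∃ C, 0 < C ∧ ∀ (k : ℕ) (m R h D : ℝ),
    1 ≤ m → 0 ≤ R → 1 ≤ h → C * (1 + Real.log (k+2)) * m^((2+η)/d) ≤ h^2 → 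
    μ0.real {w | (((uAggFrom ({0} : Finset (V d)) w k).filter (fun x => R < nrm x)).card:ℝ) ≤ m ∧
      ∃ x ∈ uAggFrom ({0} : Finset (V d)) w k, R + 1 + D < nrm x} ≤ (k+2)^2 * Real.exp (-(D/(2*h))) := by
  classical
  have hd0 : 0 < d := by omega
  obtain ⟨C, hC, H⟩ := outer_super d hd η hη
  refine ⟨C, hC, fun K m R h D hm hR hh hCh => ?_⟩
  have hh0 : 0 < h := by linarith
  have step : ∀ k, k ≤ K → EE k (Zf (d := d) m R h) ≤ ((k:ℝ)+1)*(k+2)/2 := by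
    intro k
    induction k with
    | zero =>
      intro _
      rw [EE_zero]
      unfold Zf
      have h0 : nrm (0 : V d) = 0 := by simp [nrm, nsq]
      have : gc h (nrm (0 : V d) - R - 1) = 1 := by
        rw [h0]; unfold gc; rw [max_eq_right (by linarith)]; simp
      split_ifs
      · simp [this]
      · norm_num
    | succ k ih =>
      intro hk
      have ihk := ih (by omega)
      rw [EE_step hd0]
      have hmono : EE k (Kop (Zf (d := d) m R h)) ≤ EE k (fun S : Finset (V d) => (1 + 2/((k:ℝ)+1)) * Zf m R h S) := by
        apply EE_mono hd0
        intro S hS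
        by_cases hcard : ((S.filter (fun x => R < nrm x)).card:ℝ) ≤ m
        · have hlog : C * (1 + Real.log (k+2)) * m^((2+η)/d) ≤ h^2 := by
            refine le_trans ?_ hCh
            have : (k:ℝ) ≤ K := by exact_mod_cast (by omega : k ≤ K)
            have : Real.log ((k:ℝ)+2) ≤ Real.log (K+2) := Real.log_le_log (by positivity) (by linarith)
            have : 0 < m := by linarith
            gcongr
          obtain ⟨v, v1, v2, v3⟩ := H k S m R h hm hR hh hlog hS.2.2 hcard
          have hne : S.Nonempty := ⟨0, hS.2.1⟩
          have hZ : Zf m R h S = ∑ x ∈ S, √(gc h (nrm x - R - 1)) := by unfold Zf; rw [if_pos hcard]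
          have hks := ker_super hd0 S v v1
          have hc : (S.card:ℝ) = k + 1 := by rw [hS.1]; push_cast; ring
          calc Kop (Zf m R h) S ≤ ∑ y ∈ outb S, ker S y * (Zf m R h S + v y) := by
                unfold Kop
                apply Finset.sum_le_sum
                intro y hy
                apply mul_le_mul_of_nonneg_left _ (ker_nonneg S y)
                have hyS : y ∉ S := (outb_mem S y hy).1
                rw [hZ]
                unfold Zf
                split_ifs
                · rw [Finset.sum_insert hyS]
                  linarith [v2 y hy]
                · have : 0 ≤ ∑ x ∈ S, √(gc h (nrm x - R - 1)) := Finset.sum_nonneg fun _ _ => Real.sqrt_nonneg _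
                  linarith [v2 y hy, Real.sqrt_nonneg (gc h (nrm y - R - 1))]
            _ = Zf m R h S + ∑ y ∈ outb S, ker S y * v y := by
                simp_rw [mul_add]
                rw [Finset.sum_add_distrib, ← Finset.sum_mul, ker_one hd0 S hne, one_mul]
            _ ≤ Zf m R h S + (1/(S.card:ℝ)) * ∑ x ∈ S, v x := by linarith
            _ ≤ Zf m R h S + (1/(S.card:ℝ)) * ∑ x ∈ S, 2 * √(gc h (nrm x - R - 1)) := by
                gcongr with x hx
                exact v3 x hx
            _ = _ := by rw [← Finset.mul_sum, ← hZ, hc]; ring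
        · have hZ : Zf m R h S = 0 := by unfold Zf; rw [if_neg hcard]
          rw [hZ, mul_zero]
          unfold Kop
          apply le_of_eq
          apply Finset.sum_eq_zero
          intro y _
          have : Zf m R h (insert y S) = 0 := by
            unfold Zf
            rw [if_neg]
            intro hcon
            apply hcard
            refine le_trans ?_ hcon
            exact_mod_cast Finset.card_le_card (Finset.filter_subset_filter _ (Finset.subset_insert y S))
          rw [this, mul_zero]
      rw [EE_mul] at hmono
      refine hmono.trans ?_
      calc _ ≤ (1 + 2/((k:ℝ)+1)) * (((k:ℝ)+1)*(k+2)/2) := by gcongr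
        _ = _ := by push_cast; field_simp; ring
  rw [EE_prob K (fun S : Finset (V d) => ((S.filter (fun x => R < nrm x)).card:ℝ) ≤ m ∧ ∃ x ∈ S, R + 1 + D < nrm x)]
  have hfin : EE K (fun S : Finset (V d) => if (((S.filter (fun x => R < nrm x)).card:ℝ) ≤ m ∧ ∃ x ∈ S, R + 1 + D < nrm x) then (1:ℝ) else 0) ≤
      EE K (fun S : Finset (V d) => (2 * Real.exp (-(D/(2*h)))) * Zf m R h S) := by
    apply EE_mono hd0
    intro S hS
    split_ifs with hc
    · obtain ⟨hc1, x, hx, hxD⟩ := hc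
      have hZ : √(gc h (nrm x - R - 1)) ≤ Zf m R h S := by
        unfold Zf; rw [if_pos hc1]
        exact Finset.single_le_sum (f := fun x => √(gc h (nrm x - R - 1))) (fun _ _ => Real.sqrt_nonneg _) hx
      have hg : Real.exp (D/h) / 4 ≤ gc h (nrm x - R - 1) := by
        have h1 : Real.exp (D/h) / 2 ≤ gc h D := by
          unfold gc
          rw [Real.cosh_eq]
          have : Real.exp (D/h) ≤ Real.exp (max D 0 / h) := Real.exp_le_exp.mpr (by gcongr; exact le_max_left _ _)
          have := Real.exp_pos (-(max D 0 / h))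
          linarith
        have h2 := gc_mono h hh0 (show D ≤ nrm x - R - 1 by linarith)
        have := Real.exp_pos (D/h)
        linarith
      have hs : Real.exp (D/(2*h)) / 2 ≤ √(gc h (nrm x - R - 1)) := by
        apply Real.le_sqrt_of_sq_le
        refine le_trans (le_of_eq ?_) hg
        rw [div_pow, sq, ← Real.exp_add]
        have : D/(2*h) + D/(2*h) = D/h := by field_simp; ring
        rw [this]; norm_num
      have he := Real.exp_pos (-(D/(2*h)))
      have e1 : Real.exp (-(D/(2*h))) * Real.exp (D/(2*h)) = 1 := by rw [← Real.exp_add]; simp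
      calc (1:ℝ) = 2 * Real.exp (-(D/(2*h))) * (Real.exp (D/(2*h)) / 2) := by linarith
        _ ≤ _ := by gcongr; exact hs.trans hZ
    · exact mul_nonneg (by positivity) (Zf_nonneg m R h S)
  rw [EE_mul] at hfin
  have hfin2 := hfin.trans (mul_le_mul_of_nonneg_left (step K le_rfl) (by positivity))
  refine le_trans (le_of_eq ?_) (hfin2.trans ?_)
  · congr 1; funext S; split_ifs <;> rfl
  · have := Real.exp_pos (-(D/(2*h)))
    have hK : (0:ℝ) ≤ K := Nat.cast_nonneg K
    nlinarith [mul_nonneg this.le hK]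
end UI

end

section
open MeasureTheory Filter Set
namespace UI

noncomputable def dot {d : ℕ} (z y : V d) : ℝ := ∑ i, (z i:ℝ) * (y i:ℝ)

lemma dot_le {d : ℕ} (z y : V d) : |dot z y| ≤ nrm z * nrm y := by
  apply abs_le_of_sq_le_sq _ (mul_nonneg (nrm_nonneg _) (nrm_nonneg _))
  rw [mul_pow, nrm_sq, nrm_sq]
  exact Finset.sum_mul_sq_le_sq_mul_sq _ _ _

lemma dot_add {d : ℕ} (z y : V d) (i : Fin d) : dot z (y + Pi.single i 1) = dot z y + z i := by
  have : ∀ j, ((y + Pi.single i 1 : V d) j : ℝ) = y j + if j = i then 1 else 0 := by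
    intro j; simp [Pi.add_apply, Pi.single_apply]
  simp only [dot, this, mul_add, Finset.sum_add_distrib]
  simp

lemma dot_sub {d : ℕ} (z y : V d) (i : Fin d) : dot z (y - Pi.single i 1) = dot z y - z i := by
  have : ∀ j, ((y - Pi.single i 1 : V d) j : ℝ) = y j - if j = i then 1 else 0 := by
    intro j; simp [Pi.sub_apply, Pi.single_apply]
  simp only [dot, this, mul_sub, Finset.sum_sub_distrib]
  simp

lemma nb_dot {d : ℕ} (z y : V d) (p : V d → ℝ) : nb (fun y => dot z y * p y) y =
    dot z y * nb p y + ∑ i, (z i:ℝ) * (p (y + Pi.single i 1) - p (y - Pi.single i 1)) := by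
  simp only [nb, dot_add, dot_sub, Finset.mul_sum]
  rw [← Finset.sum_add_distrib]
  apply Finset.sum_congr rfl
  intro i _
  ring

noncomputable def QQ {d : ℕ} (y : V d) : ℝ := (nsq y + 1)^(-((d:ℝ)/2)) * √(nsq y + 1) / (nsq y + 1)^2

lemma QQ_pos {d : ℕ} (y : V d) : 0 < QQ y := by
  have := nsq_nonneg y
  unfold QQ; positivity

lemma coord_nrm {d : ℕ} (z : V d) (i : Fin d) : |(z i:ℝ)| ≤ nrm z := by
  apply abs_le_of_sq_le_sq _ (nrm_nonneg z)
  rw [nrm_sq]; exact coord_le z i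

lemma lap_dot (d : ℕ) : ∃ C, 0 ≤ C ∧ ∀ (z y : V d), 16 ≤ nsq y →
    |nb (fun y => dot z y * pw 0 ((d:ℝ)/2) y) y - 2 * d * (dot z y * pw 0 ((d:ℝ)/2) y)| ≤ C * (nrm z * QQ y) := by
  set γ := (d:ℝ)/2 with hγ
  have hγ0 : 0 ≤ γ := by positivity
  obtain ⟨C1, hC1, h1⟩ := lap_pw d γ hγ0
  obtain ⟨C2, hC2, h2⟩ := fg_odd γ hγ0
  refine ⟨(4*γ*(1+γ) + C1) + d * (8 * C2), by positivity, fun z y hy => ?_⟩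
  have hs := nsq_nonneg y
  have hl := h1 0 y le_rfl (Or.inr hy)
  simp only [add_zero] at hl
  have hQ : QQ y = (nsq y + 1)^(-γ) * (√(nsq y + 1) / (nsq y + 1)^2) := by rw [QQ, mul_div_assoc]
  have hpm := fun i => pw_pm 0 γ le_rfl y i (w_small 0 le_rfl y (Or.inr hy) i).1
  have hws := fun i => w_small 0 le_rfl y (Or.inr hy) i
  simp only [add_zero] at hpm hws
  have hny : nrm y ≤ √(nsq y + 1) := Real.sqrt_le_sqrt (by linarith)
  have hdot : |dot z y| ≤ nrm z * √(nsq y + 1) := (dot_le z y).trans (mul_le_mul_of_nonneg_left hny (nrm_nonneg z))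
  have hA2 : nsq y = (nsq y + 1) - 1 := by ring
  have hsq : √(nsq y + 1) ^ 2 = nsq y + 1 := Real.sq_sqrt (by linarith)
  set A := nsq y + 1 with hA
  have hA0 : 0 < A := by linarith
  set a := A^(-γ) with ha
  have ha0 : 0 < a := Real.rpow_pos_of_pos hA0 _
  have hsA : 0 < √A := Real.sqrt_pos.mpr hA0
  have hz := nrm_nonneg z
  rw [nb_dot]
  -- even part
  have ev : |dot z y * (nb (pw 0 γ) y - 2 * d * pw 0 γ y) - dot z y * (4 * γ * a / A)| ≤ (4*γ*(1+γ) + C1) * (nrm z * QQ y) := by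
    have e1 : a * (4 * γ * (γ+1) * nsq y / A^2 - 2 * d * γ / A) = 4 * γ * a / A - 4 * γ * (γ+1) * (a / A^2) := by
      rw [hA2, show (d:ℝ) = 2 * γ by rw [hγ]; ring]
      field_simp
      ring
    rw [e1] at hl
    have e2 : |nb (pw 0 γ) y - 2 * d * pw 0 γ y - 4 * γ * a / A| ≤ (4*γ*(1+γ) + C1) * (a / A^2) := by
      have hp : 0 ≤ 4 * γ * (γ+1) * (a / A^2) := by positivity
      rw [abs_le] at hl ⊢
      constructor <;> linarith [hl.1, hl.2]
    rw [← mul_sub, abs_mul, hQ]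
    calc |dot z y| * |nb (pw 0 γ) y - 2 * d * pw 0 γ y - 4 * γ * a / A| ≤ (nrm z * √A) * ((4*γ*(1+γ) + C1) * (a / A^2)) := by
          gcongr
      _ = _ := by ring
  have od : |∑ i, (z i:ℝ) * (pw 0 γ (y + Pi.single i 1) - pw 0 γ (y - Pi.single i 1)) + dot z y * (4 * γ * a / A)| ≤ d * (8 * C2) * (nrm z * QQ y) := by
    have e1 : dot z y * (4 * γ * a / A) = ∑ i, (z i:ℝ) * (a * (2 * γ * (2 * (y i:ℝ) / A))) := by
      rw [dot, Finset.sum_mul]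
      apply Finset.sum_congr rfl
      intro i _
      ring
    rw [e1, ← Finset.sum_add_distrib]
    refine (Finset.abs_sum_le_sum_abs _ _).trans ?_
    calc _ ≤ ∑ i : Fin d, (8 * C2) * (nrm z * QQ y) := by
          apply Finset.sum_le_sum
          intro i _
          rw [(hpm i).1, (hpm i).2, ← mul_add, abs_mul]
          have hw := h2 _ (hws i).1
          have hw2 := (hws i).2.1
          set w := 2 * (y i:ℝ) / A
          have hwa : |w| ≤ 2 * √A / A := by
            apply abs_le_of_sq_le_sq _ (by positivity)
            refine hw2.trans (le_of_eq ?_)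
            rw [div_pow, mul_pow, hsq]; field_simp; norm_num
          have hw3 : |w|^3 ≤ 8 * (√A / A^2) := by
            have : |w|^3 = |w| * w^2 := by rw [← sq_abs]; ring
            rw [this]
            calc |w| * w^2 ≤ (2 * √A / A) * (4 / A) := by gcongr
              _ = _ := by field_simp; norm_num
          have e2 : a * fg γ w - a * fg γ (-w) + a * (2 * γ * w) = a * (fg γ w - fg γ (-w) + 2 * γ * w) := by ring
          rw [e2, abs_mul, abs_of_pos ha0, hQ]
          calc |(z i:ℝ)| * (a * |fg γ w - fg γ (-w) + 2 * γ * w|) ≤ nrm z * (a * (C2 * (8 * (√A / A^2)))) := by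
                gcongr
                · exact coord_nrm z i
                · exact hw.trans (by gcongr)
            _ = _ := by ring
      _ = _ := by simp; ring
  have := abs_add_le (dot z y * (nb (pw 0 γ) y - 2 * d * pw 0 γ y) - dot z y * (4 * γ * a / A)) 
    (∑ i, (z i:ℝ) * (pw 0 γ (y + Pi.single i 1) - pw 0 γ (y - Pi.single i 1)) + dot z y * (4 * γ * a / A))
  calc _ = |dot z y * (nb (pw 0 γ) y - 2 * d * pw 0 γ y) - dot z y * (4 * γ * a / A) + 
    (∑ i, (z i:ℝ) * (pw 0 γ (y + Pi.single i 1) - pw 0 γ (y - Pi.single i 1)) + dot z y * (4 * γ * a / A))| := by congr 1; ring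
    _ ≤ _ := by linarith

lemma lap_one (d : ℕ) (hd : 2 ≤ d) : ∃ C, 0 ≤ C ∧ ∀ (y : V d), 16 ≤ nsq y →
    |nb (pw 0 (((d:ℝ)-2)/2)) y - 2 * d * pw 0 (((d:ℝ)-2)/2) y| ≤ C * (√(nsq y + 1) * QQ y) := by
  have hd2 : (2:ℝ) ≤ d := by exact_mod_cast hd
  set γ := ((d:ℝ)-2)/2 with hγ
  have hγ0 : 0 ≤ γ := by rw [hγ]; linarith
  obtain ⟨C1, hC1, h1⟩ := lap_pw d γ hγ0
  refine ⟨2*d*γ + C1, by positivity, fun y hy => ?_⟩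
  have hs := nsq_nonneg y
  have hl := h1 0 y le_rfl (Or.inr hy)
  simp only [add_zero] at hl
  have hA2 : nsq y = (nsq y + 1) - 1 := by ring
  have hsq : √(nsq y + 1) ^ 2 = nsq y + 1 := Real.sq_sqrt (by linarith)
  unfold QQ
  set A := nsq y + 1 with hA
  have hA0 : 0 < A := by linarith
  have e0 : A^(-((d:ℝ)/2)) = A^(-γ) / A := by
    rw [← Real.rpow_sub_one hA0.ne']; congr 1; rw [hγ]; ring
  set a := A^(-γ) with ha
  have ha0 : 0 < a := Real.rpow_pos_of_pos hA0 _
  have e1 : a * (4 * γ * (γ+1) * nsq y / A^2 - 2 * d * γ / A) = - (2 * d * γ) * (a / A^2) := by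
    rw [hA2, show (d:ℝ) = 2 * γ + 2 by rw [hγ]; ring]
    field_simp
    ring
  rw [e1] at hl
  have e3 : √A * (A^(-((d:ℝ)/2)) * √A / A^2) = a / A^2 := by
    rw [e0]
    calc √A * (a / A * √A / A^2) = a / A * (√A^2) / A^2 := by ring
      _ = _ := by rw [hsq]; field_simp
  rw [e3]
  have hp : 0 ≤ 2 * d * γ * (a / A^2) := by positivity
  rw [abs_le] at hl ⊢
  constructor <;> linarith [hl.1, hl.2]

lemma lap_three (d : ℕ) (hd : 2 ≤ d) : ∃ R0, 16 ≤ R0 ∧ ∀ (y : V d), R0 ≤ nsq y →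
    2 * d * pw 0 (((d:ℝ)+1)/2) y + QQ y ≤ nb (pw 0 (((d:ℝ)+1)/2)) y := by
  have hd2 : (2:ℝ) ≤ d := by exact_mod_cast hd
  set γ := ((d:ℝ)+1)/2 with hγ
  have hγ0 : 1 ≤ γ := by rw [hγ]; linarith
  obtain ⟨C1, hC1, h1⟩ := lap_pw d γ (by linarith)
  refine ⟨16 + C1 + 2 * d, by nlinarith, fun y hy => ?_⟩
  have hs := nsq_nonneg y
  have hl := h1 0 y le_rfl (Or.inr (by nlinarith))
  simp only [add_zero] at hl
  have hA2 : nsq y = (nsq y + 1) - 1 := by ring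
  have hsq : √(nsq y + 1) ^ 2 = nsq y + 1 := Real.sq_sqrt (by linarith)
  unfold QQ
  set A := nsq y + 1 with hA
  have hA0 : 0 < A := by linarith
  have e0 : A^(-((d:ℝ)/2)) = A^(-γ) * √A := by
    rw [Real.sqrt_eq_rpow, ← Real.rpow_add hA0]; congr 1; rw [hγ]; ring
  set a := A^(-γ) with ha
  have ha0 : 0 < a := Real.rpow_pos_of_pos hA0 _
  have e1 : a * (4 * γ * (γ+1) * nsq y / A^2 - 2 * d * γ / A) = γ * (6 * nsq y - 2 * d) * (a / A^2) := by
    have hn : nsq y + 1 ≠ 0 := by linarith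
    rw [hA, show (d:ℝ) = 2 * γ - 1 by rw [hγ]; ring]
    field_simp
    ring
  rw [e1] at hl
  have e3 : A^(-((d:ℝ)/2)) * √A / A^2 = A * (a / A^2) := by
    rw [e0]
    calc a * √A * √A / A^2 = a * (√A^2) / A^2 := by ring
      _ = _ := by rw [hsq]; ring
  rw [e3]
  have hp : 0 < a / A^2 := by positivity
  have hq : A + C1 ≤ γ * (6 * nsq y - 2 * d) := by
    have : 6 * nsq y - 2 * d ≤ γ * (6 * nsq y - 2 * d) := by nlinarith
    nlinarith
  have := mul_le_mul_of_nonneg_right hq hp.le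
  linarith [(abs_le.mp hl).1]
end UI

end

section
open MeasureTheory Filter Set
namespace UI

lemma nsq_one_le {d : ℕ} (y : V d) (hy : y ≠ 0) : 1 ≤ nsq y := by
  have hpos : 0 < nsq y := by
    obtain ⟨i, hi⟩ := Function.ne_iff.mp hy
    have h1 := coord_le y i
    have : (y i:ℝ) ≠ 0 := by exact_mod_cast hi
    have : 0 < (y i:ℝ)^2 := by positivity
    linarith
  have := nrm_one_le y (Real.sqrt_pos.mpr hpos)
  rw [← nrm_sq]; nlinarith

noncomputable def Pz {d : ℕ} (z y : V d) : ℝ := - pw 0 (((d:ℝ)-2)/2) y - 2 * (dot z y * pw 0 ((d:ℝ)/2) y)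

lemma Pz_eq {d : ℕ} (z y : V d) (hy : y ≠ 0) : Pz z y = (- nsq y - 2 * dot z y) * (nsq y)^(-((d:ℝ)/2)) := by
  have h := nsq_one_le y hy
  unfold Pz pw
  simp only [add_zero]
  have : (nsq y)^(-(((d:ℝ)-2)/2)) = nsq y * (nsq y)^(-((d:ℝ)/2)) := by
    rw [mul_comm, ← Real.rpow_add_one (by linarith)]; congr 1; ring
  rw [this]; ring

lemma Pz_le {d : ℕ} (hd : 1 ≤ d) (z y : V d) (hy : y ≠ 0) : Pz z y ≤ 2 * nrm z * (nsq y)^(-(((d:ℝ)-1)/2)) := by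
  have h := nsq_one_le y hy
  rw [Pz_eq z y hy]
  have e : (nsq y)^(-(((d:ℝ)-1)/2)) = nrm y * (nsq y)^(-((d:ℝ)/2)) := by
    unfold nrm
    rw [Real.sqrt_eq_rpow, ← Real.rpow_add (by linarith)]; congr 1; ring
  rw [e, ← mul_assoc]
  have hp : 0 ≤ (nsq y)^(-((d:ℝ)/2)) := by positivity
  apply mul_le_mul_of_nonneg_right _ hp
  have := (abs_le.mp (dot_le z y)).1
  linarith

lemma Pz_pos {d : ℕ} (z y : V d) (hy : y ≠ 0) (hP : 0 < Pz z y) : nrm y < 2 * nrm z := by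
  have h := nsq_one_le y hy
  rw [Pz_eq z y hy] at hP
  have hp : 0 < (nsq y)^(-((d:ℝ)/2)) := by positivity
  have h1 : 0 < - nsq y - 2 * dot z y := pos_of_mul_pos_left hP hp.le
  have h2 := (abs_le.mp (dot_le z y)).1
  rw [← nrm_sq] at h1
  have h3 : 0 < nrm y := Real.sqrt_pos.mpr (by linarith)
  by_contra hcon
  push Not at hcon
  nlinarith

def l1 {d : ℕ} (y : V d) : ℕ := ∑ i, (y i).natAbs

noncomputable def q0 {d : ℕ} (y : V d) : ℝ := (1/(2*(d:ℝ)))^(l1 y)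

lemma nb_mono {d : ℕ} (f g : V d → ℝ) (h : ∀ x, f x ≤ g x) (x : V d) : nb f x ≤ nb g x :=
  Finset.sum_le_sum fun i _ => add_le_add (h _) (h _)

lemma l1_split {d : ℕ} (i : Fin d) (x : V d) :
    l1 x = (x i).natAbs + ∑ j ∈ Finset.univ.erase i, (x j).natAbs :=
  (Finset.add_sum_erase Finset.univ (fun j => (x j).natAbs) (Finset.mem_univ i)).symm

lemma l1_step {d : ℕ} (i : Fin d) (x y : V d) (h : ∀ j, j ≠ i → x j = y j)
    (h1 : (x i).natAbs + 1 = (y i).natAbs) : l1 x + 1 = l1 y := by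
  have e : ∑ j ∈ Finset.univ.erase i, (x j).natAbs = ∑ j ∈ Finset.univ.erase i, (y j).natAbs :=
    Finset.sum_congr rfl fun j hj => by rw [h j (Finset.ne_of_mem_erase hj)]
  have a1 := l1_split i x
  have a2 := l1_split i y
  rw [e] at a1
  rw [a1, a2, ← h1]; ring

lemma q0_step {d : ℕ} (hd : 1 ≤ d) (x y : V d) (hx : l1 x + 1 = l1 y) : q0 x = 2 * d * q0 y := by
  have hd' : (1:ℝ) ≤ d := by exact_mod_cast hd
  unfold q0
  rw [← hx, pow_succ]; field_simp

lemma single_le_univ {d : ℕ} (f : Fin d → ℝ) (hf : ∀ i, 0 ≤ f i) (i : Fin d) : f i ≤ ∑ j, f j :=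
  Finset.single_le_sum (fun j _ => hf j) (Finset.mem_univ i)

lemma q0_sub {d : ℕ} (hd : 1 ≤ d) (y : V d) (hy : y ≠ 0) : 2 * d * q0 y ≤ nb q0 y := by
  obtain ⟨i, hi⟩ := Function.ne_iff.mp hy
  have hi' : y i ≠ 0 := hi
  have hq : ∀ x : V d, 0 ≤ q0 x := fun x => by unfold q0; positivity
  have hle : q0 (y + Pi.single i 1) + q0 (y - Pi.single i 1) ≤ nb q0 y := by
    exact single_le_univ (fun i => q0 (y + Pi.single i 1) + q0 (y - Pi.single i 1))
      (fun j => add_nonneg (hq (y + Pi.single j 1)) (hq (y - Pi.single j 1))) i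
  have p1 := hq (y - Pi.single i 1)
  have p2 := hq (y + Pi.single i 1)
  rcases lt_or_gt_of_ne hi' with hneg | hpos
  · have t : q0 (y + Pi.single i 1) = 2 * d * q0 y := by
      apply q0_step hd
      apply l1_step i
      · intro j hj
        simp [Pi.single_eq_of_ne hj]
      · have : (y + Pi.single i 1 : V d) i = y i + 1 := by simp
        rw [this]; clear * - hneg; omega
    rw [t] at hle p2
    exact le_trans (le_add_of_nonneg_right p1) hle
  · have t : q0 (y - Pi.single i 1) = 2 * d * q0 y := by
      apply q0_step hd
      apply l1_step i
      · intro j hj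
        simp [Pi.single_eq_of_ne hj]
      · have : (y - Pi.single i 1 : V d) i = y i - 1 := by simp
        rw [this]; clear * - hpos; omega
    rw [t] at hle p1
    exact le_trans (le_add_of_nonneg_left p2) hle

lemma nsq_le_l1 {d : ℕ} (y : V d) : nsq y ≤ (l1 y:ℝ)^2 := by
  have h1 : ∀ i, |(y i:ℝ)| ≤ l1 y := by
    intro i
    have : (y i).natAbs ≤ l1 y := Finset.single_le_sum (f := fun i => (y i).natAbs) (fun _ _ => Nat.zero_le _) (Finset.mem_univ i)
    rw [← Int.cast_abs, Int.abs_eq_natAbs]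
    exact_mod_cast this
  have h2 : (l1 y:ℝ) = ∑ i, |(y i:ℝ)| := by
    unfold l1
    push_cast
    apply Finset.sum_congr rfl
    intro i _
    simp
  unfold nsq
  calc ∑ i, (y i:ℝ)^2 ≤ ∑ i, (l1 y:ℝ) * |(y i:ℝ)| := by
        apply Finset.sum_le_sum
        intro i _
        rw [← sq_abs, sq]
        exact mul_le_mul_of_nonneg_right (h1 i) (abs_nonneg _)
    _ = (l1 y:ℝ)^2 := by rw [← Finset.mul_sum, ← h2]; ring

lemma q0_decay (d : ℕ) (hd : 2 ≤ d) : ∃ C, 0 < C ∧ ∀ y : V d, q0 y ≤ C * (1 + nsq y)^(-(((d:ℝ)+1)/2)) := by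
  have hd' : (2:ℝ) ≤ d := by exact_mod_cast hd
  refine ⟨Real.exp 1 * (d+1).factorial, by positivity, fun y => ?_⟩
  set n := l1 y with hn
  have hs := nsq_nonneg y
  have h1 : q0 y ≤ Real.exp (-(n:ℝ)) := by
    unfold q0
    have : Real.exp (-(n:ℝ)) = (Real.exp (-1))^n := by rw [← Real.exp_nat_mul]; congr 1; ring
    rw [this]
    apply pow_le_pow_left₀ (by positivity)
    rw [Real.exp_neg, ← one_div]
    apply one_div_le_one_div_of_le (Real.exp_pos 1)
    have := Real.exp_one_lt_d9
    linarith
  have h2 := Real.pow_div_factorial_le_exp (1+(n:ℝ)) (by positivity) (d+1)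
  have h3 : (1 + nsq y)^(((d:ℝ)+1)/2) ≤ (1+(n:ℝ))^(d+1) := by
    have a1 : 1 + nsq y ≤ (1+(n:ℝ))^2 := by have := nsq_le_l1 y; nlinarith [Nat.cast_nonneg (α := ℝ) n]
    calc (1 + nsq y)^(((d:ℝ)+1)/2) ≤ ((1+(n:ℝ))^2)^(((d:ℝ)+1)/2) := by gcongr
      _ = _ := by
        rw [← Real.rpow_natCast, ← Real.rpow_natCast, ← Real.rpow_mul (by positivity)]
        congr 1; push_cast; ring
  rw [Real.rpow_neg (by linarith), ← div_eq_mul_inv, le_div_iff₀ (by positivity)]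
  have h4 : (1+(n:ℝ))^(d+1) ≤ (d+1).factorial * Real.exp (1+n) := by
    rw [div_le_iff₀ (by positivity)] at h2; linarith
  calc q0 y * (1 + nsq y)^(((d:ℝ)+1)/2) ≤ Real.exp (-(n:ℝ)) * ((d+1).factorial * Real.exp (1+n)) := by
        gcongr
        exact h3.trans h4
    _ = (d+1).factorial * (Real.exp (-(n:ℝ)) * Real.exp (1+n)) := by ring
    _ = _ := by rw [← Real.exp_add]; ring_nf

lemma nb_shift {d : ℕ} (H : V d → ℝ) (z x : V d) : nb (fun x => H (x - z)) x = nb H (x - z) := by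
  unfold nb
  apply Finset.sum_congr rfl
  intro i _
  beta_reduce
  rw [add_sub_right_comm, sub_right_comm]

lemma kernelH (d : ℕ) (hd : 2 ≤ d) : ∃ CV CB, 0 < CV ∧ 0 < CB ∧ ∀ z : V d, z ≠ 0 → ∃ H : V d → ℝ,
    (∀ y, y ≠ 0 → 2 * (d:ℝ) * H y ≤ nb H y) ∧ H 0 = CV * nrm z ∧ (∀ y, 0 ≤ H y ∧ H y ≤ CV * nrm z) ∧
    (∀ y, Pz z y ≤ H y) ∧
    (∀ y, y ≠ 0 → H y ≤ max (Pz z y) 0 + CB * nrm z * (1 + nsq y)^(-(((d:ℝ)+1)/2))) := by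
  have hd2 : (2:ℝ) ≤ d := by exact_mod_cast hd
  obtain ⟨C1, hC1, h1⟩ := lap_one d hd
  obtain ⟨C2, hC2, h2⟩ := lap_dot d
  obtain ⟨R0, hR0, h3⟩ := lap_three d hd
  obtain ⟨C3, hC3, h4⟩ := q0_decay d hd
  set γ3 := ((d:ℝ)+1)/2 with hγ3
  set C0 := 4 * C1 + 2 * C2 with hC0
  have hC00 : 0 ≤ C0 := by positivity
  set N := d * ⌈R0⌉₊ with hN
  set c := (2 + C0) * (2*(d:ℝ))^N with hc
  have hc0 : 2 + C0 ≤ c := by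
    rw [hc]
    exact le_mul_of_one_le_right (by linarith) (one_le_pow₀ (by linarith))
  have hcpos : 0 < c := by linarith
  refine ⟨c, C0 * 2^γ3 + c * C3, hcpos, by positivity, fun z hz => ?_⟩
  set r := nrm z with hr
  have hr1 : 1 ≤ r := by
    apply nrm_one_le
    exact Real.sqrt_pos.mpr (by linarith [nsq_one_le z hz])
  set P : V d → ℝ := Pz z with hP
  set U : V d → ℝ := fun y => C0 * r * pw 0 γ3 y with hU
  have hU0 : ∀ y, 0 ≤ U y := by
    intro y
    have := nsq_nonneg y
    simp only [hU, pw, add_zero]; positivity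
  have hq0 : ∀ y : V d, 0 ≤ q0 y := fun y => by unfold q0; positivity
  have hq1 : ∀ y : V d, q0 y ≤ 1 := fun y => by
    unfold q0
    apply pow_le_one₀ (by positivity)
    rw [div_le_one (by linarith)]; linarith
  have hU1 : ∀ y, y ≠ 0 → U y ≤ C0 * r := by
    intro y hy
    have h := nsq_one_le y hy
    simp only [hU, pw, add_zero]
    have : (nsq y)^(-γ3) ≤ 1 := Real.rpow_le_one_of_one_le_of_nonpos h (by rw [hγ3]; linarith)
    exact mul_le_of_le_one_right (by positivity) this
  have hP1 : ∀ y, y ≠ 0 → P y ≤ 2 * r := by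
    intro y hy
    have h := nsq_one_le y hy
    refine (Pz_le (by omega) z y hy).trans ?_
    have : (nsq y)^(-(((d:ℝ)-1)/2)) ≤ 1 := Real.rpow_le_one_of_one_le_of_nonpos h (by linarith)
    exact mul_le_of_le_one_right (by positivity) this
  have hPz0 : P 0 ≤ 0 := by
    have hn : nsq (0 : V d) = 0 := by simp [nsq]
    have hdt : dot z (0 : V d) = 0 := by simp [dot]
    simp only [hP, Pz, hdt, pw, hn]
    have : (0:ℝ) ≤ (0+0)^(-(((d:ℝ)-2)/2)) := Real.rpow_nonneg (by norm_num) _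
    linarith
  have hUz : U 0 = 0 := by
    have hn : nsq (0 : V d) = 0 := by simp [nsq]
    simp only [hU, pw, hn, add_zero]
    rw [Real.zero_rpow (by rw [hγ3]; linarith), mul_zero]
  have hqz : q0 (0 : V d) = 1 := by simp [q0, l1]
  have hbig : ∀ y, max (P y) 0 + U y ≤ c * r := by
    intro y
    by_cases hy : y = 0
    · rw [hy, hUz, max_eq_right hPz0]
      have : 0 ≤ c * r := by positivity
      linarith
    · have a1 := hU1 y hy
      have a2 : max (P y) 0 ≤ 2 * r := max_le (hP1 y hy) (by linarith)
      nlinarith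
  set H : V d → ℝ := fun y => max (max (P y) 0 + U y) (c * r * q0 y) with hH
  have HU : ∀ y, U y ≤ H y := fun y => le_trans (by linarith [le_max_right (P y) 0]) (le_max_left _ _)
  have HP : ∀ y, P y + U y ≤ H y := fun y => le_trans (by linarith [le_max_left (P y) 0]) (le_max_left _ _)
  have Hq : ∀ y, c * r * q0 y ≤ H y := fun y => le_max_right _ _
  have hqsub : ∀ y, y ≠ 0 → 2 * d * (c * r * q0 y) ≤ nb H y := by
    intro y hy
    have e : nb (fun y => c * r * q0 y) y = c * r * nb q0 y := by simp only [nb, Finset.mul_sum, mul_add]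
    have a1 := q0_sub (by omega) y hy
    have a2 := nb_mono _ _ Hq y
    rw [e] at a2
    have a3 := mul_le_mul_of_nonneg_left a1 (show 0 ≤ c * r by positivity)
    linarith
  refine ⟨H, ?_, ?_, ?_, ?_, ?_⟩
  · intro y hy
    by_cases hyR : R0 ≤ nsq y
    · have eU : nb U y = C0 * r * nb (pw 0 γ3) y := by simp only [hU, nb, Finset.mul_sum, mul_add]
      have b1 := mul_le_mul_of_nonneg_left (h3 y hyR) (show 0 ≤ C0 * r by positivity)
      have hQ := QQ_pos y
      have bU : 2 * d * U y + C0 * r * QQ y ≤ nb U y := by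
        rw [eU]; simp only [hU]; linarith
      have bU' : 2 * d * U y ≤ nb U y := by
        have : 0 ≤ C0 * r * QQ y := by positivity
        linarith
      rcases le_total (max (P y) 0 + U y) (c * r * q0 y) with hm | hm
      · have : H y = c * r * q0 y := max_eq_right hm
        rw [this]; exact hqsub y hy
      · have hHy : H y = max (P y) 0 + U y := max_eq_left hm
        rcases le_or_gt (P y) 0 with hp | hp
        · rw [hHy, max_eq_right hp, zero_add]
          exact bU'.trans (nb_mono _ _ HU y)
        · rw [hHy, max_eq_left hp.le]
          refine le_trans ?_ (nb_mono _ _ HP y)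
          have c1 := (abs_le.mp (h1 y (by linarith))).2
          have c2 := (abs_le.mp (h2 z y (by linarith))).2
          have eP : nb (fun y => P y + U y) y = - nb (pw 0 (((d:ℝ)-2)/2)) y - 2 * nb (fun y => dot z y * pw 0 ((d:ℝ)/2) y) y + nb U y := by
            simp only [hP, nb, Pz, Finset.mul_sum]
            rw [← Finset.sum_neg_distrib, ← Finset.sum_sub_distrib, ← Finset.sum_add_distrib]
            apply Finset.sum_congr rfl
            intro i _
            ring
          have hA : √(nsq y + 1) ≤ 4 * r := by
            have := Pz_pos z y hy hp
            rw [Real.sqrt_le_left (by linarith), ← nrm_sq]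
            have := nrm_nonneg y
            nlinarith
          have c3 : C1 * (√(nsq y + 1) * QQ y) ≤ C1 * (4 * r * QQ y) := by gcongr
          rw [eP]
          have e2 : P y = - pw 0 (((d:ℝ)-2)/2) y - 2 * (dot z y * pw 0 ((d:ℝ)/2) y) := rfl
          rw [e2]
          have e3 : C0 * r * QQ y = C1 * (4 * r * QQ y) + 2 * (C2 * (r * QQ y)) := by rw [hC0]; ring
          linarith
    · push Not at hyR
      have hl : l1 y ≤ N := by
        unfold l1
        calc ∑ i, (y i).natAbs ≤ ∑ i : Fin d, ⌈R0⌉₊ := by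
              apply Finset.sum_le_sum
              intro i _
              have a1 := coord_le y i
              have a2 : ((y i).natAbs:ℝ) ≤ (y i:ℝ)^2 := by
                have : ((y i).natAbs:ℝ) = |(y i:ℝ)| := by simp
                rw [this, ← sq_abs, ← Int.cast_abs]
                have : |y i| ≤ |y i|^2 := Int.le_self_sq _
                exact_mod_cast this
              have a3 : ((y i).natAbs:ℝ) ≤ (⌈R0⌉₊:ℝ) := by
                have := Nat.le_ceil R0
                linarith
              exact_mod_cast a3
          _ = N := by simp [hN]
      have hqN : (2 + C0) * r ≤ c * r * q0 y := by
        have : (1/(2*(d:ℝ)))^N ≤ q0 y := by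
          unfold q0
          apply pow_le_pow_of_le_one (by positivity) _ hl
          rw [div_le_one (by linarith)]; linarith
        calc (2 + C0) * r = c * r * (1/(2*(d:ℝ)))^N := by
              rw [hc, one_div, inv_pow]
              have : (2*(d:ℝ))^N ≠ 0 := by positivity
              field_simp
          _ ≤ _ := by gcongr
      have hHy : H y = c * r * q0 y := by
        apply max_eq_right
        have a1 := hU1 y hy
        have a2 : max (P y) 0 ≤ 2 * r := max_le (hP1 y hy) (by linarith)
        linarith
      rw [hHy]; exact hqsub y hy
  · simp only [hH]
    rw [hUz, hqz, max_eq_right hPz0]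
    rw [max_eq_right]; · ring
    have : 0 ≤ c * r := by positivity
    linarith
  · intro y
    refine ⟨(hU0 y).trans (HU y), max_le (hbig y) ?_⟩
    exact mul_le_of_le_one_right (by positivity) (hq1 y)
  · intro y
    linarith [HP y, hU0 y]
  · intro y hy
    have h := nsq_one_le y hy
    have a1 : U y ≤ C0 * 2^γ3 * r * (1 + nsq y)^(-γ3) := by
      simp only [hU, pw, add_zero]
      have : (nsq y)^(-γ3) ≤ ((1 + nsq y)/2)^(-γ3) :=
        Real.rpow_le_rpow_of_nonpos (by linarith) (by linarith) (by rw [hγ3]; linarith)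
      have e : ((1 + nsq y)/2)^(-γ3) = 2^γ3 * (1 + nsq y)^(-γ3) := by
        rw [Real.div_rpow (by linarith) (by norm_num), Real.rpow_neg (by norm_num : (0:ℝ) ≤ 2)]
        rw [div_inv_eq_mul]; ring
      rw [e] at this
      calc _ ≤ C0 * r * (2^γ3 * (1 + nsq y)^(-γ3)) := by gcongr
        _ = _ := by ring
    have a2 : c * r * q0 y ≤ c * C3 * r * (1 + nsq y)^(-γ3) := by
      calc c * r * q0 y ≤ c * r * (C3 * (1 + nsq y)^(-γ3)) := by gcongr; exact h4 y
        _ = _ := by ring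
    have a3 : 0 ≤ c * r * q0 y := mul_nonneg (by positivity) (hq0 y)
    apply max_le
    · linarith
    · have : 0 ≤ max (P y) 0 := le_max_right _ _
      linarith [hU0 y]
end UI

end

section
open MeasureTheory Filter Set
namespace UI

abbrev EE2 (d : ℕ) := EuclideanSpace ℝ (Fin d)

noncomputable def pE {d : ℕ} (z x : EE2 d) : ℝ := (-‖x‖^2 - 2 * inner ℝ z x) * ‖x‖^(-(d:ℝ))

noncomputable def IE {d : ℕ} (z : EE2 d) : ENNReal := ∫⁻ x, ENNReal.ofReal (pE z x)

lemma pE_meas {d : ℕ} (z : EE2 d) : Measurable (pE z) := by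
  unfold pE
  fun_prop

lemma polar (d : ℕ) (hd : 2 ≤ d) (f : EE2 d → ENNReal) (hf : Measurable f) :
    ∫⁻ x, f x = ∫⁻ θ : Metric.sphere (0 : EE2 d) 1, (∫⁻ ρ in Ioi (0:ℝ), ENNReal.ofReal (ρ^(d-1)) * f (ρ • (θ : EE2 d)))
      ∂((volume : Measure (EE2 d)).toSphere) := by
  have : Nonempty (Fin d) := ⟨⟨0, by omega⟩⟩
  have hms : MeasurableSet ({0}ᶜ : Set (EE2 d)) := (measurableSet_singleton _).compl
  have h1 : ∫⁻ x, f x = ∫⁻ x : ({0}ᶜ : Set (EE2 d)), f x ∂(Measure.comap Subtype.val volume) := by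
    rw [lintegral_subtype_comap hms, MeasureTheory.restrict_compl_singleton]
  have hmp := (volume : Measure (EE2 d)).measurePreserving_homeomorphUnitSphereProd
  have h2 := hmp.symm (homeomorphUnitSphereProd (EE2 d)).toMeasurableEquiv
  rw [h1, ← h2.lintegral_comp (f := fun x : ({0}ᶜ : Set (EE2 d)) => f x) (hf.comp measurable_subtype_coe)]
  rw [lintegral_prod]
  · apply lintegral_congr
    intro θ
    have hfr : Module.finrank ℝ (EE2 d) = d := by simp
    rw [hfr, Measure.volumeIoiPow, lintegral_withDensity_eq_lintegral_mul]
    · have := lintegral_subtype_comap (μ := (volume : Measure ℝ)) (measurableSet_Ioi (a := (0:ℝ))) (fun ρ : ℝ => ENNReal.ofReal (ρ^(d-1)) * f (ρ • (θ : EE2 d)))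
      rw [← this]
      rfl
    · fun_prop
    · apply Measurable.comp hf
      apply measurable_subtype_coe.comp
      exact ((homeomorphUnitSphereProd (EE2 d)).symm.measurable).comp measurable_prodMk_left
  · apply Measurable.aemeasurable
    exact (hf.comp measurable_subtype_coe).comp (homeomorphUnitSphereProd (EE2 d)).symm.measurable

lemma radial (s : ℝ) : ∫⁻ ρ in Ioi (0:ℝ), ENNReal.ofReal (-ρ - 2 * s) = ENNReal.ofReal (2 * (max (-s) 0)^2) := by
  rcases le_or_gt 0 s with hs | hs
  · rw [max_eq_right (by linarith)]
    simp only [ne_eq, OfNat.ofNat_ne_zero, not_false_eq_true, zero_pow, mul_zero, ENNReal.ofReal_zero]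
    rw [lintegral_eq_zero_iff (by fun_prop)]
    filter_upwards [ae_restrict_mem measurableSet_Ioi] with ρ hρ
    have : (0:ℝ) < ρ := hρ
    simp only [Pi.zero_apply, ENNReal.ofReal_eq_zero]
    linarith
  · rw [max_eq_left (by linarith)]
    have h0 : (0:ℝ) ≤ -2*s := by linarith
    have hU : Ioi (0:ℝ) = Ioc 0 (-2*s) ∪ Ioi (-2*s) := (Ioc_union_Ioi_eq_Ioi h0).symm
    rw [hU, lintegral_union measurableSet_Ioi (by
      rw [Set.disjoint_left]; intro x hx hx2; exact absurd hx.2 (not_le.mpr hx2))]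
    have e2 : ∫⁻ ρ in Ioi (-2*s), ENNReal.ofReal (-ρ - 2 * s) = 0 := by
      rw [lintegral_eq_zero_iff (by fun_prop)]
      filter_upwards [ae_restrict_mem measurableSet_Ioi] with ρ hρ
      have : -2*s < ρ := hρ
      simp only [Pi.zero_apply, ENNReal.ofReal_eq_zero]
      linarith
    rw [e2, add_zero, ← ofReal_integral_eq_lintegral_ofReal]
    · congr 1
      rw [← intervalIntegral.integral_of_le h0]
      rw [intervalIntegral.integral_sub (by apply Continuous.intervalIntegrable; fun_prop) (by simp)]
      rw [intervalIntegral.integral_neg, integral_id]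
      simp
      ring
    · have : IntervalIntegrable (fun ρ : ℝ => -ρ - 2 * s) volume 0 (-2*s) := by
        apply Continuous.intervalIntegrable; fun_prop
      exact this.1
    · filter_upwards [ae_restrict_mem measurableSet_Ioc] with ρ hρ
      have := hρ.2
      simp only [Pi.zero_apply]
      linarith

lemma IE_polar {d : ℕ} (hd : 2 ≤ d) (z : EE2 d) : IE z =
    ∫⁻ θ : Metric.sphere (0 : EE2 d) 1, ENNReal.ofReal (2 * (max (-(inner ℝ z (θ : EE2 d))) 0)^2)
      ∂((volume : Measure (EE2 d)).toSphere) := by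
  unfold IE
  rw [polar d hd _ (by have := pE_meas z; fun_prop)]
  apply lintegral_congr
  intro θ
  rw [← radial]
  apply setLIntegral_congr_fun measurableSet_Ioi
  intro ρ hρ
  have hρ' : (0:ℝ) < ρ := hρ
  have hθ : ‖(θ : EE2 d)‖ = 1 := by simpa using θ.2
  beta_reduce
  rw [← ENNReal.ofReal_mul (by positivity)]
  congr 1
  unfold pE
  rw [norm_smul, hθ, mul_one, inner_smul_right, Real.norm_of_nonneg hρ'.le, Real.rpow_neg hρ'.le, Real.rpow_natCast]
  obtain ⟨k, rfl⟩ : ∃ k, d = k + 1 := ⟨d-1, by omega⟩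
  simp only [Nat.add_sub_cancel]
  field_simp
  ring

lemma IE_iso {d : ℕ} (z : EE2 d) (L : EE2 d ≃ₗᵢ[ℝ] EE2 d) : IE (L z) = IE z := by
  unfold IE
  rw [← L.measurePreserving.lintegral_comp (by have := pE_meas (L z); fun_prop)]
  apply lintegral_congr
  intro x
  unfold pE
  rw [L.norm_map, L.inner_map_map]

lemma IE_norm {d : ℕ} (z w : EE2 d) (h : ‖z‖ = ‖w‖) : IE z = IE w := by
  have := Submodule.reflection_sub (F := EE2 d) h
  rw [← this, IE_iso]

noncomputable def om (d : ℕ) : ℝ := (volume (Metric.ball (0 : EE2 d) 1)).toReal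

lemma om_pos (d : ℕ) : 0 < om d :=
  ENNReal.toReal_pos (Metric.measure_ball_pos _ _ one_pos).ne' measure_ball_lt_top.ne

lemma IE_eq {d : ℕ} (hd : 2 ≤ d) (z : EE2 d) : IE z = ENNReal.ofReal (om d * ‖z‖^2) := by
  set r := ‖z‖ with hr
  have hr0 : 0 ≤ r := norm_nonneg _
  have h1 : ∀ i : Fin d, IE z = IE (EuclideanSpace.single i r) := by
    intro i; apply IE_norm; simp [hr]
  have h2 : ∀ i : Fin d, IE z = IE (-(EuclideanSpace.single i r)) := by
    intro i; apply IE_norm; simp [hr]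
  have hm : ∀ w : EE2 d, Measurable fun θ : Metric.sphere (0 : EE2 d) 1 => ENNReal.ofReal (2 * (max (-(inner ℝ w (θ : EE2 d))) 0)^2) := by
    intro w; fun_prop
  have h3 : ∑ i : Fin d, (IE (EuclideanSpace.single i r : EE2 d) + IE (-(EuclideanSpace.single i r : EE2 d))) =
      ∫⁻ θ : Metric.sphere (0 : EE2 d) 1, ENNReal.ofReal (2 * r^2) ∂((volume : Measure (EE2 d)).toSphere) := by
    simp only [IE_polar hd]
    simp_rw [← lintegral_add_left (hm _)]
    rw [← lintegral_finsetSum Finset.univ (f := fun (i : Fin d) (θ : Metric.sphere (0 : EE2 d) 1) =>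
      ENNReal.ofReal (2 * (max (-(inner ℝ (EuclideanSpace.single i r : EE2 d) (θ : EE2 d))) 0)^2) + 
        ENNReal.ofReal (2 * (max (-(inner ℝ (-(EuclideanSpace.single i r : EE2 d)) (θ : EE2 d))) 0)^2)) (fun i _ => (hm _).add (hm _))]
    apply lintegral_congr
    intro θ
    have hθ : ‖(θ : EE2 d)‖ = 1 := by simpa using θ.2
    have key : ∀ i : Fin d, ENNReal.ofReal (2 * (max (-(inner ℝ (EuclideanSpace.single i r : EE2 d) (θ : EE2 d))) 0)^2) + 
        ENNReal.ofReal (2 * (max (-(inner ℝ (-(EuclideanSpace.single i r : EE2 d)) (θ : EE2 d))) 0)^2) = ENNReal.ofReal (2 * r^2 * ((θ : EE2 d) i)^2) := by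
      intro i
      rw [← ENNReal.ofReal_add (by positivity) (by positivity)]
      congr 1
      rw [inner_neg_left, EuclideanSpace.inner_single_left]
      simp only [conj_trivial]
      set t := r * (θ : EE2 d) i
      have : 2 * r^2 * ((θ : EE2 d) i)^2 = 2 * t^2 := by simp only [t]; ring
      rw [this, neg_neg]
      rcases le_total 0 t with h | h
      · rw [max_eq_right (by linarith), max_eq_left h]; ring
      · rw [max_eq_left (by linarith), max_eq_right h]; ring
    rw [Finset.sum_congr rfl (fun i _ => key i), ← ENNReal.ofReal_sum_of_nonneg (fun i _ => by positivity), ← Finset.mul_sum]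
    have := EuclideanSpace.norm_sq_eq (𝕜 := ℝ) (θ : EE2 d)
    rw [hθ] at this
    simp only [Real.norm_eq_abs, sq_abs] at this
    rw [← this]; simp
  rw [lintegral_const, Measure.toSphere_apply_univ] at h3
  have h4 : ∑ i : Fin d, (IE (EuclideanSpace.single i r : EE2 d) + IE (-(EuclideanSpace.single i r : EE2 d))) = 2 * (d:ENNReal) * IE z := by
    rw [Finset.sum_congr rfl (fun i _ => by rw [← h1 i, ← h2 i])]
    simp
    ring
  rw [h4] at h3
  have hv : volume (Metric.ball (0 : EE2 d) 1) = ENNReal.ofReal (om d) := (ENNReal.ofReal_toReal measure_ball_lt_top.ne).symm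
  have hd0 : (d:ENNReal) ≠ 0 := by simp; omega
  rw [hv] at h3
  have e : ENNReal.ofReal (2 * r^2) * (((Module.finrank ℝ (EE2 d) : ℕ) : ENNReal) * ENNReal.ofReal (om d)) = 2 * (d:ENNReal) * ENNReal.ofReal (om d * r^2) := by
    rw [ENNReal.ofReal_mul (by norm_num), ENNReal.ofReal_mul (om_pos d).le]
    simp
    ring
  rw [e] at h3
  exact (ENNReal.mul_right_inj (by simp; omega) (by finiteness)).mp h3

end UI

end

section
open MeasureTheory Filter Set
namespace UI

noncomputable def emb {d : ℕ} (y : V d) : EE2 d := WithLp.toLp 2 (fun i => (y i:ℝ))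

def cube {d : ℕ} (y : V d) : Set (EE2 d) := {x | ∀ i, (y i:ℝ) ≤ x i ∧ x i < y i + 1}

lemma cube_eq {d : ℕ} (y : V d) : cube y = (WithLp.ofLp (p := 2)) ⁻¹' (Set.pi univ (fun i => Ico (y i:ℝ) (y i + 1))) := by
  ext x; simp [cube, Set.mem_pi]

lemma cube_meas {d : ℕ} (y : V d) : MeasurableSet (cube y) := by
  rw [cube_eq]
  exact (PiLp.volume_preserving_ofLp (Fin d)).measurable (MeasurableSet.univ_pi fun i => measurableSet_Ico)

lemma cube_vol {d : ℕ} (y : V d) : volume (cube y) = 1 := by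
  rw [cube_eq, (PiLp.volume_preserving_ofLp (Fin d)).measure_preimage (MeasurableSet.univ_pi fun i => measurableSet_Ico).nullMeasurableSet]
  rw [Real.volume_pi_Ico]; simp

lemma cube_floor {d : ℕ} (x : EE2 d) : x ∈ cube (fun i => ⌊x i⌋ : V d) := by
  intro i; exact ⟨Int.floor_le _, Int.lt_floor_add_one _⟩

lemma cube_uniq {d : ℕ} (x : EE2 d) (y : V d) (h : x ∈ cube y) : y = (fun i => ⌊x i⌋ : V d) := by
  funext i
  exact (Int.floor_eq_iff.mpr (h i)).symm

lemma cube_disj {d : ℕ} : Pairwise (fun y y' : V d => Disjoint (cube y) (cube y')) := by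
  intro y y' hne
  rw [Set.disjoint_left]
  intro x h1 h2
  exact hne ((cube_uniq x y h1).trans (cube_uniq x y' h2).symm)

lemma emb_norm {d : ℕ} (y : V d) : ‖emb y‖ = nrm y := by
  rw [EuclideanSpace.norm_eq]; unfold nrm nsq emb; simp

lemma emb_inner {d : ℕ} (z y : V d) : inner ℝ (emb z) (emb y) = dot z y := by
  unfold dot emb
  simp [PiLp.inner_apply, mul_comm]

lemma cube_dist {d : ℕ} (y : V d) (x : EE2 d) (h : x ∈ cube y) : ‖x - emb y‖ ≤ √d := by
  rw [EuclideanSpace.norm_eq]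
  apply Real.sqrt_le_sqrt
  calc ∑ i, ‖(x - emb y) i‖^2 ≤ ∑ i : Fin d, (1:ℝ) := by
        apply Finset.sum_le_sum
        intro i _
        have := h i
        have e : (x - emb y) i = x i - y i := by simp [emb]
        rw [e, Real.norm_eq_abs, sq_abs]
        nlinarith
    _ = d := by simp

lemma cube_nrm {d : ℕ} (y : V d) (x : EE2 d) (h : x ∈ cube y) : |‖x‖ - nrm y| ≤ √d := by
  rw [← emb_norm]
  exact (abs_norm_sub_norm_le _ _).trans (cube_dist y x h)

lemma latt_sum {d : ℕ} (X : Finset (V d)) (f e : V d → ℝ) (g : EE2 d → ℝ) (he : ∀ y, 0 ≤ e y) (hg : Measurable g)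
    (h : ∀ y ∈ X, ∀ x ∈ cube y, f y ≤ max (g x) 0 + e y) :
    ∑ y ∈ X, ENNReal.ofReal (f y) ≤ (∫⁻ x, ENNReal.ofReal (g x)) + ENNReal.ofReal (∑ y ∈ X, e y) := by
  have h1 : ∀ y ∈ X, ENNReal.ofReal (f y) ≤ (∫⁻ x in cube y, ENNReal.ofReal (g x)) + ENNReal.ofReal (e y) := by
    intro y hy
    calc ENNReal.ofReal (f y) = ∫⁻ x in cube y, ENNReal.ofReal (f y) := by simp [cube_vol]
      _ ≤ ∫⁻ x in cube y, (ENNReal.ofReal (g x) + ENNReal.ofReal (e y)) := by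
        apply setLIntegral_mono (by fun_prop)
        intro x hx
        calc ENNReal.ofReal (f y) ≤ ENNReal.ofReal (max (g x) 0 + e y) := ENNReal.ofReal_le_ofReal (h y hy x hx)
          _ = ENNReal.ofReal (max (g x) 0) + ENNReal.ofReal (e y) := ENNReal.ofReal_add (le_max_right _ _) (he y)
          _ = _ := by rw [ENNReal.ofReal_max]; simp
      _ = _ := by rw [lintegral_add_right _ (by fun_prop)]; simp [cube_vol]
  calc ∑ y ∈ X, ENNReal.ofReal (f y) ≤ ∑ y ∈ X, ((∫⁻ x in cube y, ENNReal.ofReal (g x)) + ENNReal.ofReal (e y)) := Finset.sum_le_sum h1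
    _ = ∑ y ∈ X, (∫⁻ x in cube y, ENNReal.ofReal (g x)) + ENNReal.ofReal (∑ y ∈ X, e y) := by
      rw [Finset.sum_add_distrib, ENNReal.ofReal_sum_of_nonneg (fun y _ => he y)]
    _ ≤ _ := by
      gcongr
      rw [← lintegral_biUnion_finset (fun a _ b _ hab => cube_disj hab) (fun y _ => cube_meas y)]
      exact setLIntegral_le_lintegral _ _

lemma mem_ball_iff {d : ℕ} (y : V d) (R : ℝ) : y ∈ ball d R ↔ nrm y ≤ R := by
  unfold ball nrm nsq
  rw [Finset.mem_filter]
  refine ⟨fun h => h.2, fun h => ⟨?_, h⟩⟩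
  have h0 : ∀ i, |(y i:ℝ)| ≤ R := by
    intro i
    refine le_trans ?_ h
    apply Real.abs_le_sqrt
    exact coord_le y i
  rw [Finset.mem_Icc]
  constructor
  · intro i
    have := (abs_le.mp (h0 i)).1
    have h2 : -(⌈R⌉:ℝ) ≤ y i := by linarith [Int.le_ceil R]
    show -⌈R⌉ ≤ y i
    exact_mod_cast h2
  · intro i
    have := (abs_le.mp (h0 i)).2
    have h2 : (y i:ℝ) ≤ ⌈R⌉ := by linarith [Int.le_ceil R]
    show y i ≤ ⌈R⌉
    exact_mod_cast h2

lemma vol_ball (d : ℕ) (hd : 2 ≤ d) (R : ℝ) (hR : 0 ≤ R) : volume (Metric.ball (0 : EE2 d) R) = ENNReal.ofReal (om d * R^d) := by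
  have : Nonempty (Fin d) := ⟨⟨0, by omega⟩⟩
  rw [Measure.addHaar_ball _ _ hR]
  have hv : volume (Metric.ball (0 : EE2 d) 1) = ENNReal.ofReal (om d) := (ENNReal.ofReal_toReal measure_ball_lt_top.ne).symm
  rw [hv, ← ENNReal.ofReal_mul (by positivity)]
  simp [mul_comm]

lemma cubes_vol {d : ℕ} (X : Finset (V d)) : volume (⋃ y ∈ X, cube y) = X.card := by
  rw [measure_biUnion_finset (fun a _ b _ hab => cube_disj hab) (fun y _ => cube_meas y)]
  simp [cube_vol]

lemma ball_card_le (d : ℕ) (hd : 2 ≤ d) (R : ℝ) (hR : 0 ≤ R) : ((ball d R).card : ℝ) ≤ om d * (R + √d + 1)^d := by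
  have h1 : (⋃ y ∈ ball d R, cube y) ⊆ Metric.ball (0 : EE2 d) (R + √d + 1) := by
    intro x hx
    simp only [mem_iUnion] at hx
    obtain ⟨y, hy, hx⟩ := hx
    rw [mem_ball_iff] at hy
    have := (abs_le.mp (cube_nrm y x hx)).2
    simp only [Metric.mem_ball, dist_zero_right]
    linarith
  have h2 := measure_mono (μ := volume) h1
  have h0 : 0 ≤ R + √d + 1 := by positivity
  rw [cubes_vol, vol_ball d hd _ h0] at h2
  have h3 : 0 ≤ om d * (R + √d + 1)^d := mul_nonneg (om_pos d).le (by positivity)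
  have := ENNReal.toReal_mono (by simp) h2
  rwa [ENNReal.toReal_ofReal h3, ENNReal.toReal_natCast] at this

lemma ball_card_ge (d : ℕ) (hd : 2 ≤ d) (R : ℝ) (hR : √d ≤ R) : om d * (R - √d)^d ≤ ((ball d R).card : ℝ) := by
  have h1 : Metric.ball (0 : EE2 d) (R - √d) ⊆ (⋃ y ∈ ball d R, cube y) := by
    intro x hx
    simp only [Metric.mem_ball, dist_zero_right] at hx
    simp only [mem_iUnion]
    refine ⟨_, ?_, cube_floor x⟩
    rw [mem_ball_iff]
    have := (abs_le.mp (cube_nrm _ x (cube_floor x))).1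
    linarith
  have h2 := measure_mono (μ := volume) h1
  have h0 : 0 ≤ R - √d := by linarith
  rw [cubes_vol, vol_ball d hd _ h0] at h2
  have h3 : 0 ≤ om d * (R - √d)^d := mul_nonneg (om_pos d).le (by positivity)
  have := ENNReal.toReal_mono (by simp) h2
  rwa [ENNReal.toReal_ofReal h3, ENNReal.toReal_natCast] at this

lemma riem_core (d : ℕ) (r δ a b N M : ℝ) (hδ : 0 ≤ δ) (hr : 0 ≤ r) (ha : 0 < a) (hab : |b - a| ≤ δ) (h2 : 2*δ ≤ a)
    (hN : 0 ≤ N) (hN2 : N ≤ 2*r*a) (hM : N - 8*r*δ ≤ M) :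
    N * a^(-(d:ℝ)) ≤ max (M * b^(-(d:ℝ))) 0 + (4*d*δ + 8*δ) * (r * a^(-(d:ℝ))) := by
  have hb1 := abs_le.mp hab
  have hb : a/2 ≤ b := by linarith
  have hb0 : 0 < b := by linarith
  rw [Real.rpow_neg ha.le, Real.rpow_neg hb0.le, Real.rpow_natCast, Real.rpow_natCast]
  set t := (a/b)^d with ht
  have ht0 : 0 ≤ t := by positivity
  have hbe : 1 - 2*d*δ/a ≤ t := by
    have h1 := one_add_mul_le_pow (R := ℝ) (a := a/b - 1) (by have : 0 < a/b := by positivity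
                                                              linarith) d
    have e : 1 + (a/b - 1) = a/b := by ring
    rw [e] at h1
    refine le_trans ?_ h1
    have h3 : -(2*δ/a) ≤ a/b - 1 := by
      have e2 : a/b - 1 = -((b-a)/b) := by field_simp; ring
      rw [e2]
      apply neg_le_neg
      calc (b-a)/b ≤ δ/b := by gcongr; linarith
        _ ≤ δ/(a/2) := by gcongr
        _ = 2*δ/a := by field_simp
    have : (d:ℝ) * (-(2*δ/a)) ≤ d * (a/b - 1) := by gcongr
    have e3 : 2*(d:ℝ)*δ/a = d * (2*δ/a) := by ring
    rw [e3]; linarith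
  set q := (a^d)⁻¹ with hq
  have hq0 : 0 < q := by positivity
  have ebq : (b^d)⁻¹ = t * q := by rw [ht, hq, div_pow]; field_simp
  rw [ebq]
  set t' := min t 1
  have ht'0 : 0 ≤ t' := le_min ht0 zero_le_one
  have ht'1 : t' ≤ 1 := min_le_right _ _
  have hbe' : 1 - 2*d*δ/a ≤ t' := by
    apply le_min hbe
    have : 0 ≤ 2*d*δ/a := by positivity
    linarith
  have k1 : (N - 8*r*δ) * t' * q ≤ max (M * (t * q)) 0 := by
    rcases le_or_gt (N - 8*r*δ) 0 with h | h
    · refine le_trans ?_ (le_max_right _ _)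
      have := mul_nonneg ht'0 hq0.le
      nlinarith
    · refine le_trans ?_ (le_max_left _ _)
      rw [mul_assoc]
      have : t' * q ≤ t * q := by gcongr; exact min_le_left _ _
      exact mul_le_mul hM this (by positivity) (by linarith)
  have k2 : N * (1 - t') ≤ 4*d*δ*r := by
    calc N * (1 - t') ≤ (2*r*a) * (2*d*δ/a) := by
          apply mul_le_mul hN2 (by linarith) (by linarith) (by positivity)
      _ = 4*d*δ*r := by field_simp; ring
  have k3 : 8*r*δ*t' ≤ 8*r*δ := by
    have : 0 ≤ 8*r*δ := by positivity
    nlinarith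
  have k4 : N * q - (N - 8*r*δ) * t' * q = (N * (1-t') + 8*r*δ*t') * q := by ring
  have k5 : (N * (1-t') + 8*r*δ*t') * q ≤ (4*d*δ*r + 8*r*δ) * q := by gcongr
  have : (4*d*δ + 8*δ) * (r * q) = (4*d*δ*r + 8*r*δ) * q := by ring
  rw [this]; linarith

lemma riem_pt (d : ℕ) (hd : 2 ≤ d) : ∃ C, 0 < C ∧ ∀ (z y : V d), z ≠ 0 → y ≠ 0 → ∀ x ∈ cube y,
    Pz z y ≤ max (pE (emb z) x) 0 + C * (nrm z)^((3:ℝ)/2) * (1 + nsq y)^(-(((d:ℝ)+1/2)/2)) := by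
  have hd' : (2:ℝ) ≤ d := by exact_mod_cast hd
  set δ := √(d:ℝ) with hδ
  have hδ0 : 0 ≤ δ := Real.sqrt_nonneg _
  have hδ2 : δ^2 = d := Real.sq_sqrt (by linarith)
  set p := ((d:ℝ)+1/2)/2 with hp
  have hp0 : 0 < p := by positivity
  refine ⟨2*(1+4*d)^p + (4*d*δ + 8*δ) * (2 * 2^p), by positivity, fun z y hz hy x hx => ?_⟩
  have hny := nsq_one_le y hy
  have hnz := nsq_one_le z hz
  set r := nrm z with hrdef
  set a := nrm y with hadef
  have ha2 : a^2 = nsq y := nrm_sq y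
  have hr1 : 1 ≤ r := by rw [hrdef, nrm, Real.one_le_sqrt]; exact hnz
  have ha1 : 1 ≤ a := by rw [hadef, nrm, Real.one_le_sqrt]; exact hny
  have hr32 : r ≤ r^((3:ℝ)/2) := by
    nth_rw 1 [← Real.rpow_one r]
    exact Real.rpow_le_rpow_of_exponent_le hr1 (by norm_num)
  have hmax := le_max_right (pE (emb z) x) 0
  have hw : 0 < (1 + nsq y)^(-p) := by positivity
  rcases le_or_gt a (2*δ) with hsm | hbig
  · have h1 := Pz_le (by omega) z y hy
    have h2 : (nsq y)^(-(((d:ℝ)-1)/2)) ≤ 1 := Real.rpow_le_one_of_one_le_of_nonpos hny (by linarith)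
    have h3 : 1 ≤ (1+4*(d:ℝ))^p * (1 + nsq y)^(-p) := by
      rw [Real.rpow_neg (by linarith), ← div_eq_mul_inv, one_le_div (by positivity)]
      apply Real.rpow_le_rpow (by linarith) _ hp0.le
      rw [← ha2, ← hδ2]; nlinarith
    calc Pz z y ≤ 2*r := by nlinarith
      _ ≤ 2 * r^((3:ℝ)/2) * 1 := by linarith
      _ ≤ 2 * r^((3:ℝ)/2) * ((1+4*(d:ℝ))^p * (1 + nsq y)^(-p)) := by gcongr
      _ = (2*(1+4*d)^p) * r^((3:ℝ)/2) * (1 + nsq y)^(-p) := by ring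
      _ ≤ (2*(1+4*d)^p + (4*d*δ + 8*δ) * (2 * 2^p)) * r^((3:ℝ)/2) * (1 + nsq y)^(-p) := by
        gcongr; linarith [show 0 ≤ (4*d*δ + 8*δ) * (2 * 2^p) by positivity]
      _ ≤ _ := by linarith
  · rcases le_or_gt (Pz z y) 0 with hneg | hpos
    · have : 0 ≤ (2*(1+4*d)^p + (4*d*δ + 8*δ) * (2 * 2^p)) * r^((3:ℝ)/2) * (1 + nsq y)^(-p) := by positivity
      linarith
    · have har := Pz_pos z y hy hpos
      have hpe := Pz_eq z y hy
      have hdotle := abs_le.mp (dot_le z y)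
      have hb := cube_nrm y x hx
      have hdist := cube_dist y x hx
      have hin : |inner ℝ (emb z) x - dot z y| ≤ r * δ := by
        rw [← emb_inner, ← inner_sub_right]
        calc _ ≤ ‖emb z‖ * ‖x - emb y‖ := abs_real_inner_le_norm _ _
          _ ≤ r * δ := by rw [emb_norm]; gcongr
      have hin1 := abs_le.mp hin
      have hb1 := abs_le.mp hb
      have ea : (nsq y)^(-((d:ℝ)/2)) = a^(-(d:ℝ)) := by
        rw [← ha2, ← Real.rpow_natCast, ← Real.rpow_mul (by linarith)]; congr 1; push_cast; ring
      rw [ea] at hpe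
      have hN : 0 ≤ -nsq y - 2 * dot z y := by
        have : 0 < a^(-(d:ℝ)) := by positivity
        rw [hpe] at hpos
        exact (pos_of_mul_pos_left hpos this.le).le
      have core := riem_core d r δ a ‖x‖ (-nsq y - 2 * dot z y) (-‖x‖^2 - 2 * inner ℝ (emb z) x) hδ0 (by linarith) (by linarith) hb hbig.le hN
        (by nlinarith) (by
          have : ‖x‖^2 ≤ (a+δ)^2 := by
            apply pow_le_pow_left₀ (norm_nonneg _); linarith
          nlinarith)
      rw [hpe]
      refine core.trans ?_
      have : pE (emb z) x = (-‖x‖^2 - 2 * inner ℝ (emb z) x) * ‖x‖^(-(d:ℝ)) := rfl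
      rw [← this]
      have k1 : r * a^(-(d:ℝ)) ≤ r^((3:ℝ)/2) * (2 * 2^p * (1+nsq y)^(-p)) := by
        have e1 : a^(-(d:ℝ)) = a^((1:ℝ)/2) * (nsq y)^(-p) := by
          rw [← ha2, ← Real.rpow_natCast, ← Real.rpow_mul (by linarith), ← Real.rpow_add (by linarith)]; congr 1; rw [hp]; push_cast; ring
        have e2 : (nsq y)^(-p) ≤ 2^p * (1+nsq y)^(-p) := by
          rw [Real.rpow_neg (by linarith), Real.rpow_neg (by linarith), ← div_eq_mul_inv, le_div_iff₀ (by positivity), mul_comm, ← div_eq_mul_inv, div_le_iff₀ (by positivity), ← Real.mul_rpow (by norm_num) (by linarith)]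
          apply Real.rpow_le_rpow (by linarith) (by linarith) hp0.le
        have e3 : a^((1:ℝ)/2) ≤ 2 * r^((1:ℝ)/2) := by
          calc a^((1:ℝ)/2) ≤ (2*r)^((1:ℝ)/2) := by gcongr
            _ = 2^((1:ℝ)/2) * r^((1:ℝ)/2) := Real.mul_rpow (by norm_num) (by linarith)
            _ ≤ 2^(1:ℝ) * r^((1:ℝ)/2) := by gcongr <;> norm_num
            _ = _ := by rw [Real.rpow_one]
        have e4 : r^((3:ℝ)/2) = r * r^((1:ℝ)/2) := by
          nth_rw 2 [← Real.rpow_one r]; rw [← Real.rpow_add (by linarith)]; norm_num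
        rw [e1, e4]
        calc r * (a^((1:ℝ)/2) * (nsq y)^(-p)) ≤ r * ((2 * r^((1:ℝ)/2)) * (2^p * (1+nsq y)^(-p))) := by gcongr
          _ = _ := by ring
      have k2 : (4*d*δ + 8*δ) * (r * a^(-(d:ℝ))) ≤ (4*d*δ + 8*δ) * (r^((3:ℝ)/2) * (2 * 2^p * (1+nsq y)^(-p))) := by gcongr
      have k3 : 0 ≤ 2*(1+4*d)^p * r^((3:ℝ)/2) * (1 + nsq y)^(-p) := by positivity
      have k4 : (2*(1+4*d)^p + (4*d*δ + 8*δ) * (2 * 2^p)) * r^((3:ℝ)/2) * (1 + nsq y)^(-p) = 2*(1+4*d)^p * r^((3:ℝ)/2) * (1 + nsq y)^(-p) + (4*d*δ + 8*δ) * (r^((3:ℝ)/2) * (2 * 2^p * (1+nsq y)^(-p))) := by ring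
      rw [k4]; linarith

/-- Sum of the positive part of the kernel. -/
lemma Pz_sum (d : ℕ) (hd : 2 ≤ d) : ∃ C, 0 < C ∧ ∀ (z : V d), z ≠ 0 → ∀ X : Finset (V d), (0 : V d) ∉ X →
    ∑ y ∈ X, max (Pz z y) 0 ≤ om d * (nrm z)^2 + C * (nrm z)^((3:ℝ)/2) := by
  obtain ⟨C1, hC1, h1⟩ := riem_pt d hd
  obtain ⟨C2, hC2, h2⟩ := sum_latt d (by omega) ((d:ℝ)+1/2) (by linarith)
  refine ⟨C1 * C2, by positivity, fun z hz X hX => ?_⟩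
  have hr := nrm_nonneg z
  have := latt_sum X (Pz z) (fun y => C1 * (nrm z)^((3:ℝ)/2) * (1 + nsq y)^(-(((d:ℝ)+1/2)/2))) (pE (emb z))
    (fun y => by have := nsq_nonneg y; positivity) (pE_meas _) (fun y hy x hx => h1 z y hz (fun h => hX (h ▸ hy)) x hx)
  have hIE := IE_eq hd (emb z)
  unfold IE at hIE
  rw [hIE, emb_norm, ← Finset.mul_sum] at this
  have h3 : C1 * (nrm z)^((3:ℝ)/2) * ∑ y ∈ X, (1 + nsq y)^(-(((d:ℝ)+1/2)/2)) ≤ C1 * C2 * (nrm z)^((3:ℝ)/2) := by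
    calc _ ≤ C1 * (nrm z)^((3:ℝ)/2) * C2 := by gcongr; exact h2 X
      _ = _ := by ring
  have h4 := this.trans (add_le_add le_rfl (ENNReal.ofReal_le_ofReal h3))
  have hom := (om_pos d).le
  rw [← ENNReal.ofReal_add (by positivity) (by positivity)] at h4
  have h5 : ∑ y ∈ X, ENNReal.ofReal (Pz z y) = ENNReal.ofReal (∑ y ∈ X, max (Pz z y) 0) := by
    rw [ENNReal.ofReal_sum_of_nonneg (fun y _ => le_max_right _ _)]
    apply Finset.sum_congr rfl
    intro y _
    rw [ENNReal.ofReal_max]; simp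
  rw [h5] at h4
  exact (ENNReal.ofReal_le_ofReal_iff (by positivity)).mp h4

end UI

end

section
open MeasureTheory Filter Set
namespace UI

lemma kernelF (d : ℕ) (hd : 2 ≤ d) : ∃ CV CK : ℝ, 0 < CV ∧ 0 < CK ∧ ∀ z : V d, z ≠ 0 → ∃ F : V d → ℝ,
    (∀ x, x ≠ z → 2 * (d:ℝ) * F x ≤ nb F x) ∧ (∀ x, 0 ≤ F x ∧ F x ≤ CV * nrm z) ∧
    (∀ X : Finset (V d), z ∉ X → ∑ x ∈ X, F x ≤ om d * (nrm z)^2 + CK * (nrm z)^((3:ℝ)/2)) ∧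
    (∀ (x : V d) (s : ℝ), nrm x ≤ s → s < nrm z → (nrm z)^2 / (nrm z)^d * (1 - d * (s / nrm z)) ≤ F x) := by
  obtain ⟨CV, CB, hCV, hCB, hk⟩ := kernelH d hd
  obtain ⟨C1, hC1, h1⟩ := Pz_sum d hd
  obtain ⟨C2, hC2, h2⟩ := sum_latt d (by omega) ((d:ℝ)+1) (by linarith)
  refine ⟨CV, C1 + CB * C2, hCV, by positivity, fun z hz => ?_⟩
  obtain ⟨H, a1, a2, a3, a4, a5⟩ := hk z hz
  have hr1 : 1 ≤ nrm z := by rw [nrm, Real.one_le_sqrt]; exact nsq_one_le z hz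
  have hr32 : nrm z ≤ (nrm z)^((3:ℝ)/2) := by
    nth_rw 1 [← Real.rpow_one (nrm z)]
    exact Real.rpow_le_rpow_of_exponent_le hr1 (by norm_num)
  refine ⟨fun x => H (x - z), ?_, fun x => a3 _, ?_, ?_⟩
  · intro x hx
    rw [nb_shift]
    exact a1 _ (sub_ne_zero.mpr hx)
  · intro X hX
    have e : ∑ x ∈ X, H (x - z) = ∑ y ∈ X.image (fun x => x - z), H y := by
      rw [Finset.sum_image]
      intro x _ y _ h
      exact sub_left_injective h
    rw [e]
    have h0 : (0 : V d) ∉ X.image (fun x => x - z) := by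
      intro h
      rw [Finset.mem_image] at h
      obtain ⟨x, hx, h⟩ := h
      rw [sub_eq_zero] at h
      exact hX (h ▸ hx)
    set Y := X.image (fun x => x - z)
    calc ∑ y ∈ Y, H y ≤ ∑ y ∈ Y, (max (Pz z y) 0 + CB * nrm z * (1+nsq y)^(-(((d:ℝ)+1)/2))) :=
          Finset.sum_le_sum fun y hy => a5 y (fun h => h0 (h ▸ hy))
      _ = ∑ y ∈ Y, max (Pz z y) 0 + CB * nrm z * ∑ y ∈ Y, (1+nsq y)^(-(((d:ℝ)+1)/2)) := by
          rw [Finset.sum_add_distrib, Finset.mul_sum]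
      _ ≤ (om d * (nrm z)^2 + C1 * (nrm z)^((3:ℝ)/2)) + CB * (nrm z)^((3:ℝ)/2) * C2 := by
          have := h2 Y
          have p0 : 0 ≤ ∑ y ∈ Y, (1+nsq y)^(-(((d:ℝ)+1)/2)) := Finset.sum_nonneg fun y _ => by
            have := nsq_nonneg y; positivity
          exact add_le_add (h1 z hz Y h0) (by gcongr)
      _ = _ := by ring
  · intro x s hx hs
    refine le_trans ?_ (a4 _)
    have hne : x - z ≠ 0 := by
      intro h
      rw [sub_eq_zero] at h
      rw [h] at hx; linarith
    rw [Pz_eq z _ hne]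
    have hx0 := nrm_nonneg x
    set r := nrm z with hr
    have eN : -nsq (x - z) - 2 * dot z (x - z) = r^2 - (nrm x)^2 := by
      rw [hr, nrm_sq, nrm_sq]
      simp only [nsq, dot, Pi.sub_apply, Int.cast_sub, Finset.mul_sum, ← Finset.sum_neg_distrib, ← Finset.sum_sub_distrib]
      apply Finset.sum_congr rfl
      intro i _; ring
    rw [eN]
    have hy1 := nsq_one_le _ hne
    have htri : nrm (x - z) ≤ s + r := by
      have : nrm (x - z) ≤ nrm x + nrm z := by
        have e : emb (x - z) = emb x - emb z := by ext i; simp [emb]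
        rw [← emb_norm, ← emb_norm, ← emb_norm, e]; exact norm_sub_le _ _
      linarith
    have hnp : 0 < nrm (x - z) := Real.sqrt_pos.mpr (by linarith)
    have ea : (nsq (x - z))^(-((d:ℝ)/2)) = ((nrm (x-z))^d)⁻¹ := by
      rw [← nrm_sq, ← Real.rpow_natCast, ← Real.rpow_mul hnp.le, ← Real.rpow_natCast, ← Real.rpow_neg hnp.le]; congr 1; push_cast; ring
    rw [ea]
    have hr0 : 0 < r := by linarith
    set u := s / r with hu
    have hu0 : 0 ≤ u := div_nonneg (by linarith) hr0.le
    have hu1 : u < 1 := by rw [hu, div_lt_one hr0]; exact hs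
    have hsu : s = u * r := by rw [hu]; field_simp
    calc r^2 / r^d * (1 - d * u) ≤ r^2 / r^d * (1 - u)^d := by
          gcongr
          have := one_add_mul_le_pow (R := ℝ) (a := -u) (by linarith) d
          have e : 1 + -u = 1 - u := by ring
          rw [e] at this; linarith
      _ ≤ r^2 / r^d * ((1 - u^2) / (1+u)^d) := by
          gcongr
          rw [le_div_iff₀ (by positivity), ← mul_pow]
          have e : (1-u)*(1+u) = 1 - u^2 := by ring
          rw [e]
          have : 0 ≤ 1 - u^2 := by nlinarith
          calc (1-u^2)^d ≤ (1-u^2)^1 := pow_le_pow_of_le_one this (by nlinarith) (by omega)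
            _ = _ := pow_one _
      _ = (r^2 - s^2) * ((s+r)^d)⁻¹ := by
          have : s + r = r * (1+u) := by rw [hsu]; ring
          rw [this, mul_pow, hsu]; field_simp
      _ ≤ (r^2 - (nrm x)^2) * ((nrm (x-z))^d)⁻¹ := by
          have b1 : (nrm x)^2 ≤ s^2 := pow_le_pow_left₀ hx0 hx 2
          have b2 : ((s+r)^d)⁻¹ ≤ ((nrm (x-z))^d)⁻¹ := by gcongr
          have b3 : s^2 ≤ r^2 := pow_le_pow_left₀ (by linarith) hs.le 2
          apply mul_le_mul (by linarith) b2 (inv_nonneg.mpr (pow_nonneg (by linarith) _)) (by linarith)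

/-- The average of `F` over `S`. -/
noncomputable def av {d : ℕ} (F : V d → ℝ) (S : Finset (V d)) : ℝ := (1 / (S.card:ℝ)) * ∑ x ∈ S, F x

noncomputable def phi {d : ℕ} (F : V d → ℝ) (z : V d) (c0 : ℝ) (S : Finset (V d)) : ℝ :=
  if z ∉ S then (max (c0 - av F S) 0)^2 else 0

lemma g_taylor (a t : ℝ) : (max (a - t) 0)^2 ≤ (max a 0)^2 - 2 * max a 0 * t + t^2 := by
  have h : max (a - t) 0 ≤ |max a 0 - t| := by
    apply max_le _ (abs_nonneg _)
    exact le_trans (by have := le_max_left a 0; linarith) (le_abs_self _)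
  have h2 : (max (a - t) 0)^2 ≤ |max a 0 - t|^2 := pow_le_pow_left₀ (le_max_right _ _) h 2
  rw [sq_abs] at h2
  nlinarith

lemma phi_step {d : ℕ} (hd : 0 < d) (F : V d → ℝ) (z : V d) (c0 Vv : ℝ) (hsub : ∀ x, x ≠ z → 2 * (d:ℝ) * F x ≤ nb F x)
    (hF : ∀ x, 0 ≤ F x ∧ F x ≤ Vv) (k : ℕ) (S : Finset (V d)) (hS : Good k S) :
    Kop (phi F z c0) S ≤ phi F z c0 S + 2 * Vv / ((k:ℝ)+2)^2 * ∑ y ∈ outb S, ker S y * F y := by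
  have hV : 0 ≤ Vv := (hF 0).1.trans (hF 0).2
  have hE0 : 0 ≤ ∑ y ∈ outb S, ker S y * F y := Finset.sum_nonneg fun y _ => mul_nonneg (ker_nonneg S y) (hF y).1
  by_cases hz : z ∈ S
  · have h1 : Kop (phi F z c0) S = 0 := by
      unfold Kop phi
      apply Finset.sum_eq_zero
      intro y _
      rw [if_neg (by simp [hz]), mul_zero]
    rw [h1]
    unfold phi
    rw [if_neg (by simp [hz])]
    positivity
  · have hcard : (S.card:ℝ) = k + 1 := by rw [hS.1]; push_cast; ring
    have hone := ker_one hd S ⟨0, hS.2.1⟩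
    have hks := ker_sub hd S F (fun x hx => hsub x (fun h => hz (h ▸ hx)))
    set E := ∑ y ∈ outb S, ker S y * F y with hE
    set X := av F S with hX
    have hXE : X ≤ E := hks
    clear_value E
    have hX0 : 0 ≤ X := by
      rw [hX, av]; exact mul_nonneg (by positivity) (Finset.sum_nonneg fun x _ => (hF x).1)
    set a := max (c0 - X) 0 with ha
    have ha0 : 0 ≤ a := le_max_right _ _
    have hphi : phi F z c0 S = a^2 := by unfold phi; rw [if_pos hz]
    have hav : ∀ y ∈ outb S, av F (insert y S) = X + (F y - X) / ((k:ℝ)+2) := by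
      intro y hy
      have hy' := (outb_mem S y hy).1
      have e1 : ∑ x ∈ S, F x = (k+1) * X := by rw [hX, av, hcard]; field_simp
      unfold av
      rw [Finset.card_insert_of_notMem hy', Finset.sum_insert hy', e1]
      push_cast
      rw [hcard]
      field_simp
      ring
    have hpt : ∀ y ∈ outb S, phi F z c0 (insert y S) ≤ a^2 - 2*a*((F y - X) / ((k:ℝ)+2)) + (Vv * F y + Vv * E) / ((k:ℝ)+2)^2 := by
      intro y hy
      have hFy := hF y
      have b1 : phi F z c0 (insert y S) ≤ (max (c0 - X - (F y - X) / ((k:ℝ)+2)) 0)^2 := by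
        unfold phi
        rw [hav y hy]
        split_ifs
        · positivity
        · apply le_of_eq; congr 2; ring
      have b2 := g_taylor (c0 - X) ((F y - X) / ((k:ℝ)+2))
      have b3 : ((F y - X) / ((k:ℝ)+2))^2 ≤ (Vv * F y + Vv * E) / ((k:ℝ)+2)^2 := by
        rw [div_pow]
        gcongr
        have hXV : X ≤ Vv := by
          have : ∑ x ∈ S, F x ≤ (k+1) * Vv := by
            calc ∑ x ∈ S, F x ≤ ∑ x ∈ S, Vv := Finset.sum_le_sum fun x _ => (hF x).2
              _ = (k+1) * Vv := by rw [Finset.sum_const, nsmul_eq_mul, hcard]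
          rw [hX, av, hcard, one_div, inv_mul_le_iff₀ (by positivity)]; exact this
        nlinarith
      linarith
    rw [hphi]
    calc Kop (phi F z c0) S ≤ ∑ y ∈ outb S, ker S y * (a^2 - 2*a*((F y - X) / ((k:ℝ)+2)) + (Vv * F y + Vv * E) / ((k:ℝ)+2)^2) :=
          Finset.sum_le_sum fun y hy => mul_le_mul_of_nonneg_left (hpt y hy) (ker_nonneg S y)
      _ = (a^2 + 2*a*X/((k:ℝ)+2) + Vv*E/((k:ℝ)+2)^2) * ∑ y ∈ outb S, ker S y + (-2*a/((k:ℝ)+2) + Vv/((k:ℝ)+2)^2) * ∑ y ∈ outb S, ker S y * F y := by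
          rw [Finset.mul_sum, Finset.mul_sum, ← Finset.sum_add_distrib]
          apply Finset.sum_congr rfl
          intro y _
          field_simp
          ring
      _ = a^2 - 2*a*(E-X)/((k:ℝ)+2) + 2 * Vv / ((k:ℝ)+2)^2 * E := by
          rw [hone, ← hE, mul_one]; field_simp; ring
      _ ≤ _ := by
          have : 0 ≤ 2*a*(E-X)/((k:ℝ)+2) := by
            have : 0 ≤ E - X := by linarith
            positivity
          linarith

lemma sumF_step {d : ℕ} (hd : 0 < d) (F : V d → ℝ) (k : ℕ) (S : Finset (V d)) (hS : Good k S) :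
    Kop (fun S : Finset (V d) => ∑ x ∈ S, F x) S = ∑ x ∈ S, F x + ∑ y ∈ outb S, ker S y * F y := by
  have hone := ker_one hd S ⟨0, hS.2.1⟩
  unfold Kop
  calc ∑ y ∈ outb S, ker S y * ∑ x ∈ insert y S, F x = ∑ y ∈ outb S, (ker S y * ∑ x ∈ S, F x + ker S y * F y) := by
        apply Finset.sum_congr rfl
        intro y hy
        rw [Finset.sum_insert (outb_mem S y hy).1]; ring
    _ = _ := by rw [Finset.sum_add_distrib, ← Finset.sum_mul, hone, one_mul]

lemma inner_abs {d : ℕ} (hd : 0 < d) (F : V d → ℝ) (z : V d) (c0 Vv K gap : ℝ) (hsub : ∀ x, x ≠ z → 2 * (d:ℝ) * F x ≤ nb F x)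
    (hF : ∀ x, 0 ≤ F x ∧ F x ≤ Vv) (hK : ∀ X : Finset (V d), z ∉ X → ∑ x ∈ X, F x ≤ K) (k0 k : ℕ) (hk : k0 ≤ k)
    (hc0 : 0 ≤ c0) (hgap : 0 ≤ gap) (hg : K / ((k:ℝ)+1) + gap ≤ c0) :
    gap^2 * μ0.real {w | z ∉ uAggFrom ({0} : Finset (V d)) w k} ≤
      c0^2 * μ0.real {w | ¬ ∀ x ∈ uAggFrom ({0} : Finset (V d)) w k0, c0 ≤ F x} + 2 * Vv * (K + Vv) / ((k0:ℝ)+2)^2 := by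
  have hV : 0 ≤ Vv := (hF 0).1.trans (hF 0).2
  set Psi : Finset (V d) → ℝ := fun S => ∑ x ∈ S, F x with hPsi
  have hPsiK : ∀ S, Psi S ≤ K + Vv := by
    intro S
    have h1 := hK (S.erase z) (by simp)
    by_cases hz : z ∈ S
    · have := Finset.add_sum_erase S F hz
      have h2 := (hF z).2
      simp only [hPsi]; linarith
    · rw [Finset.erase_eq_of_notMem hz] at h1
      simp only [hPsi]; linarith
  have hPsi0 : ∀ S, 0 ≤ Psi S := fun S => Finset.sum_nonneg fun x _ => (hF x).1
  set B := 2 * Vv / ((k0:ℝ)+2)^2 with hB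
  have hB0 : 0 ≤ B := by positivity
  have hstep : ∀ l, k0 ≤ l → EE (l+1) (fun S => phi F z c0 S + (-B) * Psi S) ≤ EE l (fun S => phi F z c0 S + (-B) * Psi S) := by
    intro l hl
    rw [EE_step hd]
    apply EE_mono hd
    intro S hS
    have h1 := phi_step hd F z c0 Vv hsub hF l S hS
    have h2 := sumF_step hd F l S hS
    have hE0 : 0 ≤ ∑ y ∈ outb S, ker S y * F y := Finset.sum_nonneg fun y _ => mul_nonneg (ker_nonneg S y) (hF y).1
    have e : Kop (fun S => phi F z c0 S + (-B) * Psi S) S = Kop (phi F z c0) S - B * Kop Psi S := by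
      unfold Kop
      rw [Finset.mul_sum, ← Finset.sum_sub_distrib]
      apply Finset.sum_congr rfl
      intro y _; ring
    have hBl : 2 * Vv / ((l:ℝ)+2)^2 ≤ B := by
      rw [hB]
      have : (k0:ℝ) ≤ l := by exact_mod_cast hl
      gcongr
    have := mul_le_mul_of_nonneg_right hBl hE0
    rw [e, h2]
    simp only [hPsi]
    nlinarith
  have hall : EE k (fun S => phi F z c0 S + (-B) * Psi S) ≤ EE k0 (fun S => phi F z c0 S + (-B) * Psi S) := by
    induction k, hk using Nat.le_induction with
    | base => exact le_rfl
    | succ l hl ih =>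
      refine (hstep l hl).trans ?_
      have aux : ∀ m : ℕ, k0 ≤ m → EE m (fun S => phi F z c0 S + (-B) * Psi S) ≤ EE k0 (fun S => phi F z c0 S + (-B) * Psi S) := by
        intro m hm
        induction m, hm using Nat.le_induction with
        | base => exact le_rfl
        | succ m hm ih2 => exact (hstep m hm).trans ih2
      exact aux l hl
  have e1 : ∀ l, EE l (fun S => phi F z c0 S + (-B) * Psi S) = EE l (phi F z c0) - B * EE l Psi := by
    intro l
    rw [EE_add hd l (phi F z c0) (fun S => (-B) * Psi S), EE_mul]; ring
  rw [e1, e1] at hall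
  have p1 : EE k Psi ≤ K + Vv := by
    have := EE_mono hd k Psi (fun _ => K + Vv) (fun S _ => hPsiK S)
    rwa [EE_const] at this
  have p0 : 0 ≤ EE k0 Psi := by
    have := EE_mono hd k0 (fun _ => 0) Psi (fun S _ => hPsi0 S)
    rwa [EE_const] at this
  have l1 : gap^2 * μ0.real {w | z ∉ uAggFrom ({0} : Finset (V d)) w k} ≤ EE k (phi F z c0) := by
    rw [EE_prob k (fun S => z ∉ S), ← EE_mul]
    apply EE_mono hd
    intro S hS
    unfold phi
    by_cases hz : z ∈ S
    · simp [hz]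
    · simp only [hz, not_false_eq_true, if_true, mul_one]
      apply pow_le_pow_left₀ hgap
      refine le_trans ?_ (le_max_left _ _)
      have : av F S ≤ K / ((k:ℝ)+1) := by
        unfold av
        rw [hS.1, one_div, inv_mul_eq_div]
        push_cast
        gcongr
        exact hK S hz
      linarith
  have l2 : EE k0 (phi F z c0) ≤ c0^2 * μ0.real {w | ¬ ∀ x ∈ uAggFrom ({0} : Finset (V d)) w k0, c0 ≤ F x} := by
    rw [EE_prob k0 (fun S => ¬ ∀ x ∈ S, c0 ≤ F x), ← EE_mul]
    apply EE_mono hd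
    intro S hS
    have hcp : (0:ℝ) < S.card := by rw [hS.1]; positivity
    have hav0 : 0 ≤ av F S := by
      unfold av; exact mul_nonneg (by positivity) (hPsi0 S)
    have hle : phi F z c0 S ≤ (max (c0 - av F S) 0)^2 := by
      unfold phi; split_ifs
      · positivity
      · exact le_rfl
    refine hle.trans ?_
    by_cases hb : ∀ x ∈ S, c0 ≤ F x
    · rw [if_neg (by simpa using hb)]
      have : c0 ≤ av F S := by
        unfold av
        rw [one_div, inv_mul_eq_div, le_div_iff₀ hcp]
        calc c0 * S.card = ∑ x ∈ S, c0 := by rw [Finset.sum_const, nsmul_eq_mul]; ring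
          _ ≤ _ := Finset.sum_le_sum hb
      rw [max_eq_right (by linarith)]; simp
    · rw [if_pos hb, mul_one]
      apply pow_le_pow_left₀ (le_max_right _ _)
      exact max_le (by linarith) hc0
  have e2 : 2 * Vv * (K + Vv) / ((k0:ℝ)+2)^2 = B * (K + Vv) := by rw [hB]; ring
  rw [e2]
  have := mul_le_mul_of_nonneg_left p1 hB0
  have := mul_nonneg hB0 p0
  linarith

end UI

end

section
open MeasureTheory Filter Set
namespace UI

lemma ev_pow (A a b : ℝ) (h : a < b) : ∀ᶠ x : ℝ in atTop, A * x^a ≤ x^b := by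
  filter_upwards [(tendsto_rpow_atTop (sub_pos.mpr h)).eventually_ge_atTop A, eventually_ge_atTop 1] with x h1 h2
  have : x^b = x^(b-a) * x^a := by rw [← Real.rpow_add (by linarith)]; congr 1; ring
  rw [this]
  have : 0 ≤ x^a := by positivity
  exact mul_le_mul_of_nonneg_right h1 this

lemma ev_exp (A a b c q : ℝ) (hb : 0 < b) (hc : 0 < c) : ∀ᶠ x : ℝ in atTop, A * x^a * Real.exp (-(c * x^b)) ≤ x^(-q) := by
  have h1 : ∀ᶠ y : ℝ in atTop, Real.exp (-c*y) ≤ y^(-((a+q+1)/b)) := by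
    have := (isLittleO_exp_neg_mul_rpow_atTop hc (-((a+q+1)/b))).bound (c := 1) one_pos
    filter_upwards [this, eventually_ge_atTop 0] with y hy hy0
    rw [one_mul, Real.norm_eq_abs, Real.norm_eq_abs, abs_of_pos (Real.exp_pos _), abs_of_nonneg (by positivity)] at hy
    exact hy
  have h2 := (tendsto_rpow_atTop hb).eventually h1
  have h3 := ev_pow |A| (-q-1) (-q) (by linarith)
  filter_upwards [h2, h3, eventually_ge_atTop 1] with x e1 e2 hx
  have e : (x^b)^(-((a+q+1)/b)) = x^(-(a+q+1)) := by
    rw [← Real.rpow_mul (by linarith)]; congr 1; field_simp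
  rw [e] at e1
  have hx0 : 0 < x := by linarith
  calc A * x^a * Real.exp (-(c * x^b)) ≤ |A| * x^a * Real.exp (-(c * x^b)) := by
        gcongr; exact le_abs_self A
    _ ≤ |A| * x^a * x^(-(a+q+1)) := by
        gcongr
        have : -(c * x^b) = -c * x^b := by ring
        rw [this]; exact e1
    _ = |A| * x^(-q-1) := by rw [mul_assoc, ← Real.rpow_add hx0]; congr 2; ring
    _ ≤ _ := e2

/-- Polynomial form of the outer estimate. -/
lemma outer2 (d : ℕ) (hd : 2 ≤ d) (τ p q κ : ℝ) (hτ : 0 < τ) (hτd : τ ≤ 1) (hp : 0 < p) (hκ : 1 ≤ κ) :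
    ∀ᶠ x : ℝ in atTop, ∀ (k : ℕ) (R : ℝ), (k:ℝ) ≤ x^p → 0 ≤ R →
      μ0.real {w | (((uAggFrom ({0} : Finset (V d)) w k).filter (fun y => R < nrm y)).card:ℝ) ≤ κ * x^((d:ℝ)-τ) ∧
        ∃ y ∈ uAggFrom ({0} : Finset (V d)) w k, R + x^(1-τ/(2*d)) < nrm y} ≤ x^(-q) := by
  have hd' : (2:ℝ) ≤ d := by exact_mod_cast hd
  obtain ⟨C, hC, ho⟩ := outer d hd (τ/(2*d)) (by positivity)
  set ε := τ/(8*d) with hε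
  have hε0 : 0 < ε := by positivity
  set e1 := ε/p with he1
  have he10 : 0 < e1 := by positivity
  have hε1 : ε ≤ 1/16 := by
    rw [hε, div_le_iff₀ (by positivity)]; linarith
  have eτ : τ/(2*d) = 4*ε := by rw [hε]; field_simp; norm_num
  set κ' := κ^((2+τ/(2*d))/d) with hκ'
  have v1 := ev_pow (C*(1+3^e1/e1)*κ') (2 - 11*ε) (2 - 10 * ε) (by linarith)
  have v2 := ev_exp 9 (2*p) ε (1/4) q hε0 (by norm_num)
  have v3 := ev_pow 2 0 (1-4*ε) (by linarith)
  filter_upwards [v1, v2, v3, eventually_ge_atTop 1] with x f1 f2 f3 hx k R hk hR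
  have hx0 : 0 < x := by linarith
  set m := κ * x^((d:ℝ)-τ) with hm
  have hm1 : 1 ≤ m := by
    have : 1 ≤ x^((d:ℝ)-τ) := Real.one_le_rpow hx (by linarith)
    nlinarith
  have hxp : 1 ≤ x^p := Real.one_le_rpow hx hp.le
  have hk3 : (k:ℝ) + 2 ≤ 3 * x^p := by linarith
  have hk0 : (0:ℝ) ≤ k := Nat.cast_nonneg k
  set h := x^(1-5*ε) with hh
  have hh1 : 1 ≤ h := Real.one_le_rpow hx (by linarith)
  have hlog : 1 + Real.log ((k:ℝ)+2) ≤ (1 + 3^e1/e1) * x^ε := by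
    have g1 := Real.log_le_rpow_div (x := (k:ℝ)+2) (by linarith) he10
    have g2 : ((k:ℝ)+2)^e1 ≤ 3^e1 * x^ε := by
      calc ((k:ℝ)+2)^e1 ≤ (3 * x^p)^e1 := by gcongr
        _ = 3^e1 * x^ε := by
          rw [Real.mul_rpow (by norm_num) (by positivity), ← Real.rpow_mul hx0.le]
          congr 2; rw [he1]; field_simp
    have g3 : 1 ≤ x^ε := Real.one_le_rpow hx hε0.le
    have g4 : ((k:ℝ)+2)^e1/e1 ≤ 3^e1 * x^ε/e1 := by gcongr
    have g5 : 3^e1 * x^ε/e1 = 3^e1/e1 * x^ε := by ring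
    linarith
  have hmp : m^((2+τ/(2*d))/d) ≤ κ' * x^(2-12*ε) := by
    rw [hm, Real.mul_rpow (by linarith) (by positivity), ← Real.rpow_mul hx0.le]
    gcongr
    · have t1 : ((d:ℝ)-τ) * ((2+τ/(2*d))/d) = 2 - 12*ε - τ/d * (τ/(2*d)) := by
        have : τ = 8*d*ε := by rw [hε]; field_simp
        rw [this]; field_simp; ring
      rw [t1]
      have : 0 ≤ τ/d * (τ/(2*d)) := by positivity
      linarith
  have hcond : C*(1+Real.log ((k:ℝ)+2)) * m^((2+τ/(2*d))/d) ≤ h^2 := by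
    have hh2 : h^2 = x^(2-10*ε) := by
      rw [hh, ← Real.rpow_natCast, ← Real.rpow_mul hx0.le]; congr 1; push_cast; ring
    rw [hh2]
    refine le_trans ?_ f1
    calc C*(1+Real.log ((k:ℝ)+2)) * m^((2+τ/(2*d))/d) ≤ C*((1 + 3^e1/e1) * x^ε) * (κ' * x^(2-12*ε)) := by
          gcongr
      _ = C*(1+3^e1/e1)*κ' * (x^ε * x^(2-12*ε)) := by ring
      _ = _ := by rw [← Real.rpow_add hx0]; congr 2; ring
  have := ho k m R h (x^(1-τ/(2*d)) - 1) hm1 hR hh1 hcond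
  have eset : R + 1 + (x^(1-τ/(2*d)) - 1) = R + x^(1-τ/(2*d)) := by ring
  rw [eset] at this
  refine this.trans (le_trans ?_ f2)
  rw [Real.rpow_zero, mul_one] at f3
  rw [eτ]
  have hD : x^ε/4 ≤ (x^(1-4*ε) - 1)/(2*h) := by
    rw [le_div_iff₀ (by positivity)]
    have : x^ε * h = x^(1-4*ε) := by rw [hh, ← Real.rpow_add hx0]; congr 1; ring
    nlinarith
  calc ((k:ℝ)+2)^2 * Real.exp (-((x^(1-4*ε) - 1)/(2*h))) ≤ (3*x^p)^2 * Real.exp (-(1/4 * x^ε)) := by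
        gcongr; linarith
    _ = 9 * x^(2*p) * Real.exp (-(1/4 * x^ε)) := by
        have : x^(2*p) = (x^p)^2 := by rw [← Real.rpow_natCast, ← Real.rpow_mul hx0.le]; congr 1; push_cast; ring
        rw [this]; ring

end UI

end

section
open MeasureTheory Filter Set
namespace UI

lemma gap_core (d : ℕ) (hd : 2 ≤ d) (C δ x r y t e o b : ℝ) (hC : 0 ≤ C) (ho : 0 < o) (hδ : 0 ≤ δ) (hr : 0 < r) (ht0 : 0 ≤ t)
    (hrt : r^(-(1:ℝ)/2) ≤ t) (hy0 : 0 ≤ y) (hy1 : y ≤ 1) (hrx : r ≤ x - x*y) (hδx : 2*δ ≤ x*y) (hxδ : δ < x)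
    (h1 : 8 * (C/o) * t ≤ y) (h2 : 8 * d * e ≤ y) (hb : o * (x - δ)^d ≤ b) :
    (o * r^2 + C * r^((3:ℝ)/2)) / b + r^2/r^d * (y/4) ≤ r^2/r^d * (1 - d * e) := by
  have hxd : 0 < x - δ := by linarith
  have hb0 : 0 < o * (x-δ)^d := by positivity
  have e32 : r^((3:ℝ)/2) = r^2 * r^(-(1:ℝ)/2) := by
    rw [← Real.rpow_natCast, ← Real.rpow_add hr]; congr 1; norm_num
  have hL : 0 < r^2/r^d := by positivity
  have hq : r/(x-δ) ≤ 1 - y/2 := by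
    rw [div_le_iff₀ hxd]; nlinarith
  have hqd : (r/(x-δ))^d ≤ 1 - y/2 := by
    calc (r/(x-δ))^d ≤ (r/(x-δ))^1 := pow_le_pow_of_le_one (by positivity) (by linarith) (by omega)
      _ ≤ _ := by rw [pow_one]; exact hq
  have k1 : (o * r^2 + C * r^((3:ℝ)/2)) / b ≤ r^2/r^d * ((1 + C/o*t) * (1 - y/2)) := by
    calc (o * r^2 + C * r^((3:ℝ)/2)) / b ≤ (o * r^2 + C * r^((3:ℝ)/2)) / (o * (x-δ)^d) := by gcongr
      _ = r^2/r^d * ((1 + C/o * r^(-(1:ℝ)/2)) * (r/(x-δ))^d) := by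
          rw [e32, div_pow]; field_simp
      _ ≤ _ := by gcongr
  have k2 : (1 + C/o*t) * (1 - y/2) + y/4 ≤ 1 - d*e := by
    have : 0 ≤ C/o*t := by positivity
    nlinarith
  calc _ ≤ r^2/r^d * ((1 + C/o*t) * (1 - y/2)) + r^2/r^d * (y/4) := by linarith
    _ = r^2/r^d * ((1 + C/o*t) * (1 - y/2) + y/4) := by ring
    _ ≤ _ := by gcongr

lemma prob_mono {d : ℕ} (hd : 0 < d) (k : ℕ) (P Q : Finset (V d) → Prop) (h : ∀ S, Good k S → P S → Q S) :
    μ0.real {w | P (uAggFrom ({0} : Finset (V d)) w k)} ≤ μ0.real {w | Q (uAggFrom ({0} : Finset (V d)) w k)} := by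
  rw [EE_prob, EE_prob]
  apply EE_mono hd
  intro S hS
  by_cases hP : P S
  · rw [if_pos hP, if_pos (h S hS hP)]
  · rw [if_neg hP]; split_ifs <;> norm_num

lemma bn_ge (d : ℕ) (hd : 2 ≤ d) : ∀ᶠ n : ℕ in atTop, om d * ((n:ℝ) - √d)^d ≤ (bn d n : ℝ) := by
  filter_upwards [(tendsto_natCast_atTop_atTop (R := ℝ)).eventually_ge_atTop (√d)] with n hn
  exact ball_card_ge d hd n hn

lemma bn_ge2 (d : ℕ) (hd : 2 ≤ d) (γ : ℝ) (hγ : 0 < γ) : ∀ᶠ n : ℕ in atTop, (n:ℝ)^((d:ℝ)-γ) + 1 ≤ (bn d n : ℝ) := by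
  have hd' : (2:ℝ) ≤ d := by exact_mod_cast hd
  have hom := om_pos d
  have v1 := (tendsto_natCast_atTop_atTop (R := ℝ)).eventually (ev_pow (2 * (2^d / om d)) ((d:ℝ)-γ) d (by linarith))
  have v2 := (tendsto_natCast_atTop_atTop (R := ℝ)).eventually (ev_pow (2 * (2^d / om d)) 0 d (by linarith))
  filter_upwards [bn_ge d hd, v1, v2, (tendsto_natCast_atTop_atTop (R := ℝ)).eventually_ge_atTop (2*√d)] with n h1 h2 h3 h4
  have hs := Real.sqrt_nonneg (d:ℝ)
  refine le_trans ?_ h1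
  have h5 : om d * ((n:ℝ)/2)^d ≤ om d * ((n:ℝ) - √d)^d := by
    gcongr; linarith
  refine le_trans ?_ h5
  rw [Real.rpow_natCast] at h2 h3
  rw [Real.rpow_zero] at h3
  have e : om d * ((n:ℝ)/2)^d = (n:ℝ)^d / (2^d/om d) := by rw [div_pow]; field_simp
  rw [e, le_div_iff₀ (by positivity)]
  nlinarith

set_option maxHeartbeats 1600000 in
lemma inner_est (d : ℕ) (hd : 2 ≤ d) : ∀ᶠ n : ℕ in atTop, ∀ z : V d, (n:ℝ)^(1 - 1/(16*(d:ℝ))) ≤ nrm z →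
    nrm z ≤ (n:ℝ) - (n:ℝ)^(1 - 1/(32*(d:ℝ))) →
    μ0.real {w | z ∉ uAggFrom ({0} : Finset (V d)) w (bn d n - 1)} ≤ (n:ℝ)^(-(1:ℝ)/4) := by
  have hd' : (2:ℝ) ≤ d := by exact_mod_cast hd
  obtain ⟨CV, CK, hCV, hCK, hker⟩ := kernelF d hd
  have hom := om_pos d
  set c1 := 1/(32*(d:ℝ)) with hc1
  have hc10 : 0 < c1 := by positivity
  have hc11 : c1 ≤ 1/64 := by
    rw [hc1]; apply one_div_le_one_div_of_le <;> linarith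
  have eε : 1/(16*(d:ℝ)) = 2*c1 := by rw [hc1]; field_simp; norm_num
  rw [eε]
  set δ := √(d:ℝ) with hδ
  have hδ0 : 0 ≤ δ := Real.sqrt_nonneg _
  set C3 := 2*CV*(om d + CK + CV) with hC3
  have hC30 : 0 < C3 := by positivity
  have cast := tendsto_natCast_atTop_atTop (R := ℝ)
  have v1 := cast.eventually (ev_pow (8 * (CK/om d)) (-(1:ℝ)/4) (-c1) (by linarith))
  have v2 := cast.eventually (ev_pow (8 * d) (-(2*c1)) (-c1) (by linarith))
  have v3 := cast.eventually (ev_pow (2*δ) 0 (1-c1) (by linarith))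
  have v4 := cast.eventually (ev_pow (16*(1+C3)) (2*c1 - 1/2) (-(1:ℝ)/4) (by linarith))
  have v5 := bn_ge d hd
  have v6 := bn_ge2 d hd (1/4) (by norm_num)
  have v7 := cast.eventually (outer2 d hd (1/4) d 1 2 (by norm_num) (by norm_num) (by linarith) (by norm_num))
  filter_upwards [v1, v2, v3, v4, v5, v6, v7, cast.eventually_gt_atTop 1, cast.eventually_gt_atTop δ] with n f1 f2 f3 f4 f5 f6 f7 hx hxδ z hz1 hz2
  set x : ℝ := (n:ℝ) with hxdef
  have hx0 : 0 < x := by linarith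
  have hzpos : 0 < nrm z := lt_of_lt_of_le (by positivity) hz1
  have hz0 : z ≠ 0 := by
    intro h
    rw [h] at hzpos
    simp [nrm, nsq] at hzpos
  obtain ⟨F, g1, g2, g3, g4⟩ := hker z hz0
  have hr1 : 1 ≤ nrm z := nrm_one_le z hzpos
  set r := nrm z with hr
  set y := x^(-c1) with hy
  have hy0 : 0 < y := by positivity
  have hy1 : y ≤ 1 := Real.rpow_le_one_of_one_le_of_nonpos hx.le (by linarith)
  have exy : x * y = x^(1-c1) := by
    rw [hy]; nth_rw 1 [← Real.rpow_one x]; rw [← Real.rpow_add hx0]; congr 1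
  set L := r^2/r^d with hL
  have hL0 : 0 < L := by positivity
  have hrx : r ≤ x := by
    exact hz2.trans (sub_le_self _ (by positivity))
  set c0 := L * (1 - d * x^(-(2*c1))) with hc0
  have hde : d * x^(-(2*c1)) ≤ 1 := by
    have : 0 ≤ (d:ℝ) * x^(-(2*c1)) := by positivity
    nlinarith
  have hc00 : 0 ≤ c0 := mul_nonneg hL0.le (by linarith)
  have hc0L : c0 ≤ L := by
    have : 0 ≤ (d:ℝ) * x^(-(2*c1)) := by positivity
    rw [hc0]; nlinarith
  set k0 := ⌊x^((d:ℝ) - 1/4)⌋₊ with hk0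
  have hk0le : (k0:ℝ) ≤ x^((d:ℝ)-1/4) := Nat.floor_le (by positivity)
  have hk0ge : x^((d:ℝ)-1/4) ≤ (k0:ℝ) + 2 := by
    have := Nat.lt_floor_add_one (x^((d:ℝ)-1/4))
    linarith
  have hbn1 : 1 ≤ bn d n := by
    have : (1:ℝ) ≤ bn d n := by
      have : 0 ≤ x^((d:ℝ)-1/4) := by positivity
      linarith
    exact_mod_cast this
  have hcastb : ((bn d n - 1 : ℕ):ℝ) + 1 = bn d n := by
    rw [Nat.cast_sub hbn1]; push_cast; ring
  have hkk : k0 ≤ bn d n - 1 := by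
    have : (k0:ℝ) ≤ ((bn d n - 1 : ℕ):ℝ) := by linarith
    exact_mod_cast this
  have hgap := gap_core d hd CK δ x r y (x^(-(1:ℝ)/4)) (x^(-(2*c1))) (om d) (bn d n) hCK.le hom hδ0 hzpos (by positivity) (by
      have : x^((1:ℝ)/2) ≤ r := by
        refine le_trans ?_ hz1
        exact Real.rpow_le_rpow_of_exponent_le hx.le (by linarith)
      calc r^(-(1:ℝ)/2) ≤ (x^((1:ℝ)/2))^(-(1:ℝ)/2) := Real.rpow_le_rpow_of_nonpos (by positivity) this (by norm_num)
        _ = x^(-(1:ℝ)/4) := by rw [← Real.rpow_mul hx0.le]; norm_num) hy0.le hy1 (by rw [exy]; exact hz2) (by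
      rw [exy]; rw [Real.rpow_zero, mul_one] at f3; exact f3) hxδ f1 f2 f5
  have hin := inner_abs (by omega) F z c0 (CV * r) (om d * r^2 + CK * r^((3:ℝ)/2)) (L*(y/4)) g1 g2 g3 k0 (bn d n - 1) hkk hc00 (by positivity)
    (by rw [hcastb]; exact hgap)
  -- bad event
  have hbad : μ0.real {w | ¬ ∀ u ∈ uAggFrom ({0} : Finset (V d)) w k0, c0 ≤ F u} ≤ x^(-(1:ℝ)) := by
    refine le_trans ?_ (f7 k0 0 (hk0le.trans (Real.rpow_le_rpow_of_exponent_le hx.le (by linarith))) le_rfl)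
    apply prob_mono (by omega) k0 (fun S => ¬ ∀ u ∈ S, c0 ≤ F u)
      (fun S => ((S.filter (fun y => 0 < nrm y)).card:ℝ) ≤ 2 * x^((d:ℝ)-1/4) ∧ ∃ y ∈ S, 0 + x^(1-1/4/(2*(d:ℝ))) < nrm y)
    intro S hS hP
    constructor
    · have a1 : ((S.filter (fun y => 0 < nrm y)).card:ℝ) ≤ S.card := by
        exact_mod_cast Finset.card_filter_le _ _
      rw [hS.1] at a1
      push_cast at a1
      have : 1 ≤ x^((d:ℝ)-1/4) := Real.one_le_rpow hx.le (by linarith)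
      linarith
    · push Not at hP
      obtain ⟨u, hu, hFu⟩ := hP
      refine ⟨u, hu, ?_⟩
      by_contra hcon
      push Not at hcon
      rw [zero_add] at hcon
      have e4 : 1 - 1/4/(2*(d:ℝ)) = 1 - 4*c1 := by
        have e5 : 1/4/(2*(d:ℝ)) = 4*c1 := by rw [hc1]; field_simp; norm_num
        rw [e5]
      rw [e4] at hcon
      have hsr : x^(1-4*c1) < r := lt_of_lt_of_le (Real.rpow_lt_rpow_of_exponent_lt hx (by linarith)) hz1
      have := g4 u _ hcon hsr
      have hq : x^(1-4*c1)/r ≤ x^(-(2*c1)) := by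
        rw [div_le_iff₀ hzpos]
        calc x^(1-4*c1) = x^(-(2*c1)) * x^(1-2*c1) := by rw [← Real.rpow_add hx0]; congr 1; ring
          _ ≤ _ := by gcongr
      have : c0 ≤ L * (1 - d * (x^(1-4*c1)/r)) := by
        rw [hc0]; gcongr
      linarith
  -- conclusion
  have hVK : 2 * (CV*r) * (om d * r^2 + CK * r^((3:ℝ)/2) + CV*r) ≤ C3 * r^3 := by
    have b1 : r^((3:ℝ)/2) ≤ r^2 := by
      rw [← Real.rpow_natCast]; exact Real.rpow_le_rpow_of_exponent_le hr1 (by norm_num)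
    have b2 : r ≤ r^2 := by nlinarith
    calc 2 * (CV*r) * (om d * r^2 + CK * r^((3:ℝ)/2) + CV*r) ≤ 2 * (CV*r) * (om d * r^2 + CK * r^2 + CV*r^2) := by gcongr
      _ = C3 * r^3 := by rw [hC3]; ring
  have hr3 : r^3 ≤ L^2 * x^(2*(d:ℝ)-1) := by
    have b1 : r^(2*(d:ℝ)-1) ≤ x^(2*(d:ℝ)-1) := Real.rpow_le_rpow hzpos.le hrx (by linarith)
    have b2 : r^3 = L^2 * r^(2*(d:ℝ)-1) := by
      have : r^(2*(d:ℝ)-1) = (r^d)^2 / r := by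
        rw [Real.rpow_sub hzpos, Real.rpow_one, mul_comm, Real.rpow_mul hzpos.le, Real.rpow_natCast]; norm_num
      rw [this, hL]; field_simp
    rw [b2]; gcongr
  have hk2 : x^(2*(d:ℝ)-1/2) ≤ ((k0:ℝ)+2)^2 := by
    calc x^(2*(d:ℝ)-1/2) = (x^((d:ℝ)-1/4))^2 := by rw [← Real.rpow_natCast, ← Real.rpow_mul hx0.le]; congr 1; push_cast; ring
      _ ≤ _ := by gcongr
  have hlast : 2 * (CV*r) * (om d * r^2 + CK * r^((3:ℝ)/2) + CV*r) / ((k0:ℝ)+2)^2 ≤ L^2 * (C3 * x^(-(1:ℝ)/2)) := by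
    calc _ ≤ C3 * (L^2 * x^(2*(d:ℝ)-1)) / x^(2*(d:ℝ)-1/2) := by
          have hV2 := hVK.trans (mul_le_mul_of_nonneg_left hr3 hC30.le)
          exact div_le_div₀ (by positivity) hV2 (by positivity) hk2
      _ = L^2 * (C3 * (x^(2*(d:ℝ)-1) / x^(2*(d:ℝ)-1/2))) := by ring
      _ = _ := by rw [← Real.rpow_sub hx0]; congr 3; ring
  set P := μ0.real {w | z ∉ uAggFrom ({0} : Finset (V d)) w (bn d n - 1)} with hP
  have hfin : (L*(y/4))^2 * P ≤ L^2 * ((1+C3) * x^(-(1:ℝ)/2)) := by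
    have b1 : c0^2 * μ0.real {w | ¬ ∀ u ∈ uAggFrom ({0} : Finset (V d)) w k0, c0 ≤ F u} ≤ L^2 * x^(-(1:ℝ)/2) := by
      apply mul_le_mul (pow_le_pow_left₀ hc00 hc0L 2) _ measureReal_nonneg (by positivity)
      exact hbad.trans (Real.rpow_le_rpow_of_exponent_le hx.le (by norm_num))
    calc _ ≤ _ := hin
      _ ≤ L^2 * x^(-(1:ℝ)/2) + L^2 * (C3 * x^(-(1:ℝ)/2)) := add_le_add b1 hlast
      _ = _ := by ring
  have hfin2 : y^2/16 * P ≤ (1+C3) * x^(-(1:ℝ)/2) := by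
    have : (L*(y/4))^2 * P = L^2 * (y^2/16 * P) := by ring
    rw [this] at hfin
    exact le_of_mul_le_mul_left hfin (by positivity)
  refine le_trans ?_ f4
  have hyy : x^(2*c1) * y^2 = 1 := by
    rw [hy, ← Real.rpow_natCast, ← Real.rpow_mul hx0.le, ← Real.rpow_add hx0]
    have : 2*c1 + -c1 * ((2:ℕ):ℝ) = 0 := by push_cast; ring
    rw [this, Real.rpow_zero]
  calc P = 16 * x^(2*c1) * (y^2/16 * P) := by linear_combination (-P) * hyy
    _ ≤ 16 * x^(2*c1) * ((1+C3) * x^(-(1:ℝ)/2)) := by gcongr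
    _ = 16*(1+C3) * (x^(2*c1) * x^(-(1:ℝ)/2)) := by ring
    _ = _ := by rw [← Real.rpow_add hx0]; congr 2; ring

end UI

end

section
open MeasureTheory Filter Set
namespace UI

lemma count_markov {ι : Type*} (Z : Finset ι) (E : ι → Set ℝ) (hE : ∀ z ∈ Z, MeasurableSet (E z)) (p M : ℝ) (hM : 0 < M)
    (h : ∀ z ∈ Z, μ0.real (E z) ≤ p) :
    μ0.real {w | M ≤ ∑ z ∈ Z, (E z).indicator (fun _ => (1:ℝ)) w} ≤ Z.card * p / M := by
  have hintg : ∀ z ∈ Z, Integrable ((E z).indicator (fun _ => (1:ℝ))) μ0 := fun z hz =>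
    (integrable_const (1:ℝ)).indicator (hE z hz)
  have h1 := mul_meas_ge_le_integral_of_nonneg (μ := μ0) (f := fun w => ∑ z ∈ Z, (E z).indicator (fun _ => (1:ℝ)) w)
    (Eventually.of_forall (fun w => Finset.sum_nonneg fun z _ => Set.indicator_nonneg (fun _ _ => zero_le_one) w))
    (integrable_finset_sum _ hintg) M
  rw [integral_finset_sum _ hintg] at h1
  have h2 : ∑ z ∈ Z, ∫ w, (E z).indicator (fun _ => (1:ℝ)) w ∂μ0 ≤ Z.card * p := by
    rw [← nsmul_eq_mul]
    apply Finset.sum_le_card_nsmul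
    intro z hz
    rw [integral_indicator_const _ (hE z hz)]
    simpa using h z hz
  rw [le_div_iff₀ hM]
  linarith

lemma card_split {d : ℕ} (S : Finset (V d)) (ρ R U : ℝ)
    (hU : ∑ z ∈ (ball d R).filter (fun z => ρ ≤ nrm z), (if z ∉ S then (1:ℝ) else 0) ≤ U) :
    ((S.filter (fun y => R < nrm y)).card : ℝ) ≤ S.card - (ball d R).card + (ball d ρ).card + U := by
  classical
  set T := ((ball d R).filter (fun z => ρ ≤ nrm z)).filter (fun z => z ∉ S) with hT
  have hTU : (T.card : ℝ) ≤ U := by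
    refine le_trans (le_of_eq ?_) hU
    rw [hT, Finset.sum_ite, Finset.sum_const_zero]
    simp
  have h1 := Finset.card_filter_add_card_filter_not (s := S) (fun y => R < nrm y)
  have h2 : (ball d R) ⊆ S.filter (fun y => ¬ R < nrm y) ∪ (ball d ρ ∪ T) := by
    intro z hz
    have hz' := (mem_ball_iff z R).1 hz
    by_cases a : z ∈ S
    · exact Finset.mem_union_left _ (Finset.mem_filter.2 ⟨a, not_lt.2 hz'⟩)
    · apply Finset.mem_union_right
      by_cases b : ρ ≤ nrm z
      · exact Finset.mem_union_right _ (Finset.mem_filter.2 ⟨Finset.mem_filter.2 ⟨hz, b⟩, a⟩)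
      · exact Finset.mem_union_left _ ((mem_ball_iff z ρ).2 (not_le.1 b).le)
  have h3 := (Finset.card_le_card h2).trans (Finset.card_union_le _ _)
  have h4 := Finset.card_union_le (ball d ρ) T
  have h1' : ((S.filter (fun y => R < nrm y)).card : ℝ) + ((S.filter (fun y => ¬ R < nrm y)).card : ℝ) = S.card := by
    exact_mod_cast h1
  have h5 : ((ball d R).card : ℝ) ≤ ((S.filter (fun y => ¬ R < nrm y)).card : ℝ) + ((ball d ρ).card + T.card) := by
    exact_mod_cast h3.trans (Nat.add_le_add_left h4 _)
  linarith

set_option maxHeartbeats 1000000 in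
lemma calc_bound (d : ℕ) (hd : 2 ≤ d) : ∀ᶠ x : ℝ in atTop,
    ((ball d x).card : ℝ) - (ball d (x - x^(1 - 1/(32*(d:ℝ)))) ).card + (ball d (x^(1 - 1/(16*(d:ℝ))))).card + x^((d:ℝ)-1/8)
      ≤ x^((d:ℝ) - 1/(64*(d:ℝ))) := by
  have hd' : (2:ℝ) ≤ d := by exact_mod_cast hd
  have hom := om_pos d
  set c1 := 1/(32*(d:ℝ)) with hc1
  have hc10 : 0 < c1 := by positivity
  have hc11 : c1 ≤ 1/64 := by
    rw [hc1]; apply one_div_le_one_div_of_le <;> linarith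
  have eε : 1/(16*(d:ℝ)) = 2*c1 := by rw [hc1]; field_simp; norm_num
  have eτ : 1/(64*(d:ℝ)) = c1/2 := by rw [hc1]; field_simp; norm_num
  have ed : 2*c1*d = 1/16 := by rw [hc1]; field_simp; norm_num
  rw [eε, eτ]
  set δ := √(d:ℝ) with hδ
  have hδ0 : 0 ≤ δ := Real.sqrt_nonneg _
  filter_upwards [ev_pow (3 * (om d * (2 * d * 2^(d-1)))) ((d:ℝ)-c1) ((d:ℝ)-c1/2) (by linarith),
    ev_pow (3 * (om d * 2^d)) ((d:ℝ)-1/16) ((d:ℝ)-c1/2) (by linarith),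
    ev_pow 3 ((d:ℝ)-1/8) ((d:ℝ)-c1/2) (by linarith),
    ev_pow (2*δ+1) 0 (1-c1) (by linarith),
    ev_pow (δ+1) 0 (1-2*c1) (by linarith),
    ev_pow 4 (1-c1) 1 (by linarith), eventually_gt_atTop 1] with x f1 f2 f3 f4 f5 f6 hx
  have hx0 : 0 < x := zero_lt_one.trans hx
  rw [Real.rpow_zero, mul_one] at f4 f5
  rw [Real.rpow_one] at f6
  have f7 : x^(1-2*c1) ≤ x^(1-c1) := Real.rpow_le_rpow_of_exponent_le hx.le (by linarith)
  have g1 := ball_card_le d hd x hx0.le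
  have g2 := ball_card_ge d hd (x - x^(1-c1)) (by linarith)
  have g3 := ball_card_le d hd (x^(1-2*c1)) (by positivity)
  set a := x + δ + 1 with ha
  set b := x - x^(1-c1) - δ with hb
  have hP : 0 ≤ x^(1-c1) := by positivity
  have hb0 : 0 ≤ b := by linarith
  have hab : b ≤ a := by linarith
  have g4 := abs_pow_sub_pow_le a b d
  have g5 : a^d - b^d ≤ 2 * d * 2^(d-1) * x^((d:ℝ)-c1) := by
    have k1 : |a - b| ≤ 2 * x^(1-c1) := by
      rw [abs_of_nonneg (by linarith)]; linarith
    have k2 : max |a| |b| ≤ 2*x := by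
      rw [abs_of_nonneg (by linarith), abs_of_nonneg hb0]
      exact max_le (by linarith) (by linarith)
    have k3 : x^(1-c1) * x^(d-1) = x^((d:ℝ)-c1) := by
      rw [← Real.rpow_natCast, ← Real.rpow_add hx0, Nat.cast_sub (by omega)]
      congr 1; push_cast; ring
    calc a^d - b^d ≤ _ := le_abs_self _
      _ ≤ _ := g4
      _ ≤ (2 * x^(1-c1)) * d * (2*x)^(d-1) := by
        gcongr
      _ = 2 * d * 2^(d-1) * (x^(1-c1) * x^(d-1)) := by rw [mul_pow]; ring
      _ = _ := by rw [k3]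
  have g6 : (x^(1-2*c1) + δ + 1)^d ≤ 2^d * x^((d:ℝ)-1/16) := by
    calc (x^(1-2*c1) + δ + 1)^d ≤ (2 * x^(1-2*c1))^d := by
          apply pow_le_pow_left₀ (by positivity); linarith
      _ = 2^d * x^((d:ℝ)-1/16) := by
          rw [mul_pow, ← Real.rpow_natCast (x^(1-2*c1)), ← Real.rpow_mul hx0.le]
          congr 2; linarith
  have g7 : om d * a^d - om d * b^d ≤ om d * (2 * d * 2^(d-1) * x^((d:ℝ)-c1)) := by
    rw [← mul_sub]; gcongr
  have g8 := mul_le_mul_of_nonneg_left g6 hom.le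
  linarith

end UI

end

section
open MeasureTheory Filter Set
namespace UI

set_option maxHeartbeats 1000000 in
lemma prob_n (d : ℕ) (hd : 2 ≤ d) : ∀ᶠ n : ℕ in atTop,
    μ0.real {w | ∃ y ∈ uAggFrom ({0} : Finset (V d)) w (bn d n - 1), (n:ℝ) + (n:ℝ)^(1 - 1/(64*(d:ℝ))/(2*(d:ℝ))) < nrm y}
      ≤ (n:ℝ)^(-(1:ℝ)/16) := by
  have hd' : (2:ℝ) ≤ d := by exact_mod_cast hd
  have hom := om_pos d
  set τ := 1/(64*(d:ℝ)) with hτ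
  have hτ0 : 0 < τ := by positivity
  have hτ1 : τ ≤ 1 := by
    rw [hτ, div_le_one (by positivity)]; linarith
  have cast := tendsto_natCast_atTop_atTop (R := ℝ)
  have v1 := cast.eventually (outer2 d hd τ (d+1) 1 1 hτ0 hτ1 (by linarith) le_rfl)
  have v2 := inner_est d hd
  have v3 := cast.eventually (calc_bound d hd)
  have v4 := cast.eventually (ev_pow (om d * 2^d) d (d+1) (by linarith))
  have v5 := cast.eventually (ev_pow (2 * (om d * 2^d)) (-(1:ℝ)/8) (-(1:ℝ)/16) (by norm_num))
  have v6 := cast.eventually (ev_pow 2 (-(1:ℝ)) (-(1:ℝ)/16) (by norm_num))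
  filter_upwards [v1, v2, v3, v4, v5, v6, cast.eventually_gt_atTop 1, cast.eventually_ge_atTop (√d+1)] with n f1 f2 f3 f4 f5 f6 hx hxδ
  have hbn : bn d n = (ball d (n:ℝ)).card := rfl
  set x : ℝ := (n:ℝ) with hxdef
  have hx0 : 0 < x := zero_lt_one.trans hx
  set R := x - x^(1 - 1/(32*(d:ℝ))) with hR
  set ρ := x^(1 - 1/(16*(d:ℝ))) with hρ
  have hRx : R ≤ x := sub_le_self _ (by positivity)
  have hR0 : 0 ≤ R := by
    rw [hR, sub_nonneg]
    calc x^(1 - 1/(32*(d:ℝ))) ≤ x^(1:ℝ) := Real.rpow_le_rpow_of_exponent_le hx.le (sub_le_self _ (by positivity))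
      _ = x := Real.rpow_one x
  set k := bn d n - 1 with hk
  have hbn1 : 1 ≤ bn d n := by
    rw [hbn]
    apply Finset.card_pos.2
    refine ⟨0, (mem_ball_iff _ _).2 ?_⟩
    have h0 : nrm (0 : V d) = 0 := by simp [nrm, nsq]
    rw [h0]; exact hx0.le
  have hk1 : k + 1 = bn d n := by omega
  have hballx : ((ball d x).card : ℝ) ≤ om d * 2^d * x^(d:ℝ) := by
    refine (ball_card_le d hd x hx0.le).trans ?_
    rw [Real.rpow_natCast, mul_assoc, ← mul_pow]
    have := Real.sqrt_nonneg (d:ℝ)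
    gcongr
    linarith
  have hkp : (k:ℝ) ≤ x^((d:ℝ)+1) := by
    have : (k:ℝ) ≤ (ball d x).card := by
      rw [← hbn]; exact_mod_cast (by omega)
    linarith
  set Z := (ball d R).filter (fun z => ρ ≤ nrm z) with hZ
  set M := x^((d:ℝ)-1/8) with hM
  have hM0 : 0 < M := by positivity
  have hZc : (Z.card:ℝ) ≤ om d * 2^d * x^(d:ℝ) := by
    refine le_trans ?_ hballx
    have : Z ⊆ ball d x := by
      intro z hz
      have := (mem_ball_iff z R).1 (Finset.mem_filter.1 hz).1
      exact (mem_ball_iff z x).2 (this.trans hRx)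
    exact_mod_cast Finset.card_le_card this
  have hmark := count_markov Z (fun z => {w | z ∉ uAggFrom ({0} : Finset (V d)) w k})
    (fun z _ => (A_meas d k) (MeasurableSet.of_discrete (s := {S : Finset (V d) | z ∉ S}))) (x^(-(1:ℝ)/4)) M hM0 (by
      intro z hz
      obtain ⟨a, b⟩ := Finset.mem_filter.1 hz
      exact f2 z b ((mem_ball_iff z R).1 a))
  have hmark2 : (Z.card:ℝ) * x^(-(1:ℝ)/4) / M ≤ om d * 2^d * x^(-(1:ℝ)/8) := by
    calc (Z.card:ℝ) * x^(-(1:ℝ)/4) / M ≤ (om d * 2^d * x^(d:ℝ)) * x^(-(1:ℝ)/4) / M := by gcongr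
      _ = om d * 2^d * (x^(d:ℝ) * x^(-(1:ℝ)/4) / M) := by ring
      _ = _ := by
        rw [hM, ← Real.rpow_add hx0, ← Real.rpow_sub hx0]; congr 2; ring
  have hmono := prob_mono (by omega) k (fun S : Finset (V d) => ∃ y ∈ S, x + x^(1 - τ/(2*(d:ℝ))) < nrm y)
    (fun S => M ≤ ∑ z ∈ Z, (if z ∉ S then (1:ℝ) else 0) ∨
      (((S.filter (fun y => R < nrm y)).card:ℝ) ≤ 1 * x^((d:ℝ)-τ) ∧ ∃ y ∈ S, R + x^(1 - τ/(2*(d:ℝ))) < nrm y)) (by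
    intro S hS hP
    by_cases h : M ≤ ∑ z ∈ Z, (if z ∉ S then (1:ℝ) else 0)
    · exact Or.inl h
    · right
      constructor
      · have h1 := card_split S ρ R M (not_le.1 h).le
        rw [hS.1, hk1, hbn] at h1
        rw [one_mul]
        exact h1.trans f3
      · obtain ⟨y, hy, hy2⟩ := hP
        exact ⟨y, hy, by linarith⟩)
  refine hmono.trans ?_
  have hun := measureReal_union_le (μ := μ0) {w | M ≤ ∑ z ∈ Z, (if z ∉ uAggFrom ({0} : Finset (V d)) w k then (1:ℝ) else 0)}
    {w | (((uAggFrom ({0} : Finset (V d)) w k).filter (fun y => R < nrm y)).card:ℝ) ≤ 1 * x^((d:ℝ)-τ) ∧ ∃ y ∈ uAggFrom ({0} : Finset (V d)) w k, R + x^(1 - τ/(2*(d:ℝ))) < nrm y}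
  have hlast := f1 k R hkp hR0
  have hsame : μ0.real {w | M ≤ ∑ z ∈ Z, (if z ∉ uAggFrom ({0} : Finset (V d)) w k then (1:ℝ) else 0)} ≤ om d * 2^d * x^(-(1:ℝ)/8) := by
    refine le_trans (le_of_eq ?_) (hmark.trans hmark2)
    congr 1
    ext w
    simp only [Set.mem_setOf_eq, Set.indicator]
  refine hun.trans ?_
  linarith

end UI

end

section
open MeasureTheory Filter Set
namespace UI

lemma bn_mono (d : ℕ) {m n : ℕ} (h : m ≤ n) : bn d m ≤ bn d n := by
  apply Finset.card_le_card
  intro z hz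
  have h' : (m:ℝ) ≤ n := by exact_mod_cast h
  exact (mem_ball_iff z _).2 (((mem_ball_iff z _).1 hz).trans h')

lemma interp_bound (σ : ℝ) (hσ0 : 0 < σ) (hσ : σ ≤ 1/32) (n J : ℝ) (hn : 1 ≤ n) (hJ0 : 0 ≤ J) (h1 : n ≤ J^32) (h2 : J ≤ n^((1:ℝ)/32) + 1) :
    J^32 + (J^32)^(1-σ) ≤ n * (1 + (2*(32*2^31)+1) * n^(-σ)) := by
  have hn0 : 0 < n := by linarith
  set t := n^((1:ℝ)/32) with ht
  have ht1 : 1 ≤ t := Real.one_le_rpow hn (by norm_num)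
  have ht0 : 0 < t := by linarith
  have htn : t^32 = n := by
    rw [ht, ← Real.rpow_natCast, ← Real.rpow_mul hn0.le]; norm_num
  set u := t⁻¹ with hu
  have hu0 : 0 < u := by positivity
  have hu1 : u ≤ 1 := inv_le_one_of_one_le₀ ht1
  have hus : u ≤ n^(-σ) := by
    rw [hu, ht, ← Real.rpow_neg hn0.le]
    exact Real.rpow_le_rpow_of_exponent_le hn (by linarith)
  set s := n^(-σ) with hs
  have hs0 : 0 < s := by positivity
  set K : ℝ := 32*2^31 with hK
  have hK0 : 0 < K := by positivity
  have a1 : (1+u)^32 ≤ 1 + K * u := by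
    have := abs_pow_sub_pow_le (1+u) 1 32
    rw [abs_of_nonneg (a := 1+u) (by linarith), abs_of_nonneg (a := 1+u-1) (by linarith), abs_one, max_eq_left (by linarith)] at this
    have b := le_abs_self ((1+u)^32 - 1^32)
    have c : (1+u)^31 ≤ 2^31 := pow_le_pow_left₀ (by linarith) (by linarith) 31
    have e : (1+u-1) * ((32:ℕ):ℝ) * (1+u)^(32-1) ≤ K * u := by
      have : (1+u-1) * ((32:ℕ):ℝ) * (1+u)^(32-1) = 32 * u * (1+u)^31 := by push_cast; ring
      rw [this]
      calc 32 * u * (1+u)^31 ≤ 32 * u * 2^31 := by gcongr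
        _ = K * u := by rw [hK]; ring
    rw [one_pow] at this b
    linarith
  have a2 : J^32 ≤ n * (1 + K * u) := by
    calc J^32 ≤ (t+1)^32 := pow_le_pow_left₀ hJ0 h2 32
      _ = n * (1+u)^32 := by
        rw [← htn, ← mul_pow]; congr 1; rw [hu]; field_simp
      _ ≤ _ := by gcongr
  have hN0 : 0 < J^32 := by linarith
  have a3 : (J^32)^(1-σ) = J^32 * (J^32)^(-σ) := by
    nth_rw 2 [← Real.rpow_one (J^32)]; rw [← Real.rpow_add hN0]; congr 1
  have a4 : (J^32)^(-σ) ≤ s := Real.rpow_le_rpow_of_nonpos hn0 h1 (by linarith)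
  have a5 : J^32 ≤ n * (1 + K) := a2.trans (by gcongr; nlinarith)
  rw [a3]
  calc J^32 + J^32 * (J^32)^(-σ) ≤ n * (1 + K * s) + n * (1+K) * s := by
        apply add_le_add
        · exact a2.trans (by gcongr)
        · gcongr
    _ = n * (1 + (2*K+1)*s) := by ring

lemma subseq_as (d : ℕ) (hd : 2 ≤ d) : ∀ᵐ w ∂μ0, ∀ᶠ j : ℕ in atTop, ∀ y ∈ uAggFrom ({0} : Finset (V d)) w (bn d (j^32) - 1),
    nrm y ≤ ((j:ℝ)^32) + ((j:ℝ)^32)^(1 - 1/(64*(d:ℝ))/(2*(d:ℝ))) := by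
  have h0 := (tendsto_pow_atTop (α := ℕ) (n := 32) (by norm_num)).eventually (prob_n d hd)
  set E : ℕ → Set ℝ := fun j => {w | ∃ y ∈ uAggFrom ({0} : Finset (V d)) w (bn d (j^32) - 1), ((j^32:ℕ):ℝ) + ((j^32:ℕ):ℝ)^(1 - 1/(64*(d:ℝ))/(2*(d:ℝ))) < nrm y} with hE
  have hsum : Summable (fun j => μ0.real (E j)) := by
    refine Summable.of_norm_bounded_eventually_nat (g := fun j : ℕ => 1/(j:ℝ)^2) (Real.summable_one_div_nat_pow.2 (by norm_num)) ?_
    filter_upwards [h0, eventually_gt_atTop 0] with j hj hj0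
    rw [Real.norm_of_nonneg measureReal_nonneg]
    refine hj.trans (le_of_eq ?_)
    have hj1 : (0:ℝ) < j := by exact_mod_cast hj0
    push_cast
    rw [← Real.rpow_natCast, ← Real.rpow_mul hj1.le, one_div, ← Real.rpow_natCast, ← Real.rpow_neg hj1.le]
    norm_num
  have hE2 : (∑' j, μ0 (E j)) ≠ ⊤ := by
    have := hsum.tsum_ofReal_ne_top
    convert this using 3 with j
    rw [ofReal_measureReal]
  filter_upwards [ae_eventually_notMem hE2] with w hw
  filter_upwards [hw] with j hj y hy
  by_contra hcon
  apply hj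
  refine ⟨y, hy, ?_⟩
  push_cast
  exact not_le.1 hcon

lemma final (d : ℕ) (hd : 2 ≤ d) :
    ∃ c C : ℝ, 0 < c ∧ 0 < C ∧
      ∀ᵐ ω ∂μ0, ∀ᶠ n : ℕ in atTop,
        uAggFrom ({0} : Finset (V d)) ω (bn d n - 1) ⊆
          ball d ((n : ℝ) * (1 + C * (n : ℝ) ^ (-c))) := by
  have hd' : (2:ℝ) ≤ d := by exact_mod_cast hd
  set σ := 1/(64*(d:ℝ))/(2*(d:ℝ)) with hσ
  have hσ0 : 0 < σ := by positivity
  have hσ1 : σ ≤ 1/32 := by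
    rw [hσ, div_div]
    apply one_div_le_one_div_of_le (by norm_num)
    nlinarith
  refine ⟨σ, 2*(32*2^31)+1, hσ0, by positivity, ?_⟩
  have ht : Tendsto (fun n : ℕ => ⌊(n:ℝ)^((1:ℝ)/32)⌋₊ + 1) atTop atTop :=
    (tendsto_add_atTop_nat 1).comp (tendsto_nat_floor_atTop.comp ((tendsto_rpow_atTop (by norm_num)).comp tendsto_natCast_atTop_atTop))
  filter_upwards [subseq_as d hd] with w hw
  filter_upwards [ht.eventually hw, eventually_ge_atTop 1] with n hn hn1 y hy
  set J := ⌊(n:ℝ)^((1:ℝ)/32)⌋₊ + 1 with hJ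
  have hn1' : (1:ℝ) ≤ n := by exact_mod_cast hn1
  have hn0 : (0:ℝ) ≤ n := by linarith
  have b1 : (n:ℝ) ≤ (J:ℝ)^32 := by
    have : (n:ℝ)^((1:ℝ)/32) ≤ J := by
      rw [hJ]; push_cast; exact (Nat.lt_floor_add_one _).le
    calc (n:ℝ) = ((n:ℝ)^((1:ℝ)/32))^32 := by
          rw [← Real.rpow_natCast, ← Real.rpow_mul hn0]; norm_num
      _ ≤ _ := by gcongr
  have b2 : (J:ℝ) ≤ (n:ℝ)^((1:ℝ)/32) + 1 := by
    rw [hJ]; push_cast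
    have := Nat.floor_le (a := (n:ℝ)^((1:ℝ)/32)) (by positivity)
    linarith
  have b3 : n ≤ J^32 := by exact_mod_cast b1
  have hy2 : y ∈ uAggFrom ({0} : Finset (V d)) w (bn d (J^32) - 1) :=
    A_mono d w (Nat.sub_le_sub_right (bn_mono d b3) 1) hy
  exact (mem_ball_iff y _).2 ((hn y hy2).trans (interp_bound σ hσ0 hσ1 n J hn1' (Nat.cast_nonneg _) b1 b2))

end UI

end

theorem statement19 (d : ℕ) (hd : 2 ≤ d) :
    ∃ c C : ℝ, 0 < c ∧ 0 < C ∧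
      ∀ᵐ ω ∂μ0, ∀ᶠ n : ℕ in atTop,
        uAggFrom ({0} : Finset (V d)) ω (bn d n - 1) ⊆
          ball d ((n : ℝ) * (1 + C * (n : ℝ) ^ (-c))) := by
  exact UI.final d hd
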